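/- Let θ ∈ C^{m,ς} with m ∈ ℤ≥0 and ς ∈ (0,1]. Then there exist a function d on Δ with d^{(k)}(±1) = 0 for k ∈ {0,…,m}, and a polynomial ℓ with deg ℓ ≤ 2m+1, such that sr^± · S(θ/sr⁺) = ± d + sr^± · ℓ on Δ°, where d ∈ C^{m,ς} when ς ∈ (0,1/2) ∪ (1/2,1), while d ∈ C^{m,ς-ε} for every sufficiently small ε > 0 when ς = 1/2 or ς = 1. -/

import Mathlib

open Complex MeasureTheory Filter Topology Set Metric Polynomial
open scoped ENNReal NNReal

noncomputable section

/-- The segment `[-1,1]` viewed inside `ℂ`. -/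
def realSeg : Set ℂ := (fun x : ℝ => (x : ℂ)) '' Set.Icc (-1) 1

/-- A closed analytic Jordan arc with endpoints `-1` and `1`: the image of `[-1,1]`
under a holomorphic univalent map defined on a neighborhood of `[-1,1]`. -/
structure AnalyticArc where
  U : Set ℂ
  Ξ : ℂ → ℂ
  isOpen_U : IsOpen U
  seg_sub : realSeg ⊆ U
  diff : DifferentiableOn ℂ Ξ U
  inj : Set.InjOn Ξ U
  map_neg_one : Ξ (-1) = -1
  map_one : Ξ 1 = 1

/-- The arc itself. -/
def AnalyticArc.arc (A : AnalyticArc) : Set ℂ := A.Ξ '' realSeg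

/-- The open arc `Δ° = Δ \ {±1}`. -/
def AnalyticArc.arcInt (A : AnalyticArc) : Set ℂ := A.arc \ {1, -1}

/-- Boundary value from the left (`+`) side of the arc. -/
def BVplus {E : Type*} [TopologicalSpace E] (Ξ : ℂ → ℂ) (f : ℂ → E) (fp : ℂ → E) : Prop :=
  ∀ x ∈ Set.Ioo (-1:ℝ) 1,
    Tendsto (fun y : ℝ => f (Ξ (x + y * Complex.I))) (𝓝[>] 0) (𝓝 (fp (Ξ (x:ℂ))))

/-- Boundary value from the right (`-`) side of the arc. -/
def BVminus {E : Type*} [TopologicalSpace E] (Ξ : ℂ → ℂ) (f : ℂ → E) (fm : ℂ → E) : Prop :=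
  ∀ x ∈ Set.Ioo (-1:ℝ) 1,
    Tendsto (fun y : ℝ => f (Ξ (x + y * Complex.I))) (𝓝[<] 0) (𝓝 (fm (Ξ (x:ℂ))))

/-- The branch of `√(z²-1)` holomorphic off the arc with `sr z / z → 1` at infinity. -/
structure SqrtBranch (A : AnalyticArc) where
  sr : ℂ → ℂ
  diff : DifferentiableOn ℂ sr A.arcᶜ
  sq : ∀ z ∈ A.arcᶜ, sr z ^ 2 = z ^ 2 - 1
  at_inf : Tendsto (fun z => sr z / z) (Bornology.cobounded ℂ) (𝓝 1)

/-- `φ(z) = z + sr z`. -/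
def SqrtBranch.φ {A : AnalyticArc} (S : SqrtBranch A) (z : ℂ) : ℂ := z + S.sr z

/-- The function `r_n` associated to a polynomial `v` with no zeros on the arc. -/
def rFun {A : AnalyticArc} (S : SqrtBranch A) (v : Polynomial ℂ) (n : ℕ) (z : ℂ) : ℂ :=
  (1 / S.φ z) ^ (2 * n - v.natDegree) *
    ((v.roots.map fun e => (S.φ z - S.φ e) / (1 - S.φ e * S.φ z)).prod)


/-- `IsPV A g τ v` : the principal value integral `∫_Δ g(t)/(t-τ) dt` exists and equals `v`,
computed through the analytic parametrization of the arc. -/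
def IsPV (A : AnalyticArc) (g : ℂ → ℂ) (τ v : ℂ) : Prop :=
  Filter.Tendsto (fun ε : ℝ =>
      ∫ x in {x ∈ Set.Icc (-1:ℝ) 1 | ε ≤ ‖A.Ξ (x:ℂ) - τ‖},
        g (A.Ξ (x:ℂ)) / (A.Ξ (x:ℂ) - τ) * deriv A.Ξ (x:ℂ))
    (𝓝[>] 0) (𝓝 v)

/-- The fractional Sobolev class `W_p^{1-1/p}(Δ)`, expressed through the analytic
parametrization of the arc (with arclength density `|Ξ'|`):
`∬_{Δ×Δ} |(θ(x)-θ(y))/(x-y)|^p |dx||dy| < ∞`. -/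
def SobWOn (A : AnalyticArc) (p : ℝ) (θ : ℂ → ℂ) : Prop :=
  (∫⁻ x in Set.Icc (-1:ℝ) 1, ∫⁻ y in Set.Icc (-1:ℝ) 1,
    ENNReal.ofReal ((‖θ (A.Ξ (x:ℂ)) - θ (A.Ξ (y:ℂ))‖ / ‖A.Ξ (x:ℂ) - A.Ξ (y:ℂ)‖) ^ p
      * ‖deriv A.Ξ (x:ℂ)‖ * ‖deriv A.Ξ (y:ℂ)‖)) < ⊤

/-- A system of derivatives of `θ` with respect to arclength along the arc `Δ`,
expressed through the analytic parametrization `Ξ`. -/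
structure ArcCm (A : AnalyticArc) (m : ℕ) (θ : ℂ → ℂ) where
  d : ℕ → ℂ → ℂ
  d0 : d 0 = θ
  hd : ∀ k < m, ∀ x ∈ Set.Icc (-1:ℝ) 1,
    HasDerivWithinAt (fun t : ℝ => d k (A.Ξ (t:ℂ)))
      (d (k + 1) (A.Ξ (x:ℂ)) * (‖deriv A.Ξ (x:ℂ)‖ : ℂ)) (Set.Icc (-1) 1) x

/-- The Hölder class `C^{m,ς}(Δ)` (w.r.t. arclength). -/
def ArcCmHolder (A : AnalyticArc) (m : ℕ) (ς : ℝ) (θ : ℂ → ℂ) : Prop :=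
  ∃ D : ArcCm A m θ, ∃ C : ℝ≥0, HolderOnWith C ς.toNNReal (D.d m) A.arc

/-! ### Hölder classes on `[-1,1]` -/

/-- Hölder continuity with exponent `s` on `[-1,1]`. -/
def HolderI (s : ℝ) (v : ℝ → ℂ) : Prop :=
  ∃ C : ℝ, ∀ x ∈ Icc (-1:ℝ) 1, ∀ y ∈ Icc (-1:ℝ) 1, ‖v x - v y‖ ≤ C * |x - y| ^ s

/-- `m` times differentiable functions on `[-1,1]` whose `m`-th derivative is Hölder continuous
for all exponents in `T`; when `z` holds, all derivatives are asked to vanish at `±1`. -/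
def HolderClass (z : Prop) (T : Set ℝ) : ℕ → (ℝ → ℂ) → Prop
  | 0, v => (z → v 1 = 0 ∧ v (-1) = 0) ∧ ∀ s ∈ T, HolderI s v
  | m + 1, v => (z → v 1 = 0 ∧ v (-1) = 0) ∧ ∃ v' : ℝ → ℂ,
      (∀ x ∈ Icc (-1:ℝ) 1, HasDerivWithinAt v (v' x) (Icc (-1) 1) x) ∧ HolderClass z T m v'

lemma one_mem_segI : (1:ℝ) ∈ Icc (-1:ℝ) 1 := by norm_num
lemma neg_one_mem_segI : (-1:ℝ) ∈ Icc (-1:ℝ) 1 := by norm_num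

lemma HolderI.nonneg_const {s : ℝ} {v : ℝ → ℂ} (h : HolderI s v) :
    ∃ C : ℝ, 0 ≤ C ∧ ∀ x ∈ Icc (-1:ℝ) 1, ∀ y ∈ Icc (-1:ℝ) 1, ‖v x - v y‖ ≤ C * |x - y| ^ s := by
  obtain ⟨C, hC⟩ := h
  refine ⟨|C|, abs_nonneg _, fun x hx y hy => (hC x hx y hy).trans ?_⟩
  exact mul_le_mul_of_nonneg_right (le_abs_self C) (Real.rpow_nonneg (abs_nonneg _) _)

lemma abs_sub_rpow_le_two {s : ℝ} (hs : 0 ≤ s) (hs1 : s ≤ 1) {x y : ℝ} (hx : x ∈ Icc (-1:ℝ) 1)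
    (hy : y ∈ Icc (-1:ℝ) 1) : |x - y| ^ s ≤ 2 := by
  have h2 : |x - y| ≤ 2 := abs_le.2 ⟨by linarith [hx.1, hy.2], by linarith [hx.2, hy.1]⟩
  calc |x - y| ^ s ≤ (2:ℝ) ^ s := Real.rpow_le_rpow (abs_nonneg _) h2 hs
    _ ≤ (2:ℝ) ^ (1:ℝ) := Real.rpow_le_rpow_of_exponent_le (by norm_num) hs1
    _ = 2 := by norm_num

lemma HolderI.bounded {s : ℝ} (hs : 0 ≤ s) (hs1 : s ≤ 1) {v : ℝ → ℂ} (h : HolderI s v) :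
    ∃ B : ℝ, 0 ≤ B ∧ ∀ x ∈ Icc (-1:ℝ) 1, ‖v x‖ ≤ B := by
  obtain ⟨C, hC0, hC⟩ := h.nonneg_const
  refine ⟨C * 2 + ‖v 1‖, by positivity, fun x hx => ?_⟩
  have h1 := hC x hx 1 one_mem_segI
  have h2 := mul_le_mul_of_nonneg_left (abs_sub_rpow_le_two hs hs1 hx one_mem_segI) hC0
  have h3 := norm_sub_norm_le (v x) (v 1)
  linarith

lemma HolderI.continuousOn {s : ℝ} (hs : 0 < s) {v : ℝ → ℂ} (h : HolderI s v) :
    ContinuousOn v (Icc (-1) 1) := by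
  obtain ⟨C, hC⟩ := h
  intro x hx
  rw [ContinuousWithinAt, tendsto_iff_norm_sub_tendsto_zero]
  have hlim : Tendsto (fun y : ℝ => C * |y - x| ^ s) (𝓝[Icc (-1) 1] x) (𝓝 0) := by
    have : ContinuousAt (fun y : ℝ => C * |y - x| ^ s) x :=
      continuousAt_const.mul ((by fun_prop : ContinuousAt (fun y : ℝ => |y - x|) x).rpow_const
        (Or.inr hs.le))
    have h2 := this.tendsto
    simp only [sub_self, abs_zero, Real.zero_rpow hs.ne', mul_zero] at h2
    exact h2.mono_left nhdsWithin_le_nhds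
  refine squeeze_zero' (Eventually.of_forall fun _ => norm_nonneg _) ?_ hlim
  filter_upwards [self_mem_nhdsWithin] with y hy using hC y hy x hx

lemma HolderI.congr {s : ℝ} {v w : ℝ → ℂ} (h : HolderI s v) (hvw : EqOn w v (Icc (-1) 1)) :
    HolderI s w := by
  obtain ⟨C, hC⟩ := h
  exact ⟨C, fun x hx y hy => by rw [hvw hx, hvw hy]; exact hC x hx y hy⟩

lemma HolderI.add {s : ℝ} {v w : ℝ → ℂ} (hv : HolderI s v) (hw : HolderI s w) :
    HolderI s (fun x => v x + w x) := by
  obtain ⟨C, hC⟩ := hv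
  obtain ⟨D, hD⟩ := hw
  refine ⟨C + D, fun x hx y hy => ?_⟩
  calc ‖v x + w x - (v y + w y)‖ = ‖(v x - v y) + (w x - w y)‖ := by congr 1; ring
    _ ≤ ‖v x - v y‖ + ‖w x - w y‖ := norm_add_le _ _
    _ ≤ (C + D) * |x - y| ^ s := by rw [add_mul]; exact add_le_add (hC x hx y hy) (hD x hx y hy)

lemma HolderI.mul {s : ℝ} (hs : 0 ≤ s) (hs1 : s ≤ 1) {v w : ℝ → ℂ} (hv : HolderI s v)
    (hw : HolderI s w) : HolderI s (fun x => v x * w x) := by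
  obtain ⟨A, hA0, hA⟩ := hv.bounded hs hs1
  obtain ⟨B, hB0, hB⟩ := hw.bounded hs hs1
  obtain ⟨C, hC⟩ := hv
  obtain ⟨D, hD⟩ := hw
  refine ⟨C * B + A * D, fun x hx y hy => ?_⟩
  have e : v x * w x - v y * w y = (v x - v y) * w x + v y * (w x - w y) := by ring
  rw [e]
  refine (norm_add_le _ _).trans ?_
  rw [norm_mul, norm_mul]
  have h1 : ‖v x - v y‖ * ‖w x‖ ≤ C * |x - y| ^ s * B :=
    mul_le_mul (hC x hx y hy) (hB x hx) (norm_nonneg _) ((norm_nonneg _).trans (hC x hx y hy))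
  have h2 : ‖v y‖ * ‖w x - w y‖ ≤ A * (D * |x - y| ^ s) :=
    mul_le_mul (hA y hy) (hD x hx y hy) (norm_nonneg _) hA0
  nlinarith

lemma HolderI.mono {s t : ℝ} (ht : t ≤ s) (hs1 : s ≤ 1) (ht0 : 0 < t) {v : ℝ → ℂ}
    (hv : HolderI s v) : HolderI t v := by
  obtain ⟨C, hC0, hC⟩ := hv.nonneg_const
  refine ⟨C * 2, fun x hx y hy => (hC x hx y hy).trans ?_⟩
  rw [mul_assoc]
  refine mul_le_mul_of_nonneg_left ?_ hC0
  rcases eq_or_ne |x - y| 0 with h0 | h0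
  · rw [h0, Real.zero_rpow (by linarith), Real.zero_rpow ht0.ne']; norm_num
  have hpos : 0 < |x - y| := lt_of_le_of_ne (abs_nonneg _) h0.symm
  have : |x - y| ^ s = |x - y| ^ (s - t) * |x - y| ^ t := by
    rw [← Real.rpow_add hpos]; congr 1; ring
  rw [this]
  exact mul_le_mul_of_nonneg_right
    (abs_sub_rpow_le_two (by linarith) (by linarith) hx hy) (Real.rpow_nonneg (abs_nonneg _) _)

/-- A function with bounded derivative on `[-1,1]` is Hölder continuous for all exponents. -/
lemma HolderI.of_hasDerivWithinAt {s B : ℝ} (hs : 0 < s) (hs1 : s ≤ 1) {v v' : ℝ → ℂ}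
    (hv : ∀ x ∈ Icc (-1:ℝ) 1, HasDerivWithinAt v (v' x) (Icc (-1) 1) x)
    (hB : ∀ x ∈ Icc (-1:ℝ) 1, ‖v' x‖ ≤ B) : HolderI s v := by
  have h1 : HolderI 1 v := by
    refine ⟨B, fun x hx y hy => ?_⟩
    rw [Real.rpow_one, ← Real.norm_eq_abs]
    exact (convex_Icc (-1:ℝ) 1).norm_image_sub_le_of_norm_hasDerivWithin_le hv hB hy hx
  exact h1.mono hs1 le_rfl hs

namespace HolderClass

variable {z : Prop} {T : Set ℝ} {m : ℕ} {v w : ℝ → ℂ}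

lemma vanish (h : HolderClass z T m v) : z → v 1 = 0 ∧ v (-1) = 0 := by
  cases m <;> exact h.1

lemma congr (h : HolderClass z T m v) (hvw : EqOn w v (Icc (-1) 1)) : HolderClass z T m w := by
  cases m with
  | zero =>
    exact ⟨fun hz => by rw [hvw one_mem_segI, hvw neg_one_mem_segI]; exact h.1 hz,
      fun s hs => (h.2 s hs).congr hvw⟩
  | succ m =>
    obtain ⟨h1, v', hv', h2⟩ := h
    exact ⟨fun hz => by rw [hvw one_mem_segI, hvw neg_one_mem_segI]; exact h1 hz, v',
      fun x hx => (hv' x hx).congr hvw (hvw hx), h2⟩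

lemma holderI_zero (hT : T ⊆ Ioo 0 1) (h : HolderClass z T m v) {s : ℝ} (hs : s ∈ T) :
    HolderI s v := by
  induction m generalizing v with
  | zero => exact h.2 s hs
  | succ m ih =>
    obtain ⟨-, v', hv', h2⟩ := h
    obtain ⟨B, -, hB⟩ := (ih h2).bounded (hT hs).1.le (hT hs).2.le
    exact HolderI.of_hasDerivWithinAt (hT hs).1 (hT hs).2.le hv' hB

lemma of_succ (hT : T ⊆ Ioo 0 1) (h : HolderClass z T (m + 1) v) : HolderClass z T m v := by
  induction m generalizing v with
  | zero => exact ⟨h.vanish, fun s hs => h.holderI_zero hT hs⟩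
  | succ m ih =>
    obtain ⟨h1, v', hv', h2⟩ := h
    exact ⟨h1, v', hv', ih h2⟩

lemma add (hv : HolderClass z T m v) (hw : HolderClass z T m w) :
    HolderClass z T m (fun x => v x + w x) := by
  have hz : z → v 1 + w 1 = 0 ∧ v (-1) + w (-1) = 0 := fun hz => by
    simp [hv.vanish hz, hw.vanish hz]
  induction m generalizing v w with
  | zero => exact ⟨hz, fun s hs => (hv.2 s hs).add (hw.2 s hs)⟩
  | succ m ih =>
    obtain ⟨h1, v', hv', h2⟩ := hv
    obtain ⟨k1, w', hw', k2⟩ := hw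
    exact ⟨hz, _, fun x hx => (hv' x hx).add (hw' x hx), ih h2 k2 fun hz => by
      simp [h2.vanish hz, k2.vanish hz]⟩

lemma mul (hT : T ⊆ Ioo 0 1) (hv : HolderClass z T m v) (hw : HolderClass False T m w) :
    HolderClass z T m (fun x => v x * w x) := by
  have hz : z → v 1 * w 1 = 0 ∧ v (-1) * w (-1) = 0 := fun hz => by
    simp [hv.vanish hz]
  induction m generalizing v w with
  | zero => exact ⟨hz, fun s hs => (hv.2 s hs).mul (hT hs).1.le (hT hs).2.le (hw.2 s hs)⟩
  | succ m ih =>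
    have hv0 := hv.of_succ hT
    have hw0 := hw.of_succ hT
    obtain ⟨h1, v', hv', h2⟩ := hv
    obtain ⟨k1, w', hw', k2⟩ := hw
    refine ⟨hz, _, fun x hx => (hv' x hx).mul (hw' x hx), ?_⟩
    exact (ih h2 hw0 fun hz => by simp [h2.vanish hz]).add
      (ih hv0 k2 fun hz => by simp [hv0.vanish hz])

lemma const (c : ℂ) : HolderClass False T m (fun _ => c) := by
  induction m generalizing c with
  | zero => exact ⟨False.elim, fun s _ => ⟨0, fun _ _ _ _ => by simp⟩⟩
  | succ m ih => exact ⟨False.elim, fun _ => 0, fun _ _ => hasDerivWithinAt_const _ _ _, ih 0⟩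

lemma const_mul (hT : T ⊆ Ioo 0 1) (c : ℂ) (hv : HolderClass z T m v) :
    HolderClass z T m (fun x => c * v x) :=
  (hv.mul hT (const c)).congr fun _ _ => mul_comm _ _

lemma of_contDiffAt (hT : T ⊆ Ioo 0 1)
    (h : ∀ x ∈ Icc (-1:ℝ) 1, ContDiffAt ℝ (⊤ : ℕ∞) v x) : HolderClass False T m v := by
  have hd : ∀ {v : ℝ → ℂ}, (∀ x ∈ Icc (-1:ℝ) 1, ContDiffAt ℝ (⊤ : ℕ∞) v x) →
      (∀ x ∈ Icc (-1:ℝ) 1, ContDiffAt ℝ (⊤ : ℕ∞) (deriv v) x) ∧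
      ∀ x ∈ Icc (-1:ℝ) 1, HasDerivWithinAt v (deriv v x) (Icc (-1) 1) x := by
    intro v h
    refine ⟨fun x hx => ?_, fun x hx => ?_⟩
    · exact ((h x hx).fderiv_right (m := (⊤ : ℕ∞)) (by simp)).clm_apply contDiffAt_const
    · exact ((h x hx).differentiableAt (by simp)).hasDerivAt.hasDerivWithinAt
  induction m generalizing v with
  | zero =>
    refine ⟨False.elim, fun s hs => ?_⟩
    have hc : ContinuousOn (deriv v) (Icc (-1) 1) := fun x hx =>
      ((hd h).1 x hx).continuousAt.continuousWithinAt
    obtain ⟨B, hB⟩ := isCompact_Icc.exists_bound_of_continuousOn hc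
    exact HolderI.of_hasDerivWithinAt (hT hs).1 (hT hs).2.le (hd h).2 hB
  | succ m ih => exact ⟨False.elim, deriv v, (hd h).2, ih (hd h).1⟩

lemma of_differentiableOn (hT : T ⊆ Ioo 0 1) {F : ℂ → ℂ} {N : Set ℂ} (hN : IsOpen N)
    (hs : realSeg ⊆ N) (hF : DifferentiableOn ℂ F N) :
    HolderClass False T m (fun x : ℝ => F x) := by
  refine of_contDiffAt hT fun x hx => ?_
  have hxN : (x:ℂ) ∈ N := hs ⟨x, hx, rfl⟩
  have h1 : ContDiffAt ℂ (⊤ : ℕ∞) F x := (hF.analyticAt (hN.mem_nhds hxN)).contDiffAt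
  exact (h1.restrict_scalars ℝ).comp x Complex.ofRealCLM.contDiff.contDiffAt

/-- The weights `(1-x²)^r` with `r ≥ m+1` belong to the vanishing classes. -/
lemma weight (hT : T ⊆ Ioo 0 1) {r : ℝ} (hr : (m:ℝ) + 1 ≤ r) :
    HolderClass z T m (fun x => (((1 - x ^ 2) ^ r : ℝ) : ℂ)) := by
  have hr1 : 1 ≤ r := by have := Nat.cast_nonneg (α := ℝ) m; linarith
  have hd : ∀ {r : ℝ}, 1 ≤ r → ∀ x : ℝ, HasDerivAt (fun x : ℝ => (((1 - x ^ 2) ^ r : ℝ) : ℂ))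
      ((-2 * r * x : ℝ) * (((1 - x ^ 2) ^ (r - 1) : ℝ) : ℂ)) x := by
    intro r hr x
    have h1 : HasDerivAt (fun x : ℝ => 1 - x ^ 2) (-(2 * x)) x := by
      simpa using (hasDerivAt_pow 2 x).const_sub 1
    have h2 := (h1.rpow_const (p := r) (Or.inr hr)).ofReal_comp
    convert h2 using 1
    push_cast; ring
  have hz : ∀ {r : ℝ}, 1 ≤ r → z → (fun x : ℝ => (((1 - x ^ 2) ^ r : ℝ) : ℂ)) 1 = 0 ∧
      (fun x : ℝ => (((1 - x ^ 2) ^ r : ℝ) : ℂ)) (-1) = 0 := by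
    intro r hr _
    have : r ≠ 0 := by linarith
    constructor <;> norm_num [Real.zero_rpow this]
  induction m generalizing r with
  | zero =>
    refine ⟨hz hr1, fun s hs => ?_⟩
    have hc : ContinuousOn (fun x : ℝ => ((-2 * r * x : ℝ) * (((1 - x ^ 2) ^ (r - 1) : ℝ) : ℂ)))
        (Icc (-1) 1) := by
      refine Continuous.continuousOn ?_
      refine (by fun_prop : Continuous fun x : ℝ => ((-2 * r * x : ℝ) : ℂ)).mul
        (Complex.continuous_ofReal.comp ?_)
      exact (by fun_prop : Continuous fun x : ℝ => 1 - x ^ 2).rpow_const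
        fun x => Or.inr (by linarith)
    obtain ⟨B, hB⟩ := isCompact_Icc.exists_bound_of_continuousOn hc
    exact HolderI.of_hasDerivWithinAt (hT hs).1 (hT hs).2.le
      (fun x _ => (hd hr1 x).hasDerivWithinAt) hB
  | succ m ih =>
    push_cast at hr
    have hm := Nat.cast_nonneg (α := ℝ) m
    refine ⟨hz hr1, _, fun x _ => (hd hr1 x).hasDerivWithinAt, ?_⟩
    have hlin : HolderClass False T m (fun x : ℝ => ((-2 * r * x : ℝ) : ℂ)) := by
      refine of_contDiffAt hT fun x _ => ?_
      exact Complex.ofRealCLM.contDiff.contDiffAt.comp x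
        (contDiffAt_const.mul contDiffAt_id : ContDiffAt ℝ _ (fun x : ℝ => (-2 * r) * x) x)
    exact ((ih (r := r - 1) (by linarith) (by linarith)).mul hT hlin).congr
      fun x _ => mul_comm _ _

end HolderClass

/-! ### The periodic conjugation operator -/

/-- The kernel `cot (x/2)`. -/
def cotH (x : ℝ) : ℝ := Real.cos (x / 2) / Real.sin (x / 2)

/-- The (non-normalized) conjugate function of a `2π`-periodic function. -/
def conjInt (W : ℝ → ℂ) (a : ℝ) : ℂ :=
  ∫ x in (-Real.pi)..Real.pi, (W (a + x) - W a) * (cotH x : ℂ)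

lemma measurable_cotH : Measurable cotH := by
  unfold cotH; fun_prop

lemma cotH_neg (x : ℝ) : cotH (-x) = -cotH x := by
  simp [cotH, neg_div, div_neg]

lemma cotH_periodic : Function.Periodic cotH (2 * Real.pi) := by
  intro x
  have : (x + 2 * Real.pi) / 2 = x / 2 + Real.pi := by ring
  rw [cotH, cotH, this, Real.cos_add_pi, Real.sin_add_pi, neg_div_neg_eq]

lemma abs_sin_half_ge {x : ℝ} (hx : |x| ≤ 3 * Real.pi / 2) : |x| / 10 ≤ |Real.sin (x / 2)| := by
  have key : ∀ y : ℝ, 0 ≤ y → y ≤ 3 * Real.pi / 2 → y / 10 ≤ Real.sin (y / 2) := by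
    intro y h0 h1
    have hpi := Real.pi_pos
    have hpi4 := Real.pi_le_four
    rcases le_total y Real.pi with h | h
    · have := Real.mul_le_sin (x := y / 2) (by linarith) (by linarith)
      refine le_trans ?_ this
      have : y / 10 = (Real.pi / 10) * (y / Real.pi) := by field_simp
      rw [this]
      have : 2 / Real.pi * (y / 2) = 1 * (y / Real.pi) := by ring
      rw [this]
      exact mul_le_mul_of_nonneg_right (by linarith) (by positivity)
    · have := Real.mul_le_sin (x := Real.pi - y / 2) (by linarith) (by linarith)
      rw [Real.sin_pi_sub] at this
      refine le_trans ?_ this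
      have h3 : 2 / Real.pi * (Real.pi / 4) ≤ 2 / Real.pi * (Real.pi - y / 2) :=
        mul_le_mul_of_nonneg_left (by linarith) (by positivity)
      have h4 : 2 / Real.pi * (Real.pi / 4) = 1 / 2 := by field_simp; norm_num
      have := Real.pi_lt_d2
      linarith
  rcases le_total 0 x with h | h
  · rw [abs_of_nonneg h] at *
    exact (key x h hx).trans (le_abs_self _)
  · rw [abs_of_nonpos h] at *
    have := key (-x) (by linarith) hx
    rw [neg_div 2 x, Real.sin_neg] at this
    exact this.trans (neg_le_abs _)

lemma abs_cotH_le {x : ℝ} (hx : |x| ≤ 3 * Real.pi / 2) : |cotH x| ≤ 10 / |x| := by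
  rcases eq_or_ne x 0 with rfl | h0
  · simp [cotH]
  have hpos : 0 < |x| := abs_pos.2 h0
  have h1 := abs_sin_half_ge hx
  rw [cotH, abs_div]
  calc |Real.cos (x / 2)| / |Real.sin (x / 2)| ≤ 1 / (|x| / 10) :=
        div_le_div₀ zero_le_one (Real.abs_cos_le_one _) (by positivity) h1
    _ = 10 / |x| := by rw [one_div_div]

lemma abs_cotH_sub_le {x h : ℝ} (hx : |x| ≤ Real.pi) (hxpos : 0 < |x|)
    (hxh : 2 * |h| ≤ |x|) : |cotH (x - h) - cotH x| ≤ 100 * |h| / |x| ^ 2 := by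
  have hpi := Real.pi_pos
  have h1 : |x - h| ≤ 3 * Real.pi / 2 := (abs_sub x h).trans (by linarith)
  have h2 : |x| / 2 ≤ |x - h| := by
    have := abs_sub_abs_le_abs_sub x h
    linarith
  have s1 := abs_sin_half_ge h1
  have s2 := abs_sin_half_ge (x := x) (by linarith)
  have n1 : Real.sin ((x - h) / 2) ≠ 0 := abs_pos.1 (lt_of_lt_of_le (by linarith) s1)
  have n2 : Real.sin (x / 2) ≠ 0 := abs_pos.1 (lt_of_lt_of_le (by linarith) s2)
  have e : cotH (x - h) - cotH x = Real.sin (h / 2) /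
      (Real.sin ((x - h) / 2) * Real.sin (x / 2)) := by
    rw [cotH, cotH, div_sub_div _ _ n1 n2]
    congr 1
    have : h / 2 = x / 2 - (x - h) / 2 := by ring
    rw [this, Real.sin_sub]; ring
  rw [e, abs_div, abs_mul]
  have s3 : |Real.sin (h / 2)| ≤ |h| / 2 := by
    have := Real.abs_sin_le_abs (x := h / 2)
    rwa [abs_div, abs_two] at this
  calc |Real.sin (h / 2)| / (|Real.sin ((x - h) / 2)| * |Real.sin (x / 2)|)
      ≤ (|h| / 2) / ((|x| / 20) * (|x| / 10)) := by
        refine div_le_div₀ (by positivity) s3 (by positivity) ?_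
        exact mul_le_mul (by linarith) s2 (by positivity) (abs_nonneg _)
    _ = 100 * |h| / |x| ^ 2 := by field_simp; ring

/-- `W` has the two-term power modulus of continuity `A|x|^β + B|x|^γ` at `c`. -/
def ModAt (W : ℝ → ℂ) (c A B β γ : ℝ) : Prop :=
  ∀ x, ‖W (c + x) - W c‖ ≤ A * |x| ^ β + B * |x| ^ γ

lemma abs_rpow_div_abs {β : ℝ} (hβ : β < 1) (hβ0 : 0 < β) (x : ℝ) :
    |x| ^ β * (1 / |x|) = |x| ^ (β - 1) := by
  rcases eq_or_ne x 0 with rfl | h0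
  · rw [abs_zero, Real.zero_rpow hβ0.ne', Real.zero_rpow (by linarith), zero_mul]
  · rw [Real.rpow_sub_one (abs_pos.2 h0).ne', mul_one_div]

lemma ModAt.kernel_bound {W : ℝ → ℂ} {c A B β γ : ℝ} (h : ModAt W c A B β γ)
    (hβ0 : 0 < β) (hβ : β < 1) (hγ0 : 0 < γ) (hγ : γ < 1) {x : ℝ} (hx : |x| ≤ 3 * Real.pi / 2) :
    ‖(W (c + x) - W c) * (cotH x : ℂ)‖ ≤
      10 * (A * |x| ^ (β - 1) + B * |x| ^ (γ - 1)) := by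
  rw [norm_mul, Complex.norm_real, Real.norm_eq_abs]
  calc ‖W (c + x) - W c‖ * |cotH x|
      ≤ (A * |x| ^ β + B * |x| ^ γ) * (10 / |x|) :=
        mul_le_mul (h x) (abs_cotH_le hx) (abs_nonneg _) ((norm_nonneg _).trans (h x))
    _ = 10 * (A * (|x| ^ β * (1 / |x|)) + B * (|x| ^ γ * (1 / |x|))) := by ring
    _ = _ := by rw [abs_rpow_div_abs hβ hβ0, abs_rpow_div_abs hγ hγ0]

lemma intervalIntegrable_abs_rpow {r : ℝ} (hr : -1 < r) (a b : ℝ) :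
    IntervalIntegrable (fun x : ℝ => |x| ^ r) volume a b := by
  have hpos : ∀ c : ℝ, 0 ≤ c → IntervalIntegrable (fun x : ℝ => |x| ^ r) volume 0 c := by
    intro c hc
    refine (intervalIntegral.intervalIntegrable_rpow' hr (a := 0) (b := c)).congr ?_
    intro x hx
    rw [uIoc_of_le hc] at hx
    simp only [abs_of_pos hx.1]
  have hall : ∀ c : ℝ, IntervalIntegrable (fun x : ℝ => |x| ^ r) volume 0 c := by
    intro c
    rcases le_total 0 c with hc | hc
    · exact hpos c hc
    · have := (hpos (-c) (by linarith)).comp_mul_left (c := -1)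
      simpa using this
  exact (hall a).symm.trans (hall b)

lemma integral_abs_rpow {β : ℝ} (hβ0 : 0 < β) {c : ℝ} (hc : 0 ≤ c) :
    ∫ x in (-c)..c, |x| ^ (β - 1) = 2 * c ^ β / β := by
  have hi := fun a b => intervalIntegrable_abs_rpow (r := β - 1) (by linarith) a b
  have h1 : ∫ x in (0:ℝ)..c, |x| ^ (β - 1) = c ^ β / β := by
    have : ∫ x in (0:ℝ)..c, |x| ^ (β - 1) = ∫ x in (0:ℝ)..c, x ^ (β - 1) := by
      refine intervalIntegral.integral_congr fun x hx => ?_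
      rw [uIcc_of_le hc] at hx
      simp only [abs_of_nonneg hx.1]
    rw [this, integral_rpow (Or.inl (by linarith))]
    simp [Real.zero_rpow hβ0.ne']
  have h2 : ∫ x in (-c)..0, |x| ^ (β - 1) = c ^ β / β := by
    rw [← h1]
    have := intervalIntegral.integral_comp_neg (a := 0) (b := c) (fun x : ℝ => |x| ^ (β - 1))
    simp only [abs_neg, neg_zero] at this
    exact this.symm
  rw [← intervalIntegral.integral_add_adjacent_intervals (hi _ 0) (hi 0 _), h1, h2]
  ring

lemma kernel_periodic {W : ℝ → ℂ} (hW : Function.Periodic W (2 * Real.pi)) (c : ℝ) (w : ℂ) :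
    Function.Periodic (fun x => (W (c + x) - w) * (cotH x : ℂ)) (2 * Real.pi) := by
  intro x
  simp only [← add_assoc, hW (c + x), cotH_periodic x]

lemma ModAt.kernel_intervalIntegrable {W : ℝ → ℂ} {c A B β γ : ℝ} (h : ModAt W c A B β γ)
    (hm : Measurable W) (hβ0 : 0 < β) (hβ : β < 1) (hγ0 : 0 < γ) (hγ : γ < 1) :
    IntervalIntegrable (fun x => (W (c + x) - W c) * (cotH x : ℂ)) volume
      (-Real.pi) Real.pi := by
  have hpi := Real.pi_pos
  have hb : IntervalIntegrable (fun x : ℝ => 10 * (A * |x| ^ (β - 1) + B * |x| ^ (γ - 1)))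
      volume (-Real.pi) Real.pi :=
    (((intervalIntegrable_abs_rpow (by linarith) _ _).const_mul _).add
      ((intervalIntegrable_abs_rpow (by linarith) _ _).const_mul _)).const_mul _
  refine hb.mono_fun ?_ ?_
  · refine Measurable.aestronglyMeasurable ?_
    exact ((hm.comp (measurable_const_add c)).sub_const _).mul
      (Complex.measurable_ofReal.comp measurable_cotH)
  · refine (ae_restrict_iff' measurableSet_uIoc).2 (Eventually.of_forall fun x hx => ?_)
    rw [uIoc_of_le (by linarith)] at hx
    refine (h.kernel_bound hβ0 hβ hγ0 hγ ?_).trans (le_abs_self _)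
    exact abs_le.2 ⟨by linarith [hx.1], by linarith [hx.2]⟩

lemma ModAt.norm_integral_le {W : ℝ → ℂ} {c A B β γ : ℝ} (h : ModAt W c A B β γ)
    (hA : 0 ≤ A) (hB : 0 ≤ B)
    (hβ0 : 0 < β) (hβ : β < 1) (hγ0 : 0 < γ) (hγ : γ < 1) {u v r : ℝ} (hu : -r ≤ u) (huv : u ≤ v)
    (hv : v ≤ r) (hr : r ≤ 3 * Real.pi / 2) :
    ‖∫ x in u..v, (W (c + x) - W c) * (cotH x : ℂ)‖ ≤
      20 * (A * (r ^ β / β) + B * (r ^ γ / γ)) := by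
  have h1 := fun u v => (intervalIntegrable_abs_rpow (r := β - 1) (by linarith) u v).const_mul A
  have h2 := fun u v => (intervalIntegrable_abs_rpow (r := γ - 1) (by linarith) u v).const_mul B
  have := intervalIntegral.norm_integral_le_of_norm_le (μ := volume)
    (f := fun x => (W (c + x) - W c) * (cotH x : ℂ))
    (g := fun x : ℝ => 10 * (A * |x| ^ (β - 1) + B * |x| ^ (γ - 1)))
    (a := u) (b := v) huv
    (Eventually.of_forall fun x hx => h.kernel_bound hβ0 hβ hγ0 hγ
      (abs_le.2 ⟨by linarith [hx.1], by linarith [hx.2]⟩)) (((h1 u v).add (h2 u v)).const_mul _)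
  refine this.trans ?_
  have hmono : ∫ x in u..v, 10 * (A * |x| ^ (β - 1) + B * |x| ^ (γ - 1)) ≤
      ∫ x in (-r)..r, 10 * (A * |x| ^ (β - 1) + B * |x| ^ (γ - 1)) := by
    refine intervalIntegral.integral_mono_interval hu huv hv
      (Eventually.of_forall fun x => ?_) (((h1 _ _).add (h2 _ _)).const_mul _)
    have := Real.rpow_nonneg (abs_nonneg x) (β - 1)
    have := Real.rpow_nonneg (abs_nonneg x) (γ - 1)
    simp only [Pi.zero_apply]
    positivity
  refine hmono.trans (le_of_eq ?_)
  rw [intervalIntegral.integral_const_mul, intervalIntegral.integral_add (h1 _ _) (h2 _ _),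
    intervalIntegral.integral_const_mul, intervalIntegral.integral_const_mul,
    integral_abs_rpow hβ0 (by linarith), integral_abs_rpow hγ0 (by linarith)]
  ring

lemma integral_rpow_sub_two_le {β δ : ℝ} (hβ : β < 1) (hδ : 0 < δ)
    (h2 : 2 * δ ≤ Real.pi) :
    δ * ∫ x in (2 * δ)..Real.pi, x ^ (β - 2) ≤ δ ^ β / (1 - β) := by
  rw [integral_rpow (Or.inr ⟨by linarith, by
    rw [uIcc_of_le h2]; exact fun h => by linarith [h.1]⟩)]
  have e : β - 2 + 1 = -(1 - β) := by ring
  have h3 : (2 * δ) ^ (-(1 - β)) ≤ δ ^ (-(1 - β)) :=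
    Real.rpow_le_rpow_of_nonpos hδ (by linarith) (by linarith)
  have h4 : δ * δ ^ (-(1 - β)) = δ ^ β := by
    nth_rewrite 1 [← Real.rpow_one δ]
    rw [← Real.rpow_add hδ]; congr 1; ring
  have h5 := Real.rpow_nonneg Real.pi_pos.le (-(1 - β))
  rw [e, div_neg, ← neg_div, mul_div_assoc', ← h4]
  refine div_le_div_of_nonneg_right (mul_le_mul_of_nonneg_left (by linarith) hδ.le) (by linarith)

lemma intervalIntegrable_cotH {u v : ℝ} (hu : 0 < u) (huv : u ≤ v) (hv : v ≤ Real.pi) :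
    IntervalIntegrable (fun x => (cotH x : ℂ)) volume u v := by
  refine (intervalIntegrable_const (c := 10 / u)).mono_fun
    (Complex.measurable_ofReal.comp measurable_cotH).aestronglyMeasurable ?_
  refine (ae_restrict_iff' measurableSet_uIoc).2 (Eventually.of_forall fun x hx => ?_)
  rw [uIoc_of_le huv] at hx
  have hpi := Real.pi_pos
  have hx0 : 0 < x := by linarith [hx.1]
  change ‖(cotH x : ℂ)‖ ≤ ‖10 / u‖
  rw [Complex.norm_real, Real.norm_eq_abs, Real.norm_eq_abs, abs_of_pos (by positivity : 0 < 10 / u)]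
  refine (abs_cotH_le (by rw [abs_of_pos hx0]; linarith [hx.2])).trans ?_
  rw [abs_of_pos hx0]
  exact div_le_div_of_nonneg_left (by norm_num) hu hx.1.le

/-- **Privalov's estimate**: the conjugate function inherits moduli of continuity. -/
lemma exists_conjInt_sub_le {β γ : ℝ} (hβ0 : 0 < β) (hβ : β < 1) (hγ0 : 0 < γ) (hγ : γ < 1) :
    ∃ K : ℝ, 0 ≤ K ∧ ∀ (W : ℝ → ℂ) (A B a b : ℝ), Measurable W →
      Function.Periodic W (2 * Real.pi) → 0 ≤ A → 0 ≤ B → ModAt W a A B β γ → ModAt W b A B β γ →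
      ‖conjInt W b - conjInt W a‖ ≤ K * (A * |b - a| ^ β + B * |b - a| ^ γ) := by
  have hpi := Real.pi_pos
  have hpi3 := Real.pi_gt_three
  have hpi4 := Real.pi_le_four
  have hiβ : 0 < 1 / β := by positivity
  have hiγ : 0 < 1 / γ := by positivity
  have hjβ : 0 < 1 / (1 - β) := one_div_pos.2 (by linarith)
  have hjγ : 0 < 1 / (1 - γ) := one_div_pos.2 (by linarith)
  refine ⟨400 * (1 / β + 1 / γ + 1 / (1 - β) + 1 / (1 - γ)), by positivity, ?_⟩
  intro W A B a b hm hper hA hB ha hb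
  set h := b - a with hh
  set δ := |h| with hδ
  rcases eq_or_lt_of_le (abs_nonneg h) with h0 | hδ0
  · have : b = a := by linarith [abs_eq_zero.1 h0.symm]
    rw [this, sub_self, norm_zero]
    have := Real.rpow_nonneg (abs_nonneg h) β
    have := Real.rpow_nonneg (abs_nonneg h) γ
    positivity
  have hPβ : 0 ≤ A * δ ^ β := mul_nonneg hA (Real.rpow_nonneg (abs_nonneg h) β)
  have hPγ : 0 ≤ B * δ ^ γ := mul_nonneg hB (Real.rpow_nonneg (abs_nonneg h) γ)
  have hscale : ∀ {s k : ℝ}, 0 < s → s < 1 → 1 ≤ k → (k * δ) ^ s ≤ k * δ ^ s := by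
    intro s k hs0 hs1 hk
    rw [Real.mul_rpow (by linarith) hδ0.le]
    refine mul_le_mul_of_nonneg_right ?_ (Real.rpow_nonneg hδ0.le _)
    calc k ^ s ≤ k ^ (1:ℝ) := Real.rpow_le_rpow_of_exponent_le hk hs1.le
      _ = k := Real.rpow_one k
  set K := 1 / β + 1 / γ + 1 / (1 - β) + 1 / (1 - γ) with hK
  have hβK : A * δ ^ β * (1 / β + 1 / (1 - β)) ≤ A * δ ^ β * K :=
    mul_le_mul_of_nonneg_left (by linarith) hPβ
  have hγK : B * δ ^ γ * (1 / γ + 1 / (1 - γ)) ≤ B * δ ^ γ * K :=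
    mul_le_mul_of_nonneg_left (by linarith) hPγ
  have hnear : ∀ (c : ℝ), ModAt W c A B β γ → ∀ {u v r k : ℝ}, -r ≤ u → u ≤ v → v ≤ r →
      r ≤ 3 * Real.pi / 2 → 0 ≤ r → r ≤ k * δ → 1 ≤ k →
      ‖∫ x in u..v, (W (c + x) - W c) * (cotH x : ℂ)‖ ≤
        20 * k * (A * δ ^ β * (1 / β) + B * δ ^ γ * (1 / γ)) := by
    intro c hc u v r k h1 h2 h3 h4 h5 h6 h7
    refine (hc.norm_integral_le hA hB hβ0 hβ hγ0 hγ h1 h2 h3 h4).trans ?_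
    have e1 : r ^ β ≤ k * δ ^ β := (Real.rpow_le_rpow h5 h6 hβ0.le).trans (hscale hβ0 hβ h7)
    have e2 : r ^ γ ≤ k * δ ^ γ := (Real.rpow_le_rpow h5 h6 hγ0.le).trans (hscale hγ0 hγ h7)
    have e3 : A * (r ^ β / β) ≤ A * (k * δ ^ β / β) :=
      mul_le_mul_of_nonneg_left (div_le_div_of_nonneg_right e1 hβ0.le) hA
    have e4 : B * (r ^ γ / γ) ≤ B * (k * δ ^ γ / γ) :=
      mul_le_mul_of_nonneg_left (div_le_div_of_nonneg_right e2 hγ0.le) hB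
    calc _ ≤ 20 * (A * (k * δ ^ β / β) + B * (k * δ ^ γ / γ)) := by linarith
      _ = _ := by ring
  rcases lt_or_ge (Real.pi / 4) δ with hbig | hsmall
  · have n1 := hnear a ha (u := -Real.pi) (v := Real.pi) (r := Real.pi) (k := 6) le_rfl
      (by linarith) le_rfl (by linarith) hpi.le (by linarith) (by norm_num)
    have n2 := hnear b hb (u := -Real.pi) (v := Real.pi) (r := Real.pi) (k := 6) le_rfl
      (by linarith) le_rfl (by linarith) hpi.le (by linarith) (by norm_num)
    have n3 := norm_sub_le (conjInt W b) (conjInt W a)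
    rw [conjInt, conjInt] at n3
    rw [conjInt, conjInt]
    have := mul_nonneg hPβ hjβ.le
    have := mul_nonneg hPγ hjγ.le
    have := mul_nonneg hPβ hiβ.le
    have := mul_nonneg hPγ hiγ.le
    linarith
  set kb : ℝ → ℂ := fun x => (W (b + x) - W b) * (cotH x : ℂ) with hkb
  set ka : ℝ → ℂ := fun x => (W (a + x) - W a) * (cotH x : ℂ) with hka
  have hap : -Real.pi + 2 * Real.pi = Real.pi := by ring
  have hint : ∀ (c : ℝ), ModAt W c A B β γ → ∀ u v, IntervalIntegrable
      (fun x => (W (c + x) - W c) * (cotH x : ℂ)) volume u v := by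
    intro c hc u v
    refine (kernel_periodic hper c (W c)).intervalIntegrable (t := -Real.pi) (by positivity) ?_ u v
    rw [hap]
    exact hc.kernel_intervalIntegrable hm hβ0 hβ hγ0 hγ
  have hia := hint a ha
  have hib : ∀ u v, IntervalIntegrable (fun x => kb (x - h)) volume u v := by
    intro u v
    have := (hint b hb (u - h) (v - h)).comp_sub_right h
    simpa using this
  have hCb : conjInt W b = ∫ x in (-Real.pi)..Real.pi, kb (x - h) := by
    rw [intervalIntegral.integral_comp_sub_right]
    have := (kernel_periodic hper b (W b)).intervalIntegral_add_eq (-Real.pi) (-Real.pi - h)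
    rw [hap] at this
    rw [conjInt, this]
    congr 1; ring
  have hkbx : ∀ x, kb (x - h) = (W (a + x) - W b) * (cotH (x - h) : ℂ) := by
    intro x
    have : b + (x - h) = a + x := by rw [hh]; ring
    simp only [hkb, this]
  have hsplit : conjInt W b - conjInt W a =
      (∫ x in (-Real.pi)..(-(2 * δ)), (kb (x - h) - ka x)) +
      (∫ x in (-(2 * δ))..(2 * δ), kb (x - h)) - (∫ x in (-(2 * δ))..(2 * δ), ka x) +
      (∫ x in (2 * δ)..Real.pi, (kb (x - h) - ka x)) := by
    rw [hCb, conjInt, intervalIntegral.integral_sub (hib _ _) (hia _ _),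
      intervalIntegral.integral_sub (hib _ _) (hia _ _),
      ← intervalIntegral.integral_add_adjacent_intervals (hib (-Real.pi) (-(2 * δ))) (hib _ _),
      ← intervalIntegral.integral_add_adjacent_intervals (hib (-(2 * δ)) (2 * δ)) (hib _ _),
      ← intervalIntegral.integral_add_adjacent_intervals (hia (-Real.pi) (-(2 * δ))) (hia _ _),
      ← intervalIntegral.integral_add_adjacent_intervals (hia (-(2 * δ)) (2 * δ)) (hia _ _)]
    ring
  set g : ℝ → ℂ := fun x => (W (a + x) - W b) * ((cotH (x - h) - cotH x : ℝ) : ℂ) with hg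
  have hdec : ∀ x, kb (x - h) - ka x = g x + (W a - W b) * (cotH x : ℂ) := by
    intro x
    rw [hkbx]; simp only [hka, hg]; push_cast; ring
  have h2δ : 2 * δ ≤ Real.pi := by linarith
  have hicot := intervalIntegrable_cotH (u := 2 * δ) (by linarith) h2δ le_rfl
  have hicot' : IntervalIntegrable (fun x => (cotH x : ℂ)) volume (-Real.pi) (-(2 * δ)) := by
    have := ((hicot.comp_mul_left (c := -1)).symm).neg
    simp only [neg_mul, one_mul, div_neg, div_one] at this
    refine this.congr fun x _ => ?_
    simp [cotH_neg]
  have hig : ∀ {u v : ℝ}, IntervalIntegrable (fun x => (cotH x : ℂ)) volume u v →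
      IntervalIntegrable g volume u v := by
    intro u v huv
    have := ((hib u v).sub (hia u v)).sub (huv.const_mul (W a - W b))
    refine this.congr fun x _ => ?_
    change kb (x - h) - ka x - (W a - W b) * (cotH x : ℂ) = g x
    linear_combination hdec x
  have hodd : ∫ x in (-Real.pi)..(-(2 * δ)), (cotH x : ℂ) =
      -∫ x in (2 * δ)..Real.pi, (cotH x : ℂ) := by
    rw [← intervalIntegral.integral_comp_neg (fun x => (cotH x : ℂ)),
      ← intervalIntegral.integral_neg]
    exact intervalIntegral.integral_congr fun x _ => by simp [cotH_neg]
  have hgb : ∀ x, 2 * δ ≤ |x| → |x| ≤ Real.pi →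
      ‖g x‖ ≤ 200 * δ * (A * |x| ^ (β - 2) + B * |x| ^ (γ - 2)) := by
    intro x hx1 hx2
    have hx0 : 0 < |x| := by linarith
    have e1 := ha x
    have e2 := ha h
    have hab : a + h = b := by rw [hh]; ring
    rw [hab] at e2
    have e3 : |h| ^ β ≤ |x| ^ β := Real.rpow_le_rpow hδ0.le (by linarith) hβ0.le
    have e4 : |h| ^ γ ≤ |x| ^ γ := Real.rpow_le_rpow hδ0.le (by linarith) hγ0.le
    have e5 : ‖W (a + x) - W b‖ ≤ 2 * (A * |x| ^ β + B * |x| ^ γ) := by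
      have e6 : W (a + x) - W b = (W (a + x) - W a) - (W b - W a) := by ring
      rw [e6]
      refine (norm_sub_le _ _).trans ?_
      have := mul_le_mul_of_nonneg_left e3 hA
      have := mul_le_mul_of_nonneg_left e4 hB
      linarith
    have e7 := abs_cotH_sub_le (h := h) hx2 hx0 hx1
    simp only [hg]
    rw [norm_mul, Complex.norm_real, Real.norm_eq_abs]
    calc _ ≤ 2 * (A * |x| ^ β + B * |x| ^ γ) * (100 * δ / |x| ^ 2) :=
          mul_le_mul e5 e7 (abs_nonneg _) ((norm_nonneg _).trans e5)
      _ = _ := by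
        rw [Real.rpow_sub hx0, Real.rpow_sub hx0]
        have : |x| ^ (2:ℝ) = |x| ^ 2 := by norm_cast
        rw [this]; ring
  have hi1 : ∀ s : ℝ, IntervalIntegrable (fun x : ℝ => x ^ (s - 2)) volume (2 * δ) Real.pi :=
    fun s => intervalIntegral.intervalIntegrable_rpow (Or.inr (by
      rw [uIcc_of_le h2δ]; exact fun h => by linarith [h.1]))
  have hfar : ∀ g' : ℝ → ℂ, (∀ x ∈ Ioc (2 * δ) Real.pi,
      ‖g' x‖ ≤ 200 * δ * (A * x ^ (β - 2) + B * x ^ (γ - 2))) →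
      ‖∫ x in (2 * δ)..Real.pi, g' x‖ ≤
        200 * (A * δ ^ β * (1 / (1 - β)) + B * δ ^ γ * (1 / (1 - γ))) := by
    intro g' hg'
    refine (intervalIntegral.norm_integral_le_of_norm_le h2δ (Eventually.of_forall hg')
      ((((hi1 β).const_mul _).add ((hi1 γ).const_mul _)).const_mul _)).trans ?_
    rw [intervalIntegral.integral_const_mul, intervalIntegral.integral_add
      ((hi1 β).const_mul _) ((hi1 γ).const_mul _), intervalIntegral.integral_const_mul,
      intervalIntegral.integral_const_mul]
    have f1 := mul_le_mul_of_nonneg_left (integral_rpow_sub_two_le hβ hδ0 h2δ) hA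
    have f2 := mul_le_mul_of_nonneg_left (integral_rpow_sub_two_le hγ hδ0 h2δ) hB
    calc _ = 200 * (A * (δ * ∫ x in (2 * δ)..Real.pi, x ^ (β - 2)) +
          B * (δ * ∫ x in (2 * δ)..Real.pi, x ^ (γ - 2))) := by ring
      _ ≤ 200 * (A * (δ ^ β / (1 - β)) + B * (δ ^ γ / (1 - γ))) := by linarith
      _ = _ := by ring
  have hR := hfar g (fun x hx => by
    have hx0 : 0 < x := by linarith [hx.1]
    have := hgb x (by rw [abs_of_pos hx0]; exact hx.1.le) (by rw [abs_of_pos hx0]; exact hx.2)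
    rwa [abs_of_pos hx0] at this)
  have hL := hfar (fun x => g (-x)) (fun x hx => by
    have hx0 : 0 < x := by linarith [hx.1]
    have := hgb (-x) (by rw [abs_neg, abs_of_pos hx0]; exact hx.1.le)
      (by rw [abs_neg, abs_of_pos hx0]; exact hx.2)
    rwa [abs_neg, abs_of_pos hx0] at this)
  rw [intervalIntegral.integral_comp_neg] at hL
  have hfinal : conjInt W b - conjInt W a =
      (∫ x in (-Real.pi)..(-(2 * δ)), g x) + (∫ x in (2 * δ)..Real.pi, g x) +
      ((∫ x in (-(2 * δ))..(2 * δ), kb (x - h)) - (∫ x in (-(2 * δ))..(2 * δ), ka x)) := by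
    rw [hsplit]
    simp only [hdec]
    rw [intervalIntegral.integral_add (hig hicot') (hicot'.const_mul _),
      intervalIntegral.integral_add (hig hicot) (hicot.const_mul _),
      intervalIntegral.integral_const_mul, intervalIntegral.integral_const_mul, hodd]
    ring
  have hN1 := hnear a ha (u := -(2 * δ)) (v := 2 * δ) (r := 2 * δ) (k := 2) le_rfl
      (by linarith) le_rfl (by linarith) (by linarith) le_rfl (by norm_num)
  have hh1 := neg_abs_le h
  have hh2 := le_abs_self h
  have hN2 := hnear b hb (u := -(2 * δ) - h) (v := 2 * δ - h) (r := 3 * δ) (k := 3)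
      (by linarith) (by linarith) (by linarith) (by linarith) (by linarith) le_rfl (by norm_num)
  rw [← intervalIntegral.integral_comp_sub_right
    (fun x => (W (b + x) - W b) * (cotH x : ℂ))] at hN2
  rw [hfinal]
  refine (norm_add_le _ _).trans ?_
  have g1 := norm_add_le (∫ x in (-Real.pi)..(-(2 * δ)), g x) (∫ x in (2 * δ)..Real.pi, g x)
  have g2 := norm_sub_le (∫ x in (-(2 * δ))..(2 * δ), kb (x - h)) (∫ x in (-(2 * δ))..(2 * δ), ka x)
  have := mul_nonneg hPβ hjβ.le
  have := mul_nonneg hPγ hjγ.le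
  have := mul_nonneg hPβ hiβ.le
  have := mul_nonneg hPγ hiγ.le
  linarith

/-! ### Algebraic properties of the conjugation operator -/

lemma conjInt_reflect (W : ℝ → ℂ) (c a : ℝ) :
    conjInt (fun x => W (c - x)) a = -conjInt W (c - a) := by
  have h := intervalIntegral.integral_comp_neg (a := -Real.pi) (b := Real.pi)
    (fun x => -((W (c - a + x) - W (c - a)) * (cotH x : ℂ)))
  rw [neg_neg] at h
  rw [conjInt, conjInt, ← intervalIntegral.integral_neg, ← h]
  refine intervalIntegral.integral_congr fun x _ => ?_
  simp only [cotH_neg, Complex.ofReal_neg]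
  rw [show c - (a + x) = c - a + -x by ring]
  ring

lemma ModAt.of_reflect {W : ℝ → ℂ} {c a A B β γ : ℝ}
    (h : ModAt (fun x => W (c - x)) (c - a) A B β γ) : ModAt W a A B β γ := by
  intro x
  have := h (-x)
  simp only [abs_neg] at this
  rwa [show c - (c - a + -x) = a + x by ring, show c - (c - a) = a by ring] at this

/-- Integrability of the kernel of the conjugation operator. -/
def KerInt (W : ℝ → ℂ) (a : ℝ) : Prop :=
  IntervalIntegrable (fun x => (W (a + x) - W a) * (cotH x : ℂ)) volume (-Real.pi) Real.pi

lemma conjInt_add {W Z : ℝ → ℂ} {a : ℝ} (hW : KerInt W a) (hZ : KerInt Z a) :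
    conjInt (fun x => W x + Z x) a = conjInt W a + conjInt Z a := by
  rw [conjInt, conjInt, conjInt, ← intervalIntegral.integral_add hW hZ]
  exact intervalIntegral.integral_congr fun x _ => by ring

lemma conjInt_const_mul (W : ℝ → ℂ) (c : ℂ) (a : ℝ) :
    conjInt (fun x => c * W x) a = c * conjInt W a := by
  rw [conjInt, conjInt, ← intervalIntegral.integral_const_mul]
  exact intervalIntegral.integral_congr fun x _ => by ring

lemma ae_sin_half_ne_zero :
    ∀ᵐ x : ℝ, x ∈ uIoc (-Real.pi) Real.pi → Real.sin (x / 2) ≠ 0 := by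
  have hpi := Real.pi_pos
  have h0 : ∀ᵐ x : ℝ, x ≠ 0 := by
    simp [ae_iff]
  filter_upwards [h0] with x hx hmem
  rw [uIoc_of_le (by linarith)] at hmem
  rcases lt_or_gt_of_ne hx with h | h
  · exact (Real.sin_neg_of_neg_of_neg_pi_lt (by linarith) (by linarith [hmem.1])).ne
  · exact (Real.sin_pos_of_pos_of_lt_pi (by linarith) (by linarith [hmem.2])).ne'

lemma sin_sub_mul_cotH {φ x : ℝ} (hx : Real.sin (x / 2) ≠ 0) :
    (Real.sin (φ + x) - Real.sin φ) * cotH x = Real.cos (φ + x) + Real.cos φ := by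
  have e1 : φ + x = (φ + x / 2) + x / 2 := by ring
  have e2 : φ = (φ + x / 2) - x / 2 := by ring
  have h1 : Real.sin (φ + x) - Real.sin φ = 2 * Real.cos (φ + x / 2) * Real.sin (x / 2) := by
    nth_rewrite 2 [e2]; rw [e1, Real.sin_add, Real.sin_sub]; ring
  have h2 : Real.cos (φ + x) + Real.cos φ = 2 * Real.cos (φ + x / 2) * Real.cos (x / 2) := by
    nth_rewrite 2 [e2]; rw [e1, Real.cos_add, Real.cos_sub]; ring
  rw [h1, h2, cotH]; field_simp

lemma cos_sub_mul_cotH {φ x : ℝ} (hx : Real.sin (x / 2) ≠ 0) :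
    (Real.cos (φ + x) - Real.cos φ) * cotH x = -(Real.sin (φ + x) + Real.sin φ) := by
  have e1 : φ + x = (φ + x / 2) + x / 2 := by ring
  have e2 : φ = (φ + x / 2) - x / 2 := by ring
  have h1 : Real.cos (φ + x) - Real.cos φ = -2 * Real.sin (φ + x / 2) * Real.sin (x / 2) := by
    nth_rewrite 2 [e2]; rw [e1, Real.cos_add, Real.cos_sub]; ring
  have h2 : Real.sin (φ + x) + Real.sin φ = 2 * Real.sin (φ + x / 2) * Real.cos (x / 2) := by
    nth_rewrite 2 [e2]; rw [e1, Real.sin_add, Real.sin_sub]; ring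
  rw [h1, h2, cotH]; field_simp

lemma integral_periodic_shift {f : ℝ → ℂ} (hf : Function.Periodic f (2 * Real.pi)) (a : ℝ) :
    ∫ x in (-Real.pi)..Real.pi, f (a + x) = ∫ x in (-Real.pi)..Real.pi, f x := by
  rw [intervalIntegral.integral_comp_add_left]
  have := hf.intervalIntegral_add_eq (a + -Real.pi) (-Real.pi)
  rw [show -Real.pi + 2 * Real.pi = Real.pi by ring,
    show a + -Real.pi + 2 * Real.pi = a + Real.pi by ring] at this
  exact this

lemma conjInt_cos (φ : ℝ) :
    conjInt (fun x => (Real.cos x : ℂ)) φ = -(2 * Real.pi * Real.sin φ : ℝ) := by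
  rw [conjInt]
  have h1 : ∫ x in (-Real.pi)..Real.pi, ((Real.cos (φ + x) : ℂ) - Real.cos φ) * (cotH x : ℂ) =
      ∫ x in (-Real.pi)..Real.pi, ((-(Real.sin (φ + x) + Real.sin φ) : ℝ) : ℂ) := by
    refine intervalIntegral.integral_congr_ae ?_
    filter_upwards [ae_sin_half_ne_zero] with x hx hmem
    rw [← cos_sub_mul_cotH (hx hmem)]
    push_cast; ring
  rw [h1, intervalIntegral.integral_ofReal, intervalIntegral.integral_neg,
    intervalIntegral.integral_add (by apply Continuous.intervalIntegrable; fun_prop)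
      (by apply Continuous.intervalIntegrable; fun_prop),
    intervalIntegral.integral_comp_add_left (fun x => Real.sin x), integral_sin]
  rw [← sub_eq_add_neg, Real.cos_sub_pi, Real.cos_add_pi, sub_self, zero_add,
    intervalIntegral.integral_const, smul_eq_mul]
  push_cast; ring

lemma kerInt_cos (φ : ℝ) : KerInt (fun x => (Real.cos x : ℂ)) φ := by
  have : IntervalIntegrable (fun x => ((-(Real.sin (φ + x) + Real.sin φ) : ℝ) : ℂ)) volume
      (-Real.pi) Real.pi := by apply Continuous.intervalIntegrable; fun_prop
  refine this.congr_ae ?_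
  refine (ae_restrict_iff' measurableSet_uIoc).2 ?_
  filter_upwards [ae_sin_half_ne_zero] with x hx hmem
  rw [← cos_sub_mul_cotH (hx hmem)]
  push_cast; ring

/-- Commutation of the conjugation operator with multiplication by `sin`. -/
lemma conjInt_sin_mul {W : ℝ → ℂ} (hper : Function.Periodic W (2 * Real.pi)) {φ : ℝ}
    (hk : KerInt W φ) (hi : IntervalIntegrable W volume (-Real.pi) Real.pi) :
    conjInt (fun x => (Real.sin x : ℂ) * W x) φ = Real.sin φ * conjInt W φ +
      ((∫ x in (-Real.pi)..Real.pi, (Real.cos x : ℂ) * W x) +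
        Real.cos φ * ∫ x in (-Real.pi)..Real.pi, W x) := by
  have hpi := Real.pi_pos
  have hi' : ∀ u v, IntervalIntegrable W volume u v := fun u v =>
    hper.intervalIntegrable (t := -Real.pi) (by positivity) (by
      rwa [show -Real.pi + 2 * Real.pi = Real.pi by ring]) u v
  have hic : ∀ u v, IntervalIntegrable (fun x => (Real.cos x : ℂ) * W x) volume u v := fun u v =>
    (hi' u v).continuousOn_mul (by fun_prop)
  have hs := integral_periodic_shift hper φ
  have hperc : Function.Periodic (fun x => (Real.cos x : ℂ) * W x) (2 * Real.pi) := by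
    intro x; simp only [hper x, Real.cos_add_two_pi]
  have hsc := integral_periodic_shift hperc φ
  have j1 : IntervalIntegrable (fun x => W (φ + x)) volume (-Real.pi) Real.pi := by
    have := (hi' (φ + -Real.pi) (φ + Real.pi)).comp_add_left φ
    simpa using this
  have j2 : IntervalIntegrable (fun x => (Real.cos (φ + x) : ℂ) * W (φ + x)) volume
      (-Real.pi) Real.pi := by
    have := (hic (φ + -Real.pi) (φ + Real.pi)).comp_add_left φ
    simpa using this
  rw [← hs, ← hsc, conjInt, conjInt, ← intervalIntegral.integral_const_mul,
    ← intervalIntegral.integral_const_mul, ← intervalIntegral.integral_add j2 (j1.const_mul _),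
    ← intervalIntegral.integral_add (hk.const_mul _) (j2.add (j1.const_mul _))]
  refine intervalIntegral.integral_congr_ae ?_
  filter_upwards [ae_sin_half_ne_zero] with x hx hmem
  have := congrArg (fun r : ℝ => (r : ℂ)) (sin_sub_mul_cotH (φ := φ) (hx hmem))
  push_cast at this
  push_cast
  linear_combination W (φ + x) * this

/-! ### Hölder continuity through the cosine -/

lemma cos_sub_cos_ge {a b : ℝ} (ha : 0 ≤ a) (hab : a ≤ b) (hb : b ≤ Real.pi / 2) :
    b * (b - a) / 8 ≤ Real.cos a - Real.cos b := by
  have hpi := Real.pi_pos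
  have hpi4 := Real.pi_le_four
  rw [Real.cos_sub_cos]
  have h1 := Real.mul_le_sin (x := (a + b) / 2) (by linarith) (by linarith)
  have h2 := Real.mul_le_sin (x := (b - a) / 2) (by linarith) (by linarith)
  have h3 : (1:ℝ) / 2 ≤ 2 / Real.pi := by rw [div_le_div_iff₀ (by norm_num) hpi]; linarith
  have h4 : 1 / 2 * ((a + b) / 2) ≤ Real.sin ((a + b) / 2) :=
    (mul_le_mul_of_nonneg_right h3 (by linarith)).trans h1
  have h5 : 1 / 2 * ((b - a) / 2) ≤ Real.sin ((b - a) / 2) :=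
    (mul_le_mul_of_nonneg_right h3 (by linarith)).trans h2
  have h6 := mul_le_mul h4 h5 (by linarith) (le_trans (by linarith) h4)
  have e : (a - b) / 2 = -((b - a) / 2) := by ring
  rw [e, Real.sin_neg]
  have h7 : 0 ≤ a * (b - a) := mul_nonneg ha (by linarith)
  nlinarith

lemma abs_cos_add_sub_cos_le (φ x : ℝ) :
    |Real.cos (φ + x) - Real.cos φ| ≤ |φ| * |x| + |x| ^ 2 / 2 := by
  rw [Real.cos_sub_cos, abs_mul, abs_mul, abs_neg, abs_two]
  have h1 : |Real.sin ((φ + x + φ) / 2)| ≤ |φ| + |x| / 2 := by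
    refine Real.abs_sin_le_abs.trans ?_
    rw [show (φ + x + φ) / 2 = φ + x / 2 by ring]
    refine (abs_add_le _ _).trans ?_
    rw [abs_div, abs_two]
  have h2 : |Real.sin ((φ + x - φ) / 2)| ≤ |x| / 2 := by
    refine Real.abs_sin_le_abs.trans ?_
    rw [show (φ + x - φ) / 2 = x / 2 by ring, abs_div, abs_two]
  have := mul_le_mul h1 h2 (abs_nonneg _) (by positivity)
  nlinarith

/-- Hölder-type bound near the endpoint `φ = 0` in the cosine parametrization. -/
def CosHolder (s : ℝ) (f : ℝ → ℂ) : Prop :=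
  ∃ K : ℝ, 0 ≤ K ∧ ∀ a b, 0 ≤ a → a ≤ b → b ≤ Real.pi / 2 →
    ‖f b - f a‖ ≤ K * (b ^ s * (b - a) ^ s)

lemma CosHolder.add {s : ℝ} {f g : ℝ → ℂ} (hf : CosHolder s f) (hg : CosHolder s g) :
    CosHolder s (fun x => f x + g x) := by
  obtain ⟨K, hK0, hK⟩ := hf
  obtain ⟨L, hL0, hL⟩ := hg
  refine ⟨K + L, by positivity, fun a b h1 h2 h3 => ?_⟩
  calc ‖f b + g b - (f a + g a)‖ = ‖(f b - f a) + (g b - g a)‖ := by congr 1; ring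
    _ ≤ _ := (norm_add_le _ _).trans (by linarith [hK a b h1 h2 h3, hL a b h1 h2 h3])

lemma CosHolder.const_mul {s : ℝ} {f : ℝ → ℂ} (c : ℂ) (hf : CosHolder s f) :
    CosHolder s (fun x => c * f x) := by
  obtain ⟨K, hK0, hK⟩ := hf
  refine ⟨‖c‖ * K, by positivity, fun a b h1 h2 h3 => ?_⟩
  rw [← mul_sub, norm_mul, mul_assoc]
  exact mul_le_mul_of_nonneg_left (hK a b h1 h2 h3) (norm_nonneg _)

lemma holderI_of_cosHolder {s : ℝ} (hs : 0 < s) {f : ℝ → ℂ} (h1 : CosHolder s f)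
    (h2 : CosHolder s (fun x => f (Real.pi - x))) : HolderI s (fun t => f (Real.arccos t)) := by
  obtain ⟨K, hK0, hK⟩ := h1
  obtain ⟨L, hL0, hL⟩ := h2
  have key : ∀ (g : ℝ → ℂ) (M : ℝ), 0 ≤ M → (∀ a b, 0 ≤ a → a ≤ b → b ≤ Real.pi / 2 →
      ‖g b - g a‖ ≤ M * (b ^ s * (b - a) ^ s)) → ∀ x y, 0 ≤ x → x ≤ y → y ≤ 1 →
      ‖g (Real.arccos x) - g (Real.arccos y)‖ ≤ M * 8 ^ s * |x - y| ^ s := by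
    intro g M hM hg x y hx hxy hy
    have hb : Real.arccos x ≤ Real.pi / 2 := Real.arccos_le_pi_div_two.2 hx
    have hab : Real.arccos y ≤ Real.arccos x := Real.arccos_le_arccos hxy
    have ha := Real.arccos_nonneg y
    refine (hg _ _ ha hab hb).trans ?_
    have h3 := cos_sub_cos_ge ha hab hb
    rw [Real.cos_arccos (by linarith) hy, Real.cos_arccos (by linarith) (by linarith)] at h3
    rw [mul_assoc]
    refine mul_le_mul_of_nonneg_left ?_ hM
    rw [← Real.mul_rpow (by linarith) (by linarith), ← Real.mul_rpow (by norm_num) (abs_nonneg _),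
      abs_sub_comm, abs_of_nonneg (by linarith : 0 ≤ y - x)]
    exact Real.rpow_le_rpow (mul_nonneg (by linarith) (by linarith)) (by linarith) hs.le
  have hsym : ∀ x y, -1 ≤ x → x ≤ y → y ≤ 0 →
      ‖f (Real.arccos x) - f (Real.arccos y)‖ ≤ L * 8 ^ s * |x - y| ^ s := by
    intro x y hx hxy hy
    have := key _ L hL0 hL (-y) (-x) (by linarith) (by linarith) (by linarith)
    simp only [Real.arccos_neg, sub_sub_cancel] at this
    rw [norm_sub_rev, show x - y = -y - -x by ring]
    exact this
  have h8 : (0:ℝ) ≤ 8 ^ s := by positivity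
  have hord : ∀ x y, -1 ≤ x → x ≤ y → y ≤ 1 →
      ‖f (Real.arccos x) - f (Real.arccos y)‖ ≤ (K + L) * 8 ^ s * |x - y| ^ s := by
    intro x y hx hxy hy
    have hP : 0 ≤ 8 ^ s * |x - y| ^ s := mul_nonneg h8 (Real.rpow_nonneg (abs_nonneg _) _)
    rcases le_total 0 x with h | h
    · have := key f K hK0 hK x y h hxy hy
      nlinarith
    rcases le_total y 0 with h' | h'
    · have := hsym x y hx hxy h'
      nlinarith
    have e1 := hsym x 0 hx h le_rfl
    have e2 := key f K hK0 hK 0 y le_rfl h' hy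
    have e3 : |x - 0| ^ s ≤ |x - y| ^ s := by
      refine Real.rpow_le_rpow (abs_nonneg _) ?_ hs.le
      rw [abs_of_nonpos (by linarith), abs_of_nonpos (by linarith)]; linarith
    have e4 : |0 - y| ^ s ≤ |x - y| ^ s := by
      refine Real.rpow_le_rpow (abs_nonneg _) ?_ hs.le
      rw [abs_of_nonpos (by linarith), abs_of_nonpos (by linarith)]; linarith
    have e5 := mul_le_mul_of_nonneg_left e3 (mul_nonneg hL0 h8)
    have e6 := mul_le_mul_of_nonneg_left e4 (mul_nonneg hK0 h8)
    have e7 := norm_sub_le_norm_sub_add_norm_sub (f (Real.arccos x)) (f (Real.arccos 0))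
      (f (Real.arccos y))
    linarith
  refine ⟨(K + L) * 8 ^ s, fun x hx y hy => ?_⟩
  rcases le_total x y with h | h
  · exact hord x y hx.1 h hy.2
  · rw [norm_sub_rev, abs_sub_comm]; exact hord y x hy.1 h hx.2

/-! ### The base case: Hölder continuity of the conjugate function -/

lemma continuous_comp_cos {v : ℝ → ℂ} (hv : ContinuousOn v (Icc (-1) 1)) :
    Continuous fun φ => v (Real.cos φ) :=
  hv.comp_continuous Real.continuous_cos fun φ => ⟨Real.neg_one_le_cos φ, Real.cos_le_one φ⟩

lemma periodic_comp_cos (v : ℝ → ℂ) :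
    Function.Periodic (fun φ => v (Real.cos φ)) (2 * Real.pi) := fun φ => by
  simp only [Real.cos_add_two_pi]

lemma HolderI.comp_cos {s : ℝ} (hs : 0 < s) (hs1 : s < 1) {v : ℝ → ℂ} (hv : HolderI s v) :
    ∃ M : ℝ, 0 ≤ M ∧ ∀ φ x,
      ‖v (Real.cos (φ + x)) - v (Real.cos φ)‖ ≤ M * (|φ| ^ s * |x| ^ s + |x| ^ (2 * s)) := by
  obtain ⟨M, hM0, hM⟩ := hv.nonneg_const
  refine ⟨M, hM0, fun φ x => (hM _ ⟨Real.neg_one_le_cos _, Real.cos_le_one _⟩ _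
    ⟨Real.neg_one_le_cos _, Real.cos_le_one _⟩).trans (mul_le_mul_of_nonneg_left ?_ hM0)⟩
  have h1 := abs_cos_add_sub_cos_le φ x
  have h2 : |Real.cos (φ + x) - Real.cos φ| ≤ |φ| * |x| + |x| ^ 2 := by
    have := sq_nonneg |x|; linarith
  calc |Real.cos (φ + x) - Real.cos φ| ^ s ≤ (|φ| * |x| + |x| ^ 2) ^ s :=
        Real.rpow_le_rpow (abs_nonneg _) h2 hs.le
    _ ≤ (|φ| * |x|) ^ s + (|x| ^ 2) ^ s :=
        Real.rpow_add_le_add_rpow (by positivity) (by positivity) hs.le hs1.le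
    _ = _ := by
        rw [Real.mul_rpow (abs_nonneg _) (abs_nonneg _), Real.rpow_mul (abs_nonneg _)]
        norm_cast

lemma sub_rpow_le {s a b : ℝ} (hs : 0 ≤ s) (ha : 0 ≤ a) (hab : a ≤ b) : (b - a) ^ s ≤ b ^ s :=
  Real.rpow_le_rpow (by linarith) (by linarith) hs

lemma rpow_two_mul {s x : ℝ} (hs : 0 < s) (hx : 0 ≤ x) : x ^ (2 * s) = x ^ s * x ^ s := by
  rw [two_mul, Real.rpow_add_of_nonneg hx hs.le hs.le]

/-- For exponents below `1/2`, the conjugate function of `v ∘ cos` is Hölder continuous in the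
cosine variable. -/
lemma cosHolder_conjInt {s : ℝ} (hs : 0 < s) (hs1 : s < 1 / 2) {v : ℝ → ℂ} (hv : HolderI s v) :
    CosHolder s (conjInt fun φ => v (Real.cos φ)) := by
  obtain ⟨M, hM0, hM⟩ := hv.comp_cos hs (by linarith)
  obtain ⟨K, hK0, hK⟩ := exists_conjInt_sub_le (β := s) (γ := 2 * s) hs (by linarith)
    (by linarith) (by linarith)
  refine ⟨2 * K * M, by positivity, fun a b ha hab hb => ?_⟩
  have hb0 : 0 ≤ b := ha.trans hab
  have hmod : ∀ c, 0 ≤ c → c ≤ b →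
      ModAt (fun φ => v (Real.cos φ)) c (M * b ^ s) M s (2 * s) := by
    intro c hc hcb x
    refine (hM c x).trans ?_
    have h1 : |c| ^ s ≤ b ^ s := by
      rw [abs_of_nonneg hc]; exact Real.rpow_le_rpow hc hcb hs.le
    have h2 := mul_le_mul_of_nonneg_right h1 (Real.rpow_nonneg (abs_nonneg x) s)
    have h3 := mul_le_mul_of_nonneg_left h2 hM0
    nlinarith
  refine (hK _ _ _ a b (continuous_comp_cos (hv.continuousOn hs)).measurable
    (periodic_comp_cos v) (mul_nonneg hM0 (Real.rpow_nonneg hb0 _)) hM0 (hmod a ha hab)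
    (hmod b hb0 le_rfl)).trans ?_
  rw [abs_of_nonneg (by linarith : 0 ≤ b - a), rpow_two_mul hs (by linarith)]
  have h0 : 0 ≤ (b - a) ^ s := Real.rpow_nonneg (by linarith) _
  have h1 := mul_le_mul_of_nonneg_right (sub_rpow_le hs.le ha hab) h0
  have h2 := mul_le_mul_of_nonneg_left h1 (mul_nonneg hK0 hM0)
  nlinarith

lemma rpow_bound {s a b r : ℝ} (hs : s < 1) (ha : 0 ≤ a) (hab : a ≤ b) (hb : b ≤ Real.pi / 2)
    (hs0 : 0 < s) (hr : s ≤ r) (hr2 : r ≤ 2) :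
    b ^ r * (b - a) ≤ 8 * (b ^ s * (b - a) ^ s) := by
  have hb0 : 0 ≤ b := ha.trans hab
  have hb2 : b ≤ 2 := by have := Real.pi_le_four; linarith
  have h2 : ∀ x t : ℝ, 0 ≤ x → x ≤ 2 → 0 ≤ t → t ≤ 2 → x ^ t ≤ 4 := by
    intro x t hx0 hx ht ht2
    calc x ^ t ≤ 2 ^ t := Real.rpow_le_rpow hx0 hx ht
      _ ≤ 2 ^ (2:ℝ) := Real.rpow_le_rpow_of_exponent_le (by norm_num) ht2
      _ = 4 := by norm_num
  have h2' : ∀ x t : ℝ, 0 ≤ x → x ≤ 2 → 0 ≤ t → t ≤ 1 → x ^ t ≤ 2 := by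
    intro x t hx0 hx ht ht2
    calc x ^ t ≤ 2 ^ t := Real.rpow_le_rpow hx0 hx ht
      _ ≤ 2 ^ (1:ℝ) := Real.rpow_le_rpow_of_exponent_le (by norm_num) ht2
      _ = 2 := by norm_num
  have e1 : b ^ r = b ^ s * b ^ (r - s) := by
    rw [← Real.rpow_add_of_nonneg hb0 hs0.le (by linarith)]; congr 1; ring
  have e2 : b - a = (b - a) ^ s * (b - a) ^ (1 - s) := by
    rw [← Real.rpow_add_of_nonneg (by linarith) hs0.le (by linarith)]
    rw [show s + (1 - s) = 1 by ring, Real.rpow_one]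
  have h3 := h2 b (r - s) hb0 hb2 (by linarith) (by linarith)
  have h4 := h2' (b - a) (1 - s) (by linarith) (by linarith) (by linarith) (by linarith)
  have p1 := Real.rpow_nonneg hb0 s
  have p2 : 0 ≤ (b - a) ^ s := Real.rpow_nonneg (by linarith) s
  have p3 : 0 ≤ (b - a) ^ (1 - s) := Real.rpow_nonneg (by linarith) _
  calc b ^ r * (b - a) = (b ^ s * (b - a) ^ s) * (b ^ (r - s) * (b - a) ^ (1 - s)) := by
        rw [e1]; nth_rewrite 1 [e2]; ring
    _ ≤ (b ^ s * (b - a) ^ s) * (4 * 2) :=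
        mul_le_mul_of_nonneg_left (mul_le_mul h3 h4 p3 (by norm_num)) (by positivity)
    _ = _ := by ring

lemma cosHolder_sin_mul {s : ℝ} (hs0 : 0 < s) (hs : s < 1) :
    CosHolder s fun φ => ((Real.sin φ * (1 - Real.cos φ) : ℝ) : ℂ) := by
  refine ⟨16, by norm_num, fun a b ha hab hb => ?_⟩
  rw [← Complex.ofReal_sub, Complex.norm_real, Real.norm_eq_abs]
  have hb0 : 0 ≤ b := ha.trans hab
  have h1 : |Real.sin b| ≤ b := by
    have := Real.abs_sin_le_abs (x := b); rwa [abs_of_nonneg hb0] at this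
  have h2 : |Real.sin b - Real.sin a| ≤ b - a := by
    have := Real.abs_sin_sub_sin_le b a
    rwa [abs_of_nonneg (by linarith : 0 ≤ b - a)] at this
  have h3 := abs_cos_add_sub_cos_le a (b - a)
  rw [show a + (b - a) = b by ring, abs_of_nonneg ha, abs_of_nonneg (by linarith : 0 ≤ b - a)] at h3
  have h4 := abs_cos_add_sub_cos_le 0 a
  rw [zero_add, Real.cos_zero, abs_zero, zero_mul, zero_add, sq_abs] at h4
  have h5 : Real.sin b * (1 - Real.cos b) - Real.sin a * (1 - Real.cos a) =
      -(Real.sin b * (Real.cos b - Real.cos a)) - (Real.sin b - Real.sin a) * (Real.cos a - 1) := by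
    ring
  have h6 : |Real.sin b * (Real.cos b - Real.cos a)| ≤ b * (a * (b - a) + (b - a) ^ 2 / 2) := by
    rw [abs_mul]; exact mul_le_mul h1 h3 (abs_nonneg _) hb0
  have h7 : |(Real.sin b - Real.sin a) * (Real.cos a - 1)| ≤ (b - a) * (a ^ 2 / 2) := by
    rw [abs_mul]; exact mul_le_mul h2 h4 (abs_nonneg _) (by linarith)
  have h8 := rpow_bound hs ha hab hb hs0 (by linarith : s ≤ 2) le_rfl
  have h9 : b ^ (2:ℝ) = b ^ 2 := by norm_cast
  rw [h9] at h8
  rw [h5]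
  refine (abs_sub _ _).trans ?_
  rw [abs_neg]
  have h10 : b * (a * (b - a) + (b - a) ^ 2 / 2) ≤ b ^ 2 * (b - a) := by
    have : a * (b - a) + (b - a) ^ 2 / 2 ≤ b * (b - a) := by nlinarith
    nlinarith
  have h11 : (b - a) * (a ^ 2 / 2) ≤ b ^ 2 * (b - a) := by
    have : a ^ 2 / 2 ≤ b ^ 2 := by nlinarith
    nlinarith
  linarith

section AboveHalf

variable {s : ℝ} {v : ℝ → ℂ}

lemma norm_comp_cos_le (hs : 0 < s) (hv : HolderI s v) (h1 : v 1 = 0) (h2 : v (-1) = 0) :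
    ∃ M : ℝ, 0 ≤ M ∧ ∀ φ, ‖v (Real.cos φ)‖ ≤ M * |Real.sin φ| ^ (2 * s) := by
  obtain ⟨M, hM0, hM⟩ := hv.nonneg_const
  refine ⟨M, hM0, fun φ => ?_⟩
  have hc : Real.cos φ ∈ Icc (-1:ℝ) 1 := ⟨Real.neg_one_le_cos _, Real.cos_le_one _⟩
  have hsq : (|Real.sin φ| ^ 2) ^ s = |Real.sin φ| ^ (2 * s) := by
    rw [Real.rpow_mul (abs_nonneg _)]; norm_cast
  rw [← hsq]
  have hcs := Real.sin_sq_add_cos_sq φ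
  rcases le_total 0 (Real.cos φ) with h | h
  · have := hM _ hc 1 one_mem_segI
    rw [h1, sub_zero] at this
    refine this.trans (mul_le_mul_of_nonneg_left (Real.rpow_le_rpow (abs_nonneg _) ?_ hs.le) hM0)
    rw [sq_abs, abs_of_nonpos (by linarith [hc.2])]
    nlinarith [hc.2]
  · have := hM _ hc (-1) neg_one_mem_segI
    rw [h2, sub_zero] at this
    refine this.trans (mul_le_mul_of_nonneg_left (Real.rpow_le_rpow (abs_nonneg _) ?_ hs.le) hM0)
    rw [sq_abs, abs_of_nonneg (by linarith [hc.1])]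
    nlinarith [hc.1]

lemma norm_div_sin_le (hs : 1 / 2 < s) (hv : HolderI s v) (h1 : v 1 = 0) (h2 : v (-1) = 0) :
    ∃ M : ℝ, 0 ≤ M ∧ ∀ φ, ‖v (Real.cos φ) / Real.sin φ‖ ≤ M * |Real.sin φ| ^ (2 * s - 1) := by
  obtain ⟨M, hM0, hM⟩ := norm_comp_cos_le (by linarith) hv h1 h2
  refine ⟨M, hM0, fun φ => ?_⟩
  rcases eq_or_ne (Real.sin φ) 0 with h | h
  · rw [h]; simp [Real.zero_rpow (by linarith : 2 * s - 1 ≠ 0)]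
  rw [norm_div, Complex.norm_real, Real.norm_eq_abs, Real.rpow_sub_one (abs_pos.2 h).ne',
    ← mul_div_assoc]
  exact div_le_div_of_nonneg_right (hM φ) (abs_nonneg _)

/-- Moduli of continuity of the quotient `v (cos φ) / sin φ` near the endpoint `φ = 0`. -/
lemma modAt_div_sin (hs : 1 / 2 < s) (hs1 : s < 1) (hv : HolderI s v) (h1 : v 1 = 0)
    (h2 : v (-1) = 0) :
    ∃ M : ℝ, 0 ≤ M ∧ ModAt (fun φ => v (Real.cos φ) / Real.sin φ) 0 0 M s (2 * s - 1) ∧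
      ∀ φ, 0 < φ → φ ≤ Real.pi / 2 →
        ModAt (fun φ => v (Real.cos φ) / Real.sin φ) φ (M * φ ^ (s - 1)) 0 s (2 * s - 1) := by
  obtain ⟨M₁, hM₁0, hM₁⟩ := norm_comp_cos_le (by linarith) hv h1 h2
  obtain ⟨M₂, hM₂0, hM₂⟩ := norm_div_sin_le hs hv h1 h2
  obtain ⟨M₃, hM₃0, hM₃⟩ := hv.comp_cos (by linarith) hs1
  have hbd : ∀ φ, ‖v (Real.cos φ) / Real.sin φ‖ ≤ M₂ * |φ| ^ (2 * s - 1) := fun φ =>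
    (hM₂ φ).trans (mul_le_mul_of_nonneg_left
      (Real.rpow_le_rpow (abs_nonneg _) Real.abs_sin_le_abs (by linarith)) hM₂0)
  refine ⟨10 * M₂ + 20 * M₃ + 100 * M₁, by positivity, fun x => ?_, fun φ hφ0 hφ x => ?_⟩
  · simp only [zero_add, Real.sin_zero, Complex.ofReal_zero, div_zero, sub_zero, zero_mul]
    refine (hbd x).trans (mul_le_mul_of_nonneg_right (by linarith)
      (Real.rpow_nonneg (abs_nonneg _) _))
  rw [zero_mul, add_zero]
  have hpi := Real.pi_pos
  have hP : 0 ≤ φ ^ (s - 1) * |x| ^ s :=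
    mul_nonneg (Real.rpow_nonneg hφ0.le _) (Real.rpow_nonneg (abs_nonneg _) _)
  rcases lt_or_ge |x| (φ / 2) with hx | hx
  · have hx1 := neg_abs_le x
    have hx2 := le_abs_self x
    have hs2 : φ / 10 ≤ Real.sin (φ + x) := by
      have hnn : 0 ≤ Real.sin (φ + x) := Real.sin_nonneg_of_nonneg_of_le_pi (by linarith)
        (by linarith)
      have := abs_sin_half_ge (x := 2 * (φ + x)) (by
        rw [abs_of_nonneg (by linarith)]; linarith)
      rw [abs_of_nonneg (by linarith), mul_div_cancel_left₀ _ (by norm_num : (2:ℝ) ≠ 0),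
        abs_of_nonneg hnn] at this
      linarith
    have hs3 : φ / 10 ≤ Real.sin φ := by
      have hnn : 0 ≤ Real.sin φ := Real.sin_nonneg_of_nonneg_of_le_pi hφ0.le (by linarith)
      have := abs_sin_half_ge (x := 2 * φ) (by
        rw [abs_of_nonneg (by linarith)]; linarith)
      rw [abs_of_nonneg (by linarith), mul_div_cancel_left₀ _ (by norm_num : (2:ℝ) ≠ 0),
        abs_of_nonneg hnn] at this
      linarith
    have n2 : 0 < Real.sin (φ + x) := by linarith
    have n3 : 0 < Real.sin φ := by linarith
    have c2 : (Real.sin (φ + x) : ℂ) ≠ 0 := by exact_mod_cast n2.ne'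
    have c3 : (Real.sin φ : ℂ) ≠ 0 := by exact_mod_cast n3.ne'
    have e : v (Real.cos (φ + x)) / Real.sin (φ + x) - v (Real.cos φ) / Real.sin φ =
        (v (Real.cos (φ + x)) - v (Real.cos φ)) / Real.sin (φ + x) -
        v (Real.cos φ) * ((Real.sin (φ + x) - Real.sin φ : ℝ) : ℂ) /
          (Real.sin φ * Real.sin (φ + x)) := by
      rw [Complex.ofReal_sub]
      field_simp
      ring
    have b1 : ‖(v (Real.cos (φ + x)) - v (Real.cos φ)) / (Real.sin (φ + x) : ℂ)‖ ≤
        20 * M₃ * (φ ^ (s - 1) * |x| ^ s) := by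
      rw [norm_div, Complex.norm_real, Real.norm_eq_abs, abs_of_pos n2]
      have hle : ‖v (Real.cos (φ + x)) - v (Real.cos φ)‖ ≤ 2 * M₃ * (φ ^ s * |x| ^ s) := by
        refine (hM₃ φ x).trans ?_
        rw [abs_of_pos hφ0, rpow_two_mul (by linarith) (abs_nonneg x)]
        have : |x| ^ s ≤ φ ^ s := Real.rpow_le_rpow (abs_nonneg _) (by linarith) (by linarith)
        have := mul_le_mul_of_nonneg_right this (Real.rpow_nonneg (abs_nonneg x) s)
        have := mul_le_mul_of_nonneg_left this hM₃0
        nlinarith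
      calc _ ≤ 2 * M₃ * (φ ^ s * |x| ^ s) / (φ / 10) :=
            div_le_div₀ ((norm_nonneg _).trans hle) hle (by positivity) hs2
        _ = _ := by rw [Real.rpow_sub_one hφ0.ne']; field_simp; ring
    have b2 : ‖v (Real.cos φ) * ((Real.sin (φ + x) - Real.sin φ : ℝ) : ℂ) /
          (Real.sin φ * Real.sin (φ + x))‖ ≤ 100 * M₁ * (φ ^ (s - 1) * |x| ^ s) := by
      rw [norm_div, norm_mul, norm_mul, Complex.norm_real, Complex.norm_real, Complex.norm_real,
        Real.norm_eq_abs, Real.norm_eq_abs, Real.norm_eq_abs, abs_of_pos n2, abs_of_pos n3]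
      have l1 : ‖v (Real.cos φ)‖ ≤ M₁ * φ ^ (2 * s) := by
        refine (hM₁ φ).trans (mul_le_mul_of_nonneg_left ?_ hM₁0)
        refine Real.rpow_le_rpow (abs_nonneg _) ?_ (by linarith)
        have := Real.abs_sin_le_abs (x := φ); rwa [abs_of_pos hφ0] at this
      have l2 : |Real.sin (φ + x) - Real.sin φ| ≤ φ ^ (1 - s) * |x| ^ s := by
        have h3 := Real.abs_sin_sub_sin_le (φ + x) φ
        rw [add_sub_cancel_left] at h3
        refine h3.trans ?_
        have h4 : |x| = |x| ^ (1 - s) * |x| ^ s := by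
          rw [← Real.rpow_add_of_nonneg (abs_nonneg _) (by linarith) (by linarith)]
          rw [show 1 - s + s = 1 by ring, Real.rpow_one]
        nth_rewrite 1 [h4]
        exact mul_le_mul_of_nonneg_right
          (Real.rpow_le_rpow (abs_nonneg _) (by linarith) (by linarith))
          (Real.rpow_nonneg (abs_nonneg _) _)
      have l3 := mul_le_mul l1 l2 (abs_nonneg _) ((norm_nonneg _).trans l1)
      calc _ ≤ M₁ * φ ^ (2 * s) * (φ ^ (1 - s) * |x| ^ s) / (φ / 10 * (φ / 10)) :=
            div_le_div₀ (by positivity) l3 (by positivity)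
              (mul_le_mul hs3 hs2 (by positivity) n3.le)
        _ = _ := by
          have : φ ^ (2 * s) * φ ^ (1 - s) = φ ^ (s - 1) * (φ * φ) := by
            rw [← Real.rpow_add hφ0, ← pow_two, ← Real.rpow_natCast, ← Real.rpow_add hφ0]
            congr 1; push_cast; ring
          field_simp
          linear_combination 100 * M₁ * |x| ^ s * this
    simp only
    rw [e]
    refine (norm_sub_le _ _).trans ?_
    have := mul_nonneg hM₂0 hP
    linarith
  · have hx0 : 0 < |x| := by linarith
    have e1 : |x| ^ (2 * s - 1) ≤ 2 * (φ ^ (s - 1) * |x| ^ s) := by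
      have h3 : |x| ^ (2 * s - 1) = |x| ^ (s - 1) * |x| ^ s := by
        rw [← Real.rpow_add hx0]; congr 1; ring
      have h4 : |x| ^ (s - 1) ≤ 2 * φ ^ (s - 1) := by
        calc |x| ^ (s - 1) ≤ (φ / 2) ^ (s - 1) :=
              Real.rpow_le_rpow_of_nonpos (by positivity) hx (by linarith)
          _ = φ ^ (s - 1) * 2 ^ (1 - s) := by
              rw [Real.div_rpow hφ0.le (by norm_num), div_eq_mul_inv, ← Real.rpow_neg (by norm_num)]
              congr 2; ring
          _ ≤ φ ^ (s - 1) * 2 ^ (1:ℝ) := mul_le_mul_of_nonneg_left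
              (Real.rpow_le_rpow_of_exponent_le (by norm_num) (by linarith))
              (Real.rpow_nonneg hφ0.le _)
          _ = _ := by rw [Real.rpow_one]; ring
      rw [h3, ← mul_assoc]
      exact mul_le_mul_of_nonneg_right h4 (Real.rpow_nonneg (abs_nonneg _) _)
    have hk : ∀ k : ℝ, 1 ≤ k → (k * |x|) ^ (2 * s - 1) ≤ k * |x| ^ (2 * s - 1) := by
      intro k hk
      rw [Real.mul_rpow (by linarith) (abs_nonneg _)]
      refine mul_le_mul_of_nonneg_right ?_ (Real.rpow_nonneg (abs_nonneg _) _)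
      calc k ^ (2 * s - 1) ≤ k ^ (1:ℝ) := Real.rpow_le_rpow_of_exponent_le hk (by linarith)
        _ = k := Real.rpow_one k
    have b1 : ‖v (Real.cos (φ + x)) / Real.sin (φ + x)‖ ≤ M₂ * (3 * |x| ^ (2 * s - 1)) := by
      refine (hbd _).trans (mul_le_mul_of_nonneg_left ?_ hM₂0)
      refine (Real.rpow_le_rpow (abs_nonneg _) ?_ (by linarith)).trans (hk 3 (by norm_num))
      have := abs_add_le φ x
      rw [abs_of_pos hφ0] at this
      linarith
    have b2 : ‖v (Real.cos φ) / Real.sin φ‖ ≤ M₂ * (2 * |x| ^ (2 * s - 1)) := by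
      refine (hbd _).trans (mul_le_mul_of_nonneg_left ?_ hM₂0)
      refine (Real.rpow_le_rpow (abs_nonneg _) ?_ (by linarith)).trans (hk 2 (by norm_num))
      rw [abs_of_pos hφ0]; linarith
    refine (norm_sub_le _ _).trans ((add_le_add b1 b2).trans ?_)
    have := mul_le_mul_of_nonneg_left e1 hM₂0
    have := mul_nonneg hM₃0 hP
    have := mul_nonneg hM₁0 hP
    linarith

end AboveHalf

lemma HolderI.comp_neg {s : ℝ} {v : ℝ → ℂ} (hv : HolderI s v) : HolderI s fun t => v (-t) := by
  obtain ⟨C, hC⟩ := hv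
  refine ⟨C, fun x hx y hy => ?_⟩
  have := hC (-x) ⟨by linarith [hx.2], by linarith [hx.1]⟩ (-y)
    ⟨by linarith [hy.2], by linarith [hy.1]⟩
  rwa [show -x - -y = -(x - y) by ring, abs_neg] at this

lemma kerInt_comp_cos {s : ℝ} (hs : 0 < s) (hs1 : s < 1) {v : ℝ → ℂ} (hv : HolderI s v) (φ : ℝ) :
    KerInt (fun φ => v (Real.cos φ)) φ := by
  have ht := hv.mono (t := s / 2) (by linarith) hs1.le (by linarith)
  obtain ⟨M, hM0, hM⟩ := ht.comp_cos (by linarith) (by linarith)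
  have hmod : ModAt (fun φ => v (Real.cos φ)) φ (M * |φ| ^ (s / 2)) M (s / 2) (2 * (s / 2)) :=
    fun x => (hM φ x).trans (le_of_eq (by ring))
  exact hmod.kernel_intervalIntegrable (continuous_comp_cos (hv.continuousOn hs)).measurable
    (by linarith) (by linarith) (by linarith) (by linarith)

lemma conjInt_comp_cos_pi_sub (v : ℝ → ℂ) (φ : ℝ) :
    conjInt (fun φ => v (Real.cos φ)) (Real.pi - φ) =
      -conjInt (fun φ => v (-Real.cos φ)) φ := by
  have := conjInt_reflect (fun φ => v (Real.cos φ)) Real.pi φ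
  simp only [Real.cos_pi_sub] at this
  rw [this, neg_neg]

lemma conjInt_comp_cos_zero (v : ℝ → ℂ) : conjInt (fun φ => v (Real.cos φ)) 0 = 0 := by
  have := conjInt_reflect (fun φ => v (Real.cos φ)) 0 0
  simp only [zero_sub, Real.cos_neg, neg_zero] at this
  exact CharZero.eq_neg_self_iff.1 this

lemma conjInt_comp_cos_pi (v : ℝ → ℂ) : conjInt (fun φ => v (Real.cos φ)) Real.pi = 0 := by
  have := conjInt_comp_cos_pi_sub v 0
  rw [sub_zero] at this
  rw [this, conjInt_comp_cos_zero (fun t => v (-t)), neg_zero]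

section AboveHalf

variable {s : ℝ} {v : ℝ → ℂ}

lemma measurable_div_sin (hs : 0 < s) (hv : HolderI s v) :
    Measurable fun φ => v (Real.cos φ) / (Real.sin φ : ℂ) :=
  (continuous_comp_cos (hv.continuousOn hs)).measurable.div (by fun_prop)

lemma periodic_div_sin (v : ℝ → ℂ) :
    Function.Periodic (fun φ => v (Real.cos φ) / (Real.sin φ : ℂ)) (2 * Real.pi) := fun φ => by
  simp only [Real.cos_add_two_pi, Real.sin_add_two_pi]

/-- For exponents above `1/2`, the function `sin φ (H φ - H 0)` is Hölder continuous in the cosine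
variable near `φ = 0`, where `H` is the conjugate function of `v (cos φ) / sin φ`. -/
lemma cosHolder_sin_mul_conjInt (hs : 1 / 2 < s) (hs1 : s < 1) (hv : HolderI s v) (h1 : v 1 = 0)
    (h2 : v (-1) = 0) :
    CosHolder s fun φ => (Real.sin φ : ℂ) *
      (conjInt (fun φ => v (Real.cos φ) / Real.sin φ) φ -
        conjInt (fun φ => v (Real.cos φ) / Real.sin φ) 0) := by
  obtain ⟨M, hM0, hMz, hM⟩ := modAt_div_sin hs hs1 hv h1 h2
  obtain ⟨K, hK0, hK⟩ := exists_conjInt_sub_le (β := s) (γ := 2 * s - 1) (by linarith) hs1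
    (by linarith) (by linarith)
  set W : ℝ → ℂ := fun φ => v (Real.cos φ) / Real.sin φ with hW
  have hm : Measurable W := measurable_div_sin (by linarith) hv
  have hper : Function.Periodic W (2 * Real.pi) := periodic_div_sin v
  set G : ℝ → ℂ := fun φ => conjInt W φ - conjInt W 0 with hG
  have hG0 : ∀ φ, 0 ≤ φ → φ ≤ Real.pi / 2 → ‖G φ‖ ≤ 2 * K * M * φ ^ (2 * s - 1) := by
    intro φ hφ0 hφ
    rcases eq_or_lt_of_le hφ0 with h | h
    · rw [← h]; simp only [hG, sub_self, norm_zero]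
      have := Real.rpow_nonneg le_rfl (2 * s - 1)
      positivity
    have hP : 0 ≤ φ ^ (s - 1) := Real.rpow_nonneg hφ0 _
    have := hK W (M * φ ^ (s - 1)) M 0 φ hm hper (mul_nonneg hM0 hP) hM0
      (fun x => (hMz x).trans (by
        have := mul_nonneg (mul_nonneg hM0 hP) (Real.rpow_nonneg (abs_nonneg x) s)
        linarith))
      (fun x => (hM φ h hφ x).trans (by
        have := mul_nonneg hM0 (Real.rpow_nonneg (abs_nonneg x) (2 * s - 1))
        linarith))
    rw [sub_zero, abs_of_pos h] at this
    refine this.trans (le_of_eq ?_)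
    have e : φ ^ (s - 1) * φ ^ s = φ ^ (2 * s - 1) := by
      rw [← Real.rpow_add h]; congr 1; ring
    linear_combination K * M * e
  have hGd : ∀ a b, 0 ≤ a → a ≤ b → b ≤ Real.pi / 2 → b - a < b / 2 →
      ‖G b - G a‖ ≤ 2 * K * M * (b ^ (s - 1) * (b - a) ^ s) := by
    intro a b ha hab hb hδ
    have hb0 : 0 < b := by linarith
    have ha0 : 0 < a := by linarith
    have hP : 0 ≤ b ^ (s - 1) := Real.rpow_nonneg hb0.le _
    have h4 : a ^ (s - 1) ≤ 2 * b ^ (s - 1) := by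
      calc a ^ (s - 1) ≤ (b / 2) ^ (s - 1) :=
            Real.rpow_le_rpow_of_nonpos (by positivity) (by linarith) (by linarith)
        _ = b ^ (s - 1) * 2 ^ (1 - s) := by
            rw [Real.div_rpow hb0.le (by norm_num), div_eq_mul_inv, ← Real.rpow_neg (by norm_num)]
            congr 2; ring
        _ ≤ b ^ (s - 1) * 2 ^ (1:ℝ) := mul_le_mul_of_nonneg_left
            (Real.rpow_le_rpow_of_exponent_le (by norm_num) (by linarith)) hP
        _ = _ := by rw [Real.rpow_one]; ring
    have := hK W (2 * M * b ^ (s - 1)) 0 a b hm hper (by positivity) le_rfl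
      (fun x => (hM a ha0 (by linarith) x).trans (by
        have := mul_le_mul_of_nonneg_left
          (mul_le_mul_of_nonneg_right h4 (Real.rpow_nonneg (abs_nonneg x) s)) hM0
        linarith))
      (fun x => (hM b hb0 hb x).trans (by
        have := mul_nonneg (mul_nonneg hM0 hP) (Real.rpow_nonneg (abs_nonneg x) s)
        linarith))
    rw [abs_of_nonneg (by linarith : 0 ≤ b - a)] at this
    simp only [hG, sub_sub_sub_cancel_right]
    refine this.trans (le_of_eq (by ring))
  refine ⟨8 * K * M, by positivity, fun a b ha hab hb => ?_⟩
  have hb0 : 0 ≤ b := ha.trans hab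
  have hKM : 0 ≤ K * M := mul_nonneg hK0 hM0
  have sb : |Real.sin b| ≤ b := by
    have := Real.abs_sin_le_abs (x := b); rwa [abs_of_nonneg hb0] at this
  have sa : |Real.sin a| ≤ a := by
    have := Real.abs_sin_le_abs (x := a); rwa [abs_of_nonneg ha] at this
  have hxx : ∀ x : ℝ, 0 ≤ x → x * x ^ (2 * s - 1) = x ^ s * x ^ s := by
    intro x hx
    rw [← rpow_two_mul (by linarith) hx]
    nth_rewrite 1 [← Real.rpow_one x]
    rw [← Real.rpow_add_of_nonneg hx zero_le_one (by linarith)]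
    congr 1; ring
  have hsG : ∀ x, 0 ≤ x → x ≤ b → ‖(Real.sin x : ℂ) * G x‖ ≤ 2 * K * M * (b ^ s * b ^ s) := by
    intro x hx0 hxb
    rw [norm_mul, Complex.norm_real, Real.norm_eq_abs]
    have sx : |Real.sin x| ≤ x := by
      have := Real.abs_sin_le_abs (x := x); rwa [abs_of_nonneg hx0] at this
    have h3 := mul_le_mul sx (hG0 x hx0 (by linarith)) (norm_nonneg _) hx0
    have h4 : x ^ s * x ^ s ≤ b ^ s * b ^ s := by
      have := Real.rpow_le_rpow hx0 hxb (by linarith : 0 ≤ s)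
      exact mul_le_mul this this (Real.rpow_nonneg hx0 _) (Real.rpow_nonneg hb0 _)
    have h5 := mul_le_mul_of_nonneg_left h4 hKM
    have h6 := hxx x hx0
    calc _ ≤ _ := h3
      _ = 2 * (K * M) * (x * x ^ (2 * s - 1)) := by ring
      _ ≤ _ := by rw [h6]; linarith
  have hbs : 0 ≤ b ^ s := Real.rpow_nonneg hb0 _
  rcases lt_or_ge (b - a) (b / 2) with hδ | hδ
  · have hbp : 0 < b := by linarith
    have e : (Real.sin b : ℂ) * G b - Real.sin a * G a =
        Real.sin b * (G b - G a) + ((Real.sin b - Real.sin a : ℝ) : ℂ) * G a := by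
      push_cast; ring
    have hsd : |Real.sin b - Real.sin a| ≤ b - a := by
      have := Real.abs_sin_sub_sin_le b a
      rwa [abs_of_nonneg (by linarith : 0 ≤ b - a)] at this
    have q1 := mul_le_mul sb (hGd a b ha hab hb hδ) (norm_nonneg _) hb0
    have q2 := mul_le_mul hsd (hG0 a ha (by linarith)) (norm_nonneg _) (by linarith)
    have q3 : b * b ^ (s - 1) = b ^ s := by
      nth_rewrite 1 [← Real.rpow_one b]
      rw [← Real.rpow_add hbp]; congr 1; ring
    have q4 : (b - a) * a ^ (2 * s - 1) ≤ b ^ s * (b - a) ^ s := by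
      have r1 : a ^ (2 * s - 1) ≤ b ^ (2 * s - 1) := Real.rpow_le_rpow ha hab (by linarith)
      have r2 : b - a = (b - a) ^ s * (b - a) ^ (1 - s) := by
        rw [← Real.rpow_add_of_nonneg (by linarith) (by linarith) (by linarith)]
        rw [show s + (1 - s) = 1 by ring, Real.rpow_one]
      have r3 : (b - a) ^ (1 - s) ≤ b ^ (1 - s) :=
        Real.rpow_le_rpow (by linarith) (by linarith) (by linarith)
      have r4 : b ^ (1 - s) * b ^ (2 * s - 1) = b ^ s := by
        rw [← Real.rpow_add hbp]; congr 1; ring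
      have p1 : 0 ≤ (b - a) ^ s := Real.rpow_nonneg (by linarith) _
      nth_rewrite 1 [r2]
      rw [mul_assoc, mul_comm (b ^ s), ← r4]
      exact mul_le_mul_of_nonneg_left
        (mul_le_mul r3 r1 (Real.rpow_nonneg ha _) (Real.rpow_nonneg hb0 _)) p1
    change ‖(Real.sin b : ℂ) * G b - Real.sin a * G a‖ ≤ _
    rw [e]
    refine (norm_add_le _ _).trans ?_
    rw [norm_mul, norm_mul, Complex.norm_real, Complex.norm_real, Real.norm_eq_abs,
      Real.norm_eq_abs]
    have q5 := mul_le_mul_of_nonneg_left q4 hKM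
    have p1 : 0 ≤ K * M * (b ^ s * (b - a) ^ s) :=
      mul_nonneg hKM (mul_nonneg hbs (Real.rpow_nonneg (by linarith) _))
    calc _ ≤ b * (2 * K * M * (b ^ (s - 1) * (b - a) ^ s)) +
          (b - a) * (2 * K * M * a ^ (2 * s - 1)) := add_le_add q1 q2
      _ = 2 * (K * M * (b * b ^ (s - 1) * (b - a) ^ s)) +
          2 * (K * M * ((b - a) * a ^ (2 * s - 1))) := by ring
      _ ≤ _ := by rw [q3]; linarith
  · have hδ' : b ^ s ≤ 2 * (b - a) ^ s := by
      calc b ^ s ≤ (2 * (b - a)) ^ s := Real.rpow_le_rpow hb0 (by linarith) (by linarith)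
        _ = 2 ^ s * (b - a) ^ s := Real.mul_rpow (by norm_num) (by linarith)
        _ ≤ 2 ^ (1:ℝ) * (b - a) ^ s := mul_le_mul_of_nonneg_right
            (Real.rpow_le_rpow_of_exponent_le (by norm_num) hs1.le)
            (Real.rpow_nonneg (by linarith) _)
        _ = _ := by rw [Real.rpow_one]
    refine (norm_sub_le _ _).trans ((add_le_add (hsG b hb0 le_rfl) (hsG a ha hab)).trans ?_)
    have := mul_le_mul_of_nonneg_left (mul_le_mul_of_nonneg_left hδ' hbs) hKM
    linarith

lemma kerInt_div_sin (hs : 1 / 2 < s) (hs1 : s < 1) (hv : HolderI s v) (h1 : v 1 = 0)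
    (h2 : v (-1) = 0) {φ : ℝ} (h0 : 0 ≤ φ) (hpi : φ ≤ Real.pi) :
    KerInt (fun φ => v (Real.cos φ) / Real.sin φ) φ := by
  have hmod : ∀ {v : ℝ → ℂ}, HolderI s v → v 1 = 0 → v (-1) = 0 → ∀ {φ : ℝ}, 0 ≤ φ →
      φ ≤ Real.pi / 2 → ∃ A B : ℝ,
        ModAt (fun φ => v (Real.cos φ) / Real.sin φ) φ A B s (2 * s - 1) := by
    intro v hv h1 h2 φ h0 hφ
    obtain ⟨M, hM0, hMz, hM⟩ := modAt_div_sin hs hs1 hv h1 h2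
    rcases eq_or_lt_of_le h0 with h | h
    · exact ⟨0, M, h ▸ hMz⟩
    · exact ⟨_, _, hM φ h hφ⟩
  have hex : ∃ A B : ℝ, ModAt (fun φ => v (Real.cos φ) / Real.sin φ) φ A B s (2 * s - 1) := by
    rcases le_total φ (Real.pi / 2) with h | h
    · exact hmod hv h1 h2 h0 h
    · obtain ⟨A, B, hAB⟩ := hmod hv.comp_neg h2 (by simpa using h1)
        (φ := Real.pi - φ) (by linarith) (by linarith)
      refine ⟨A, B, ModAt.of_reflect (c := Real.pi) ?_⟩
      simpa only [Real.cos_pi_sub, Real.sin_pi_sub] using hAB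
  obtain ⟨A, B, hAB⟩ := hex
  exact hAB.kernel_intervalIntegrable (measurable_div_sin (by linarith) hv) (by linarith) hs1
    (by linarith) (by linarith)

lemma conjInt_comp_cos_eq_sin_mul (hs : 1 / 2 < s) (hs1 : s < 1) (hv : HolderI s v)
    (h1 : v 1 = 0) (h2 : v (-1) = 0) {φ : ℝ} (h0 : 0 ≤ φ) (hpi : φ ≤ Real.pi) :
    conjInt (fun φ => v (Real.cos φ)) φ =
      Real.sin φ * conjInt (fun φ => v (Real.cos φ) / Real.sin φ) φ := by
  obtain ⟨M, hM0, hM⟩ := norm_div_sin_le hs hv h1 h2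
  set W : ℝ → ℂ := fun φ => v (Real.cos φ) / Real.sin φ with hW
  have hodd : ∀ x, W (-x) = -W x := fun x => by
    simp only [hW, Real.cos_neg, Real.sin_neg, Complex.ofReal_neg, div_neg]
  have hi : IntervalIntegrable W volume (-Real.pi) Real.pi := by
    refine (intervalIntegrable_const (c := M)).mono_fun
      (measurable_div_sin (by linarith) hv).aestronglyMeasurable
      (Eventually.of_forall fun φ => (hM φ).trans ?_)
    rw [Real.norm_eq_abs, abs_of_nonneg hM0]
    exact mul_le_of_le_one_right hM0 (Real.rpow_le_one (abs_nonneg _) (Real.abs_sin_le_one _)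
      (by linarith))
  have hz : ∀ f : ℝ → ℂ, (∀ x, f (-x) = -f x) → ∫ x in (-Real.pi)..Real.pi, f x = 0 := by
    intro f hf
    have := intervalIntegral.integral_comp_neg (a := -Real.pi) (b := Real.pi) f
    simp only [hf, intervalIntegral.integral_neg, neg_neg] at this
    exact CharZero.neg_eq_self_iff.1 this
  have key := conjInt_sin_mul (periodic_div_sin v) (kerInt_div_sin hs hs1 hv h1 h2 h0 hpi) hi
  rw [hz W hodd, hz (fun x => (Real.cos x : ℂ) * W x) (fun x => by
    simp only [hodd, Real.cos_neg]; ring), mul_zero, add_zero, add_zero] at key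
  rw [← key]
  congr 1
  ext x
  rcases eq_or_ne (Real.sin x) 0 with h | h
  · rw [h, Complex.ofReal_zero, zero_mul]
    rcases Real.sin_eq_zero_iff_cos_eq.1 h with h' | h' <;> rw [h'] <;> assumption
  · have : (Real.sin x : ℂ) ≠ 0 := by exact_mod_cast h
    field_simp

end AboveHalf

/-- The sets of exponents for which the conjugation operator is controlled. -/
def GoodExp (T : Set ℝ) : Prop := T.Nonempty ∧ (T ⊆ Ioo 0 (1 / 2) ∨ T ⊆ Ioo (1 / 2) 1)

lemma GoodExp.subset {T : Set ℝ} (hT : GoodExp T) : T ⊆ Ioo 0 1 := by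
  intro s hs
  rcases hT.2 with h | h
  · exact ⟨(h hs).1, by linarith [(h hs).2]⟩
  · exact ⟨by linarith [(h hs).1], (h hs).2⟩

/-- The decomposition of the conjugate function for Hölder densities. -/
lemma exists_conjInt_decomp_zero {T : Set ℝ} (hT : GoodExp T) {v : ℝ → ℂ}
    (hv : HolderClass False T 0 v) :
    ∃ (d : ℝ → ℂ) (p : ℂ[X]), HolderClass True T 0 d ∧ ∀ φ ∈ Icc 0 Real.pi,
      conjInt (fun φ => v (Real.cos φ)) φ =
        d (Real.cos φ) + Real.sin φ * p.eval (Real.cos φ : ℂ) := by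
  obtain ⟨-, hv⟩ := hv
  obtain ⟨s₀, hs₀⟩ := hT.1
  have hs₀' := hT.subset hs₀
  rcases hT.2 with hlt | hgt
  · refine ⟨fun t => conjInt (fun φ => v (Real.cos φ)) (Real.arccos t), 0, ⟨fun _ => ?_, ?_⟩, ?_⟩
    · simp only [Real.arccos_one, Real.arccos_neg_one, conjInt_comp_cos_zero, conjInt_comp_cos_pi,
        and_self]
    · intro s hs
      refine holderI_of_cosHolder (hlt hs).1 (cosHolder_conjInt (hlt hs).1 (hlt hs).2 (hv s hs)) ?_
      simp only [conjInt_comp_cos_pi_sub, ← neg_one_mul (conjInt _ _)]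
      exact (cosHolder_conjInt (hlt hs).1 (hlt hs).2 (hv s hs).comp_neg).const_mul (-1)
    · intro φ hφ
      simp only [Real.arccos_cos hφ.1 hφ.2, eval_zero, mul_zero, add_zero]
  set A : ℂ := (v 1 + v (-1)) / 2 with hA
  set B : ℂ := (v 1 - v (-1)) / 2 with hB
  set w : ℝ → ℂ := fun t => v t + -(A + B * t) with hw
  have hlin : ∀ s ∈ T, HolderI s (fun t : ℝ => -(A + B * t)) := by
    intro s hs
    exact (HolderClass.of_differentiableOn hT.subset isOpen_univ (subset_univ _)
      (F := fun z => -(A + B * z)) (by fun_prop) : HolderClass False T 0 _).2 s hs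
  have hwH : ∀ s ∈ T, HolderI s w := fun s hs => (hv s hs).add (hlin s hs)
  have w1 : w 1 = 0 := by simp only [hw, hA, hB]; push_cast; ring
  have w2 : w (-1) = 0 := by simp only [hw, hA, hB]; push_cast; ring
  set H : ℝ → ℂ := conjInt (fun φ => w (Real.cos φ) / Real.sin φ) with hH
  set a : ℂ := (H 0 + H Real.pi) / 2 with ha
  set b : ℂ := (H 0 - H Real.pi) / 2 with hb
  set f : ℝ → ℂ := fun φ => Real.sin φ * (H φ - (a + b * Real.cos φ)) with hf
  refine ⟨fun t => f (Real.arccos t), C (a - 2 * Real.pi * B) + C b * X, ⟨fun _ => ?_, ?_⟩, ?_⟩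
  · simp [hf]
  · intro s hs
    refine holderI_of_cosHolder (by linarith [(hgt hs).1]) ?_ ?_
    · have c1 := cosHolder_sin_mul_conjInt (hgt hs).1 (hgt hs).2 (hwH s hs) w1 w2
      have c2 := (cosHolder_sin_mul (by linarith [(hgt hs).1]) (hgt hs).2).const_mul b
      convert c1.add c2 using 2 with φ
      simp only [hf, ha, hb, ← hH]; push_cast; ring
    · have w1' : (fun t : ℝ => w (-t)) 1 = 0 := w2
      have w2' : (fun t : ℝ => w (-t)) (-1) = 0 := by simpa using w1
      have c1 := cosHolder_sin_mul_conjInt (hgt hs).1 (hgt hs).2 (hwH s hs).comp_neg w1' w2'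
      have c2 := (cosHolder_sin_mul (by linarith [(hgt hs).1]) (hgt hs).2).const_mul (-b)
      have hr : ∀ φ, conjInt (fun φ => w (-Real.cos φ) / Real.sin φ) φ = -H (Real.pi - φ) := by
        intro φ
        have := conjInt_reflect (fun φ => w (Real.cos φ) / Real.sin φ) Real.pi φ
        simpa only [Real.cos_pi_sub, Real.sin_pi_sub] using this
      convert (c1.const_mul (-1)).add c2 using 2 with φ
      simp only [hf, ha, hb, hr, Real.sin_pi_sub, Real.cos_pi_sub, sub_zero]
      push_cast; ring
  · intro φ hφ
    have k1 := conjInt_comp_cos_eq_sin_mul (hgt hs₀).1 (hgt hs₀).2 (hwH s₀ hs₀) w1 w2 hφ.1 hφ.2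
    have k2 : KerInt (fun φ => w (Real.cos φ)) φ :=
      kerInt_comp_cos hs₀'.1 hs₀'.2 (hwH s₀ hs₀) φ
    have k3 : KerInt (fun φ => A + B * (Real.cos φ : ℂ)) φ := by
      refine ((kerInt_cos φ).const_mul B).congr fun x _ => ?_
      ring
    have k4 : conjInt (fun φ => A + B * (Real.cos φ : ℂ)) φ =
        B * conjInt (fun φ => (Real.cos φ : ℂ)) φ := by
      rw [← conjInt_const_mul, conjInt, conjInt]
      exact intervalIntegral.integral_congr fun x _ => by ring
    have k5 := conjInt_add k2 k3
    rw [k1, k4, conjInt_cos] at k5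
    have k6 : (fun x => w (Real.cos x) + (A + B * (Real.cos x : ℂ))) =
        fun φ => v (Real.cos φ) := by
      ext x; simp only [hw]; ring
    rw [k6] at k5
    rw [k5, ← hH]
    simp only [hf, Real.arccos_cos hφ.1 hφ.2, eval_add, eval_mul, eval_C, eval_X]
    push_cast; ring

/-! ### Differentiating the conjugate function -/

lemma hasDerivAt_conjInt {W W' : ℝ → ℂ} {φ A B β γ : ℝ} (hW : ∀ x, HasDerivAt W (W' x) x)
    (hW' : Continuous W') (hk : KerInt W φ) (hβ0 : 0 < β) (hβ : β < 1) (hγ0 : 0 < γ) (hγ : γ < 1)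
    (hmod : ∀ c ∈ ball φ 1, ModAt W' c A B β γ) :
    HasDerivAt (conjInt W) (conjInt W' φ) φ := by
  have hpi := Real.pi_pos
  have hWc : Continuous W := continuous_iff_continuousAt.2 fun x => (hW x).continuousAt
  have hmeas : ∀ {Z : ℝ → ℂ}, Continuous Z → ∀ a, AEStronglyMeasurable
      (fun x => (Z (a + x) - Z a) * (cotH x : ℂ))
      (volume.restrict (uIoc (-Real.pi) Real.pi)) := by
    intro Z hZ a
    refine Measurable.aestronglyMeasurable ?_
    exact ((hZ.measurable.comp (measurable_const_add a)).sub_const _).mul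
      (Complex.measurable_ofReal.comp measurable_cotH)
  refine (intervalIntegral.hasDerivAt_integral_of_dominated_loc_of_deriv_le
    (F := fun a x => (W (a + x) - W a) * (cotH x : ℂ))
    (F' := fun a x => (W' (a + x) - W' a) * (cotH x : ℂ))
    (bound := fun x => 10 * (A * |x| ^ (β - 1) + B * |x| ^ (γ - 1)))
    (ball_mem_nhds φ one_pos) (Eventually.of_forall fun a => hmeas hWc a) hk (hmeas hW' φ)
    (Eventually.of_forall fun x hx a ha => ?_) ?_
    (Eventually.of_forall fun x hx a ha => ?_)).2
  · rw [uIoc_of_le (by linarith)] at hx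
    refine (hmod a ha).kernel_bound hβ0 hβ hγ0 hγ ?_
    exact abs_le.2 ⟨by linarith [hx.1], by linarith [hx.2]⟩
  · exact (((intervalIntegrable_abs_rpow (by linarith) _ _).const_mul _).add
      ((intervalIntegrable_abs_rpow (by linarith) _ _).const_mul _)).const_mul _
  · have h1 : HasDerivAt (fun a => W (a + x)) (W' (a + x)) a := (hW (a + x)).comp_add_const a x
    exact (h1.sub (hW a)).mul_const _

lemma abs_sin_add_sub_le {t : ℝ} (ht : 0 ≤ t) (ht1 : t ≤ 1) (c x : ℝ) :
    |Real.sin (c + x) - Real.sin c| ≤ 2 * |x| ^ t := by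
  rcases le_total |x| 1 with h | h
  · have h1 : |Real.sin (c + x) - Real.sin c| ≤ |x| := by
      simpa using Real.abs_sin_sub_sin_le (c + x) c
    have h2 : |x| ≤ |x| ^ t := Real.self_le_rpow_of_le_one (abs_nonneg _) h ht1
    have := abs_nonneg x
    linarith
  · have h1 : |Real.sin (c + x) - Real.sin c| ≤ 2 := by
      rw [abs_le]
      constructor <;>
      linarith [Real.neg_one_le_sin (c + x), Real.neg_one_le_sin c, Real.sin_le_one (c + x),
        Real.sin_le_one c]
    have h2 := Real.one_le_rpow h ht
    linarith

lemma modAt_sin_mul_comp_cos {s : ℝ} (hs : 0 < s) (hs1 : s < 1) {w : ℝ → ℂ} (hw : HolderI s w)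
    (R : ℝ) : ∃ A B : ℝ, ∀ c, |c| ≤ R →
      ModAt (fun φ => (Real.sin φ : ℂ) * w (Real.cos φ)) c A B (s / 2) s := by
  have ht := hw.mono (t := s / 2) (by linarith) hs1.le (by linarith)
  obtain ⟨M, hM0, hM⟩ := ht.comp_cos (by linarith) (by linarith)
  obtain ⟨K, hK0, hK⟩ := hw.bounded hs.le hs1.le
  refine ⟨2 * K + M * R ^ (s / 2), M, fun c hc x => ?_⟩
  have e : (Real.sin (c + x) : ℂ) * w (Real.cos (c + x)) - Real.sin c * w (Real.cos c) =
      ((Real.sin (c + x) - Real.sin c : ℝ) : ℂ) * w (Real.cos (c + x)) +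
        Real.sin c * (w (Real.cos (c + x)) - w (Real.cos c)) := by push_cast; ring
  change ‖(Real.sin (c + x) : ℂ) * w (Real.cos (c + x)) - Real.sin c * w (Real.cos c)‖ ≤ _
  rw [e]
  refine (norm_add_le _ _).trans ?_
  rw [norm_mul, norm_mul, Complex.norm_real, Complex.norm_real, Real.norm_eq_abs, Real.norm_eq_abs]
  have h1 := mul_le_mul (abs_sin_add_sub_le (t := s / 2) (by linarith) (by linarith) c x)
    (hK (Real.cos (c + x)) ⟨Real.neg_one_le_cos _, Real.cos_le_one _⟩) (norm_nonneg _)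
    (by positivity)
  have h2 := mul_le_mul (Real.abs_sin_le_one c) (hM c x) (norm_nonneg _) zero_le_one
  have h3 : |c| ^ (s / 2) ≤ R ^ (s / 2) := Real.rpow_le_rpow (abs_nonneg _) hc (by linarith)
  have h4 : M * (|c| ^ (s / 2) * |x| ^ (s / 2)) ≤ M * (R ^ (s / 2) * |x| ^ (s / 2)) := by gcongr
  rw [show 2 * (s / 2) = s by ring] at h2
  linarith

lemma hasDerivAt_comp_cos {v v' : ℝ → ℂ}
    (hv : ∀ x ∈ Icc (-1:ℝ) 1, HasDerivWithinAt v (v' x) (Icc (-1) 1) x) (φ : ℝ) :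
    HasDerivAt (fun φ => v (Real.cos φ)) ((Real.sin φ : ℂ) * -v' (Real.cos φ)) φ := by
  have hm : ∀ φ, Real.cos φ ∈ Icc (-1:ℝ) 1 := fun φ => ⟨Real.neg_one_le_cos _, Real.cos_le_one _⟩
  have := (hv _ (hm φ)).scomp_hasDerivAt φ (Real.hasDerivAt_cos φ) hm
  have e : (Real.sin φ : ℂ) * -v' (Real.cos φ) = (-Real.sin φ) • v' (Real.cos φ) := by
    rw [Complex.real_smul]; push_cast; ring
  rw [e]
  exact this

/-- The derivative of the conjugate function of `v ∘ cos`. -/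
lemma hasDerivAt_conjInt_comp_cos {s : ℝ} (hs : 0 < s) (hs1 : s < 1) {v v' : ℝ → ℂ}
    (hv : ∀ x ∈ Icc (-1:ℝ) 1, HasDerivWithinAt v (v' x) (Icc (-1) 1) x) (hv' : HolderI s v') :
    ∃ α β : ℂ, ∀ φ, HasDerivAt (conjInt fun φ => v (Real.cos φ))
      (-(Real.sin φ * conjInt (fun φ => v' (Real.cos φ)) φ + (α + β * Real.cos φ))) φ := by
  refine ⟨∫ x in (-Real.pi)..Real.pi, (Real.cos x : ℂ) * v' (Real.cos x),
    ∫ x in (-Real.pi)..Real.pi, v' (Real.cos x), fun φ => ?_⟩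
  obtain ⟨K, -, hK⟩ := hv'.bounded hs.le hs1.le
  have hvs : HolderI s v := HolderI.of_hasDerivWithinAt hs hs1.le hv hK
  have hn : HolderI s fun t => -v' t := by
    refine (hv'.mul (w := fun _ => -1) hs.le hs1.le ⟨0, fun x _ y _ => by simp⟩).congr
      fun x _ => by ring
  obtain ⟨A, B, hAB⟩ := modAt_sin_mul_comp_cos hs hs1 hn (|φ| + 1)
  have hc : Continuous fun φ => (Real.sin φ : ℂ) * -v' (Real.cos φ) :=
    (Complex.continuous_ofReal.comp Real.continuous_sin).mul
      (continuous_comp_cos (v := fun t => -v' t) (hn.continuousOn hs))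
  have key := hasDerivAt_conjInt (fun x => hasDerivAt_comp_cos hv x) hc
    (kerInt_comp_cos hs hs1 hvs φ) (by linarith : (0:ℝ) < s / 2) (by linarith) hs hs1
    (fun c hc => hAB c (by
      have := abs_sub_abs_le_abs_sub c φ
      have h2 : |c - φ| < 1 := hc
      linarith))
  convert key using 1
  have e := conjInt_sin_mul (periodic_comp_cos v') (kerInt_comp_cos hs hs1 hv' φ)
    ((continuous_comp_cos (hv'.continuousOn hs)).intervalIntegrable _ _)
  have e2 := conjInt_const_mul (fun x => (Real.sin x : ℂ) * v' (Real.cos x)) (-1) φ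
  rw [e] at e2
  have e3 : (fun x => (Real.sin x : ℂ) * -v' (Real.cos x)) =
    fun x => (-1 : ℂ) * ((Real.sin x : ℂ) * v' (Real.cos x)) := by ext x; ring
  rw [e3, e2]; ring

/-! ### The decomposition theorem on the segment -/

section PolynomialLemma

lemma C_two : (C 2 : ℂ[X]) = 2 := map_ofNat C 2

lemma exists_sin_antideriv_one (M : ℕ) : ∃ (p : ℂ[X]) (c : ℂ),
    (1 : ℂ[X]) = X * p - (1 - X ^ 2) * derivative p + C c * (1 - X ^ 2) ^ M := by
  induction M with
  | zero => exact ⟨0, 1, by simp⟩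
  | succ k ih =>
    obtain ⟨p, c, h⟩ := ih
    have hk : (2 * k + 1 : ℂ) ≠ 0 := by exact_mod_cast (by omega : 2 * k + 1 ≠ 0)
    set b : ℂ := c / (2 * k + 1) with hb
    have hc : C c = C b * (2 * (k : ℂ[X]) + 1) := by
      have : c = b * (2 * k + 1) := by rw [hb]; field_simp
      conv_lhs => rw [this]
      simp [C_two]
    refine ⟨p + C b * (X * (1 - X ^ 2) ^ k), b * (2 * k + 2), ?_⟩
    have hd : (1 - X ^ 2) * derivative ((1 - X ^ 2 : ℂ[X]) ^ k) =
        -2 * (k : ℂ[X]) * X * (1 - X ^ 2) ^ k := by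
      rcases k with _ | k
      · simp
      · rw [derivative_pow_succ]
        simp only [derivative_sub, derivative_one, derivative_X_pow, Nat.cast_add, Nat.cast_one,
          map_add, map_natCast, map_one]
        norm_num
        ring
    have hd2 : (1 - X ^ 2) * derivative (C b * (X * (1 - X ^ 2 : ℂ[X]) ^ k)) =
        C b * ((1 - X ^ 2) * (1 - X ^ 2) ^ k + X * (-2 * (k : ℂ[X]) * X * (1 - X ^ 2) ^ k)) := by
      rw [derivative_C_mul, derivative_mul, derivative_X, ← hd]; ring
    rw [derivative_add, mul_add (1 - X ^ 2 : ℂ[X]), hd2, pow_succ]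
    have hc2 : (C (b * (2 * k + 2)) : ℂ[X]) = C b * (2 * (k : ℂ[X]) + 2) := by simp [C_two]
    rw [hc2]
    linear_combination h + (1 - X ^ 2) ^ k * hc

/-- Every polynomial `q` differs from an operator value `X p - (1 - X²) p'` by a multiple of
`(1 - X²)^M`. -/
lemma exists_sin_antideriv (M : ℕ) (q : ℂ[X]) : ∃ (p : ℂ[X]) (c : ℂ),
    q = X * p - (1 - X ^ 2) * derivative p + C c * (1 - X ^ 2) ^ M := by
  have hmon : ∀ n : ℕ, ∃ (p : ℂ[X]) (c : ℂ),
      (X ^ n : ℂ[X]) = X * p - (1 - X ^ 2) * derivative p + C c * (1 - X ^ 2) ^ M := by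
    intro n
    induction n using Nat.twoStepInduction with
    | zero => simpa using exists_sin_antideriv_one M
    | one => exact ⟨1, 0, by simp⟩
    | more n ih _ =>
      obtain ⟨p, c, h⟩ := ih
      have hn : (n + 2 : ℂ) ≠ 0 := by exact_mod_cast (by omega : n + 2 ≠ 0)
      have h1 : C ((1 : ℂ) / (n + 2)) * ((n : ℂ[X]) + 2) = 1 := by
        have : ((n : ℂ[X]) + 2) = C (n + 2 : ℂ) := by simp [C_two]
        rw [this, ← C_mul, one_div_mul_cancel hn, C_1]
      refine ⟨C ((1 : ℂ) / (n + 2)) * (X ^ (n + 1) + (n + 1 : ℂ[X]) * p),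
        (1 : ℂ) / (n + 2) * (n + 1) * c, ?_⟩
      have hd : derivative (C ((1 : ℂ) / (n + 2)) * (X ^ (n + 1) + (n + 1 : ℂ[X]) * p)) =
          C ((1 : ℂ) / (n + 2)) * ((n + 1 : ℂ[X]) * X ^ n + (n + 1 : ℂ[X]) * derivative p) := by
        rw [derivative_C_mul, derivative_add, derivative_X_pow, derivative_mul]
        simp
      have hc2 : (C ((1 : ℂ) / (n + 2) * (n + 1) * c) : ℂ[X]) =
        C ((1 : ℂ) / (n + 2)) * (n + 1 : ℂ[X]) * C c := by simp
      rw [hd, hc2]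
      linear_combination (-X ^ (n + 2)) * h1 + C ((1 : ℂ) / (n + 2)) * (n + 1 : ℂ[X]) * h
  induction q using Polynomial.induction_on' with
  | add q r hq hr =>
    obtain ⟨p, c, h⟩ := hq
    obtain ⟨p', c', h'⟩ := hr
    exact ⟨p + p', c + c', by rw [derivative_add, C_add]; linear_combination h + h'⟩
  | monomial n a =>
    obtain ⟨p, c, h⟩ := hmon n
    refine ⟨C a * p, a * c, ?_⟩
    rw [derivative_C_mul, C_mul, ← C_mul_X_pow_eq_monomial]
    linear_combination C a * h

end PolynomialLemma

lemma HolderClass.continuousOn {z : Prop} {T : Set ℝ} {m : ℕ} {v : ℝ → ℂ} (hT : T ⊆ Ioo 0 1)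
    (hne : T.Nonempty) (h : HolderClass z T m v) : ContinuousOn v (Icc (-1) 1) := by
  obtain ⟨s, hs⟩ := hne
  exact (h.holderI_zero hT hs).continuousOn (hT hs).1

/-- An antiderivative on `[-1,1]` vanishing at `1`. -/
lemma exists_antideriv {e : ℝ → ℂ} (he : ContinuousOn e (Icc (-1) 1)) :
    ∃ d : ℝ → ℂ, d 1 = 0 ∧ ∀ x ∈ Icc (-1:ℝ) 1, HasDerivAt d (e x) x := by
  set E : ℝ → ℂ := IccExtend (by norm_num : (-1:ℝ) ≤ 1) ((Icc (-1) 1).domRestrict e) with hE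
  have hEc : Continuous E := (continuousOn_iff_continuous_domRestrict.1 he).Icc_extend'
  refine ⟨fun t => ∫ x in (1:ℝ)..t, E x, intervalIntegral.integral_same, fun x hx => ?_⟩
  have h1 : E x = e x := by
    rw [hE, IccExtend_of_mem _ _ hx]; rfl
  rw [← h1]
  exact intervalIntegral.integral_hasDerivAt_right (hEc.intervalIntegrable _ _)
    (hEc.stronglyMeasurableAtFilter _ _) hEc.continuousAt

/-- The conjugate function of `v ∘ cos` for `v` in a Hölder class is, up to a term
`sin φ · p (cos φ)` with a polynomial `p`, a function in the same class, vanishing at `±1`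
together with its derivatives. -/
theorem exists_conjInt_decomp {T : Set ℝ} (hT : GoodExp T) (m : ℕ) : ∀ {v : ℝ → ℂ},
    HolderClass False T m v →
    ∃ (d : ℝ → ℂ) (p : ℂ[X]), HolderClass True T m d ∧ ∀ φ ∈ Icc 0 Real.pi,
      conjInt (fun φ => v (Real.cos φ)) φ =
        d (Real.cos φ) + Real.sin φ * p.eval (Real.cos φ : ℂ) := by
  induction m with
  | zero => exact fun hv => exists_conjInt_decomp_zero hT hv
  | succ m ih =>
    intro v hv
    obtain ⟨-, v', hvv', hv'⟩ := hv
    obtain ⟨s, hs⟩ := hT.1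
    have hs' := hT.subset hs
    obtain ⟨d₀, p₀, hd₀, hp₀⟩ := ih hv'
    obtain ⟨α, β, hder⟩ := hasDerivAt_conjInt_comp_cos hs'.1 hs'.2 hvv'
      (hv'.holderI_zero hT.subset hs)
    obtain ⟨p, c, hpc⟩ := exists_sin_antideriv (m + 2) (-((1 - X ^ 2) * p₀ + (C α + C β * X)))
    set r : ℝ := m + 3 / 2 with hr
    set e : ℝ → ℂ := fun t => d₀ t + -c * (((1 - t ^ 2) ^ r : ℝ) : ℂ) with he
    have hec : HolderClass True T m e :=
      hd₀.add ((HolderClass.weight hT.subset (by rw [hr]; linarith)).const_mul hT.subset _)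
    obtain ⟨d, hd1, hd⟩ := exists_antideriv (hec.continuousOn hT.subset hT.1)
    have hcosm : ∀ φ, Real.cos φ ∈ Icc (-1:ℝ) 1 :=
      fun φ => ⟨Real.neg_one_le_cos _, Real.cos_le_one _⟩
    have hcd : ∀ φ, HasDerivAt (fun φ => d (Real.cos φ)) (-Real.sin φ * e (Real.cos φ)) φ := by
      intro φ
      have := hasDerivAt_comp_cos (fun x hx => (hd x hx).hasDerivWithinAt) φ
      convert this using 1
      ring
    have hsp : ∀ φ, HasDerivAt (fun φ : ℝ => (Real.sin φ : ℂ) * p.eval (Real.cos φ : ℂ))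
        (Real.cos φ * p.eval (Real.cos φ : ℂ) +
          Real.sin φ * (p.derivative.eval (Real.cos φ : ℂ) * -Real.sin φ)) φ := by
      intro φ
      have h1 : HasDerivAt (fun φ : ℝ => (Real.sin φ : ℂ)) (Real.cos φ : ℂ) φ :=
        (Real.hasDerivAt_sin φ).ofReal_comp
      have h3 : HasDerivAt (fun φ : ℝ => p.eval (Real.cos φ : ℂ))
          (p.derivative.eval (Real.cos φ : ℂ) * -Real.sin φ) φ :=
        ((p.hasDerivAt (Real.cos φ : ℂ)).comp_ofReal.scomp φ (Real.hasDerivAt_cos φ)).congr_deriv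
          (by rw [Complex.real_smul]; push_cast; ring)
      exact h1.mul h3
    have hconst : ∀ φ ∈ Icc 0 Real.pi, conjInt (fun φ => v (Real.cos φ)) φ -
        (d (Real.cos φ) + Real.sin φ * p.eval (Real.cos φ : ℂ)) = 0 := by
      have hD : ∀ φ ∈ Icc 0 Real.pi, HasDerivAt (fun φ => conjInt (fun φ => v (Real.cos φ)) φ -
          (d (Real.cos φ) + Real.sin φ * p.eval (Real.cos φ : ℂ))) 0 φ := by
        intro φ hφ
        refine ((hder φ).sub ((hcd φ).add (hsp φ))).congr_deriv ?_
        rw [hp₀ φ hφ]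
        have hsin : 0 ≤ Real.sin φ := Real.sin_nonneg_of_mem_Icc hφ
        have hpow : (1 - Real.cos φ ^ 2) ^ r = Real.sin φ ^ (2 * m + 3) := by
          rw [← Real.sin_sq, ← Real.rpow_natCast, ← Real.rpow_natCast, ← Real.rpow_mul hsin, hr]
          congr 1; push_cast; ring
        have hev := congrArg (eval (Real.cos φ : ℂ)) hpc
        simp only [eval_neg, eval_add, eval_mul, eval_sub, eval_one, eval_pow, eval_X, eval_C]
          at hev
        have hsq : (1 - (Real.cos φ : ℂ) ^ 2) = (Real.sin φ : ℂ) ^ 2 := by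
          exact_mod_cast (Real.sin_sq φ).symm
        rw [hsq] at hev
        simp only [he, hpow]
        push_cast at hev ⊢
        linear_combination hev
      intro φ hφ
      have := constant_of_has_deriv_right_zero
        (fun x hx => (hD x hx).continuousAt.continuousWithinAt)
        (fun x hx => (hD x (Ico_subset_Icc_self hx)).hasDerivWithinAt) φ hφ
      rw [this]
      simp [conjInt_comp_cos_zero, hd1]
    refine ⟨d, p, ⟨fun _ => ⟨hd1, ?_⟩, e, fun x hx => (hd x hx).hasDerivWithinAt, hec⟩,
      fun φ hφ => sub_eq_zero.1 (hconst φ hφ)⟩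
    have := hconst Real.pi ⟨Real.pi_pos.le, le_rfl⟩
    rw [conjInt_comp_cos_pi] at this
    simpa using this

/-! ### Univalent functions and the kernel of the arc -/

/-- The derivative of a univalent function does not vanish. -/
lemma deriv_ne_zero_of_injOn {f : ℂ → ℂ} {U : Set ℂ} (hU : IsOpen U)
    (hf : DifferentiableOn ℂ f U) (hinj : InjOn f U) {z₀ : ℂ} (hz₀ : z₀ ∈ U) :
    deriv f z₀ ≠ 0 := by
  intro hder
  have hUn : U ∈ 𝓝 z₀ := hU.mem_nhds hz₀
  have han : AnalyticAt ℂ f z₀ := hf.analyticAt hUn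
  have han' : AnalyticAt ℂ (fun z => f z - f z₀) z₀ := han.sub analyticAt_const
  have hnz : ¬∀ᶠ z in 𝓝 z₀, f z - f z₀ = 0 := by
    intro h
    have h1 : ∀ᶠ z in 𝓝[≠] z₀, z = z₀ := by
      filter_upwards [(h.and hUn).filter_mono nhdsWithin_le_nhds] with z hz
      exact hinj hz.2 hz₀ (sub_eq_zero.1 hz.1)
    obtain ⟨z, hz, hz'⟩ := (h1.and self_mem_nhdsWithin).exists
    exact hz' hz
  obtain ⟨n, g, hg, hg0, hfg⟩ := han'.exists_eventuallyEq_pow_smul_nonzero_iff.2 hnz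
  have hn0 : n ≠ 0 := by
    rintro rfl
    have := hfg.self_of_nhds
    simp only [sub_self, pow_zero, one_smul] at this
    exact hg0 this.symm
  have hn1 : n ≠ 1 := by
    rintro rfl
    have h1 : HasDerivAt (fun z => (z - z₀) ^ 1 • g z) (g z₀) z₀ := by
      have h0 : HasDerivAt (fun z => (z - z₀) * g z) (g z₀) z₀ :=
        (((hasDerivAt_id z₀).sub_const z₀).mul hg.differentiableAt.hasDerivAt).congr_deriv
          (by simp)
      simpa using h0
    have h2 : HasDerivAt (fun z => f z - f z₀) (g z₀) z₀ := h1.congr_of_eventuallyEq hfg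
    have h3 := (han.differentiableAt.hasDerivAt.sub_const (f z₀)).unique h2
    exact hg0 (by rw [← h3, hder])
  set r : ℂ → ℂ := fun z => (g z / g z₀) ^ ((n : ℂ)⁻¹) with hr
  have hran : AnalyticAt ℂ r z₀ := by
    refine (hg.div_const).cpow analyticAt_const ?_
    rw [div_self hg0]; exact one_mem_slitPlane
  have hr0 : r z₀ = 1 := by simp only [hr, div_self hg0, one_cpow]
  set h : ℂ → ℂ := fun z => (z - z₀) * r z with hh
  have hhan : AnalyticAt ℂ h z₀ := (analyticAt_id.sub analyticAt_const).mul hran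
  have hhd : deriv h z₀ = 1 := by
    have : HasDerivAt h 1 z₀ :=
      (((hasDerivAt_id z₀).sub_const z₀).mul hran.differentiableAt.hasDerivAt).congr_deriv
        (by simp [hr0])
    exact this.deriv
  have hhs : HasStrictDerivAt h 1 z₀ := by
    rw [← hhd]; exact hhan.hasStrictDerivAt
  have hmap := hhs.map_nhds_eq one_ne_zero
  have hh0 : h z₀ = 0 := by simp [hh]
  rw [hh0] at hmap
  set V : Set ℂ := {z | z ∈ U ∧ f z - f z₀ = (z - z₀) ^ n • g z} with hV
  have hVn : V ∈ 𝓝 z₀ := Filter.inter_mem hUn hfg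
  have himg : h '' V ∈ 𝓝 (0:ℂ) := by
    rw [← hmap]; exact image_mem_map hVn
  have hfh : ∀ z ∈ V, f z = f z₀ + h z ^ n * g z₀ := by
    intro z hz
    have : h z ^ n = (z - z₀) ^ n * (g z / g z₀) := by
      simp only [hh, hr, mul_pow, cpow_nat_inv_pow _ hn0]
    rw [this]
    have h2 := hz.2
    rw [smul_eq_mul] at h2
    rw [← sub_eq_iff_eq_add', h2]
    field_simp
  set ζ : ℂ := Complex.exp (2 * Real.pi * I / n) with hζ
  have hprim : IsPrimitiveRoot ζ n := Complex.isPrimitiveRoot_exp n hn0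
  have hζ1 : ζ ≠ 1 := hprim.ne_one (by omega)
  have hlim : Tendsto (fun w => ζ * w) (𝓝 0) (𝓝 (0:ℂ)) := by
    have : Continuous fun w : ℂ => ζ * w := by fun_prop
    simpa using this.tendsto 0
  have hev : ∀ᶠ w in 𝓝[≠] (0:ℂ), w ∈ h '' V ∧ ζ * w ∈ h '' V := by
    refine Filter.Eventually.filter_mono nhdsWithin_le_nhds ?_
    exact (show ∀ᶠ w in 𝓝 (0:ℂ), w ∈ h '' V from himg).and (hlim himg)
  obtain ⟨w, ⟨⟨z₁, hz₁, e₁⟩, z₂, hz₂, e₂⟩, hw⟩ := (hev.and self_mem_nhdsWithin).exists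
  have : f z₁ = f z₂ := by
    rw [hfh _ hz₁, hfh _ hz₂, e₁, e₂, mul_pow, hprim.pow_eq_one, one_mul]
  have hz := hinj hz₁.1 hz₂.1 this
  rw [hz, e₂] at e₁
  exact hζ1 (mul_right_cancel₀ (b := w) hw (by rw [e₁, one_mul]))

namespace AnalyticArc

variable (A : AnalyticArc)

lemma deriv_ne_zero {z : ℂ} (hz : z ∈ A.U) : deriv A.Ξ z ≠ 0 :=
  deriv_ne_zero_of_injOn A.isOpen_U A.diff A.inj hz

lemma dslope_ne_zero {x t : ℂ} (hx : x ∈ A.U) (ht : t ∈ A.U) : dslope A.Ξ x t ≠ 0 := by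
  rcases eq_or_ne t x with rfl | h
  · rw [dslope_same]; exact A.deriv_ne_zero ht
  · rw [dslope_of_ne _ h, slope_def_field]
    exact div_ne_zero (sub_ne_zero.2 fun h' => h (A.inj ht hx h')) (sub_ne_zero.2 h)

lemma differentiableOn_dslope {x : ℂ} (hx : x ∈ A.U) : DifferentiableOn ℂ (dslope A.Ξ x) A.U :=
  (Complex.differentiableOn_dslope (A.isOpen_U.mem_nhds hx)).2 A.diff

/-- The regular part of the Cauchy kernel of the arc, pulled back by the parametrization. -/
def kern (x t : ℂ) : ℂ := dslope (dslope A.Ξ x) x t / dslope A.Ξ x t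

lemma kern_eq {x t : ℂ} (hx : x ∈ A.U) (ht : t ∈ A.U) (hne : x ≠ t) :
    A.kern x t = deriv A.Ξ x / (A.Ξ x - A.Ξ t) - 1 / (x - t) := by
  have h1 : A.Ξ x - A.Ξ t ≠ 0 := sub_ne_zero.2 fun h => hne (A.inj hx ht h)
  have h2 : x - t ≠ 0 := sub_ne_zero.2 hne
  have h2' : t - x ≠ 0 := sub_ne_zero.2 hne.symm
  have h1' : A.Ξ t - A.Ξ x ≠ 0 := fun h => h1 (by rw [← neg_sub, h, neg_zero])
  rw [kern, dslope_of_ne _ hne.symm, slope_def_field, dslope_same, dslope_of_ne _ hne.symm,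
    slope_def_field]
  field_simp
  ring

lemma differentiableOn_kern {x : ℂ} (hx : x ∈ A.U) : DifferentiableOn ℂ (A.kern x) A.U :=
  ((Complex.differentiableOn_dslope (A.isOpen_U.mem_nhds hx)).2 (A.differentiableOn_dslope hx)).div
    (A.differentiableOn_dslope hx) fun _ ht => A.dslope_ne_zero hx ht

lemma isCompact_realSeg : IsCompact realSeg :=
  isCompact_Icc.image Complex.continuous_ofReal

lemma convex_realSeg : Convex ℝ realSeg :=
  (convex_Icc (-1:ℝ) 1).is_linear_image Complex.ofRealCLM.isLinear

lemma ofReal_mem_realSeg {x : ℝ} (hx : x ∈ Icc (-1:ℝ) 1) : (x : ℂ) ∈ realSeg := ⟨x, hx, rfl⟩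

/-- A convex neighborhood of the segment on which the kernel of the arc is bounded and the
parametrization is bi-Lipschitz with respect to the segment. -/
lemma exists_nhd : ∃ (N : Set ℂ) (B : ℝ), IsOpen N ∧ Convex ℝ N ∧ realSeg ⊆ N ∧ N ⊆ A.U ∧ 0 ≤ B ∧
    ∀ x ∈ realSeg, ∀ t ∈ N, ‖A.kern x t‖ ≤ B ∧ ‖x - t‖ ≤ B * ‖A.Ξ x - A.Ξ t‖ ∧
      ‖A.Ξ x - A.Ξ t‖ ≤ B * ‖x - t‖ := by
  obtain ⟨r, hr, hrU⟩ := isCompact_realSeg.exists_cthickening_subset_open A.isOpen_U A.seg_sub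
  have hcl : closure (thickening r realSeg) ⊆ cthickening r realSeg :=
    closure_thickening_subset_cthickening _ _
  have hbd : Bornology.IsBounded (thickening r realSeg) := isCompact_realSeg.isBounded.thickening
  have hFc : IsCompact (frontier (thickening r realSeg)) :=
    hbd.isCompact_closure.of_isClosed_subset isClosed_frontier frontier_subset_closure
  have hFU : frontier (thickening r realSeg) ⊆ A.U :=
    (frontier_subset_closure.trans hcl).trans hrU
  have hFr : ∀ x ∈ realSeg, ∀ t ∈ frontier (thickening r realSeg), x ≠ t := by
    rintro x hx t ht rfl
    have h1 : x ∈ thickening r realSeg := self_subset_thickening hr _ hx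
    rw [isOpen_thickening.frontier_eq] at ht
    exact ht.2 h1
  have hbound : ∀ f : ℂ × ℂ → ℂ,
      ContinuousOn f (realSeg ×ˢ frontier (thickening r realSeg)) →
      ∃ B, 0 ≤ B ∧ ∀ x ∈ realSeg, ∀ t ∈ frontier (thickening r realSeg), ‖f (x, t)‖ ≤ B := by
    intro f hf
    obtain ⟨B, hB⟩ := (isCompact_realSeg.prod hFc).exists_bound_of_continuousOn hf
    exact ⟨max B 0, le_max_right _ _, fun x hx t ht => (hB (x, t) ⟨hx, ht⟩).trans (le_max_left _ _)⟩
  have hc1 : ContinuousOn (fun p : ℂ × ℂ => A.Ξ p.1)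
      (realSeg ×ˢ frontier (thickening r realSeg)) :=
    A.diff.continuousOn.comp continuousOn_fst fun p hp => A.seg_sub hp.1
  have hc2 : ContinuousOn (fun p : ℂ × ℂ => A.Ξ p.2)
      (realSeg ×ˢ frontier (thickening r realSeg)) :=
    A.diff.continuousOn.comp continuousOn_snd fun p hp => hFU hp.2
  have hc3 : ContinuousOn (fun p : ℂ × ℂ => deriv A.Ξ p.1)
      (realSeg ×ˢ frontier (thickening r realSeg)) :=
    (A.diff.deriv A.isOpen_U).continuousOn.comp continuousOn_fst fun p hp => A.seg_sub hp.1
  have hne1 : ∀ p ∈ realSeg ×ˢ frontier (thickening r realSeg), A.Ξ p.1 - A.Ξ p.2 ≠ 0 :=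
    fun p hp => sub_ne_zero.2 fun h => hFr _ hp.1 _ hp.2 (A.inj (A.seg_sub hp.1) (hFU hp.2) h)
  have hne2 : ∀ p ∈ realSeg ×ˢ frontier (thickening r realSeg), p.1 - p.2 ≠ 0 :=
    fun p hp => sub_ne_zero.2 (hFr _ hp.1 _ hp.2)
  have hc4 : ContinuousOn (fun p : ℂ × ℂ => p.1 - p.2)
      (realSeg ×ˢ frontier (thickening r realSeg)) := by fun_prop
  obtain ⟨B₁, hB₁, h₁⟩ := hbound (fun p => deriv A.Ξ p.1 / (A.Ξ p.1 - A.Ξ p.2) - 1 / (p.1 - p.2))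
    ((hc3.div (hc1.sub hc2) hne1).sub (continuousOn_const.div hc4 hne2))
  obtain ⟨B₂, hB₂, h₂⟩ := hbound (fun p => (p.1 - p.2) / (A.Ξ p.1 - A.Ξ p.2))
    (hc4.div (hc1.sub hc2) hne1)
  obtain ⟨B₃, hB₃, h₃⟩ := hbound (fun p => (A.Ξ p.1 - A.Ξ p.2) / (p.1 - p.2))
    ((hc1.sub hc2).div hc4 hne2)
  have hdc : ∀ f : ℂ → ℂ, DifferentiableOn ℂ f A.U → DiffContOnCl ℂ f (thickening r realSeg) :=
    fun f hf => (hf.mono (hcl.trans hrU)).diffContOnCl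
  have hslope : ∀ x t, x ≠ t → dslope A.Ξ x t = (A.Ξ x - A.Ξ t) / (x - t) := by
    intro x t h
    rw [dslope_of_ne _ h.symm, slope_def_field, ← neg_sub, ← neg_sub x t, neg_div_neg_eq]
  refine ⟨thickening r realSeg, B₁ + B₂ + B₃, isOpen_thickening, convex_realSeg.thickening r,
    self_subset_thickening hr _, (subset_closure.trans hcl).trans hrU, by positivity,
    fun x hx t ht => ?_⟩
  have hxU := A.seg_sub hx
  have htU := ((subset_closure.trans hcl).trans hrU) ht
  refine ⟨?_, ?_, ?_⟩
  · refine le_trans (Complex.norm_le_of_forall_mem_frontier_norm_le hbd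
      (hdc _ (A.differentiableOn_kern hxU)) (C := B₁) (fun t ht => ?_) (subset_closure ht))
      (by linarith)
    rw [A.kern_eq hxU (hFU ht) (hFr x hx t ht)]
    exact h₁ x hx t ht
  · have := Complex.norm_le_of_forall_mem_frontier_norm_le hbd
      (hdc (fun t => (dslope A.Ξ x t)⁻¹) ((A.differentiableOn_dslope hxU).inv
        fun t ht => A.dslope_ne_zero hxU ht)) (C := B₂) (fun t ht => by
        rw [hslope _ _ (hFr x hx t ht), inv_div]; exact h₂ x hx t ht) (subset_closure ht)
    rcases eq_or_ne x t with rfl | hne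
    · simp
    · rw [hslope _ _ hne, inv_div, norm_div, div_le_iff₀ (norm_pos_iff.2 (sub_ne_zero.2
        fun h => hne (A.inj hxU htU h)))] at this
      exact this.trans (mul_le_mul_of_nonneg_right (by linarith) (norm_nonneg _))
  · have := Complex.norm_le_of_forall_mem_frontier_norm_le hbd
      (hdc _ (A.differentiableOn_dslope hxU)) (C := B₃) (fun t ht => by
        rw [hslope _ _ (hFr x hx t ht)]; exact h₃ x hx t ht) (subset_closure ht)
    rcases eq_or_ne x t with rfl | hne
    · simp
    · rw [hslope _ _ hne, norm_div, div_le_iff₀ (norm_pos_iff.2 (sub_ne_zero.2 hne))] at this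
      exact this.trans (mul_le_mul_of_nonneg_right (by linarith) (norm_nonneg _))

end AnalyticArc

/-! ### The square root on the arc -/

namespace AnalyticArc

variable (A : AnalyticArc)

lemma differentiableOn_of_sq_eq {N : Set ℂ} (hN : IsOpen N) {q g : ℂ → ℂ} (hq : ContinuousOn q N)
    (hg : DifferentiableOn ℂ g N) (hqg : ∀ z ∈ N, q z ^ 2 = g z) (hq0 : ∀ z ∈ N, q z ≠ 0) :
    DifferentiableOn ℂ q N := by
  intro z hz
  have hgd := (hg.differentiableAt (hN.mem_nhds hz)).hasDerivAt
  have hqc := hq.continuousAt (hN.mem_nhds hz)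
  have h0 : q z + q z ≠ 0 := by
    rw [← two_mul]; exact mul_ne_zero two_ne_zero (hq0 z hz)
  refine (HasDerivAt.differentiableAt (f' := deriv g z / (q z + q z)) ?_).differentiableWithinAt
  rw [hasDerivAt_iff_tendsto_slope] at hgd ⊢
  have hsum : Tendsto (fun w => q w + q z) (𝓝[≠] z) (𝓝 (q z + q z)) :=
    (hqc.tendsto.mono_left nhdsWithin_le_nhds).add_const _
  refine (hgd.div hsum h0).congr' ?_
  filter_upwards [hsum.eventually_ne h0, nhdsWithin_le_nhds (hN.mem_nhds hz),
    self_mem_nhdsWithin] with w hw hwN hwz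
  have hwz' : w - z ≠ 0 := sub_ne_zero.2 hwz
  simp only [Pi.div_apply, slope_def_field, ← hqg w hwN, ← hqg z hz]
  field_simp
  ring

/-- A holomorphic square root of `(Ξ² - 1)/(z² - 1)`. -/
lemma exists_sqrt {N : Set ℂ} (hN : IsOpen N) (hNc : Convex ℝ N) (hsN : realSeg ⊆ N)
    (hNU : N ⊆ A.U) : ∃ q : ℂ → ℂ, DifferentiableOn ℂ q N ∧ (∀ z ∈ N, q z ≠ 0) ∧
      ∀ z ∈ N, A.Ξ z ^ 2 - 1 = (z ^ 2 - 1) * q z ^ 2 := by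
  have h1 : (1:ℂ) ∈ A.U := A.seg_sub (by simpa using ofReal_mem_realSeg one_mem_segI)
  have h2 : (-1:ℂ) ∈ A.U := A.seg_sub (by simpa using ofReal_mem_realSeg neg_one_mem_segI)
  set g : ℂ → ℂ := fun z => dslope A.Ξ 1 z * dslope A.Ξ (-1) z with hg
  have hgd : DifferentiableOn ℂ g N :=
    ((A.differentiableOn_dslope h1).mul (A.differentiableOn_dslope h2)).mono hNU
  have hg0 : ∀ z ∈ N, g z ≠ 0 := fun z hz =>
    mul_ne_zero (A.dslope_ne_zero h1 (hNU hz)) (A.dslope_ne_zero h2 (hNU hz))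
  have hne : N.Nonempty := ⟨_, hsN (ofReal_mem_realSeg one_mem_segI)⟩
  have hsc : IsSimplyConnected N := by
    have := hNc.contractibleSpace hne
    exact (inferInstance : SimplyConnectedSpace N)
  obtain ⟨q, hqc, hq⟩ := exists_continuousOn_pow_eq hsc hN hgd.continuousOn
    (by rintro ⟨z, hz, h⟩; exact hg0 z hz h) two_ne_zero
  have hq0 : ∀ z ∈ N, q z ≠ 0 := by
    intro z hz h
    have := hq z
    rw [h] at this
    exact hg0 z hz (by rw [← this]; simp)
  refine ⟨q, differentiableOn_of_sq_eq hN hqc hgd (fun z _ => hq z) hq0, hq0, fun z hz => ?_⟩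
  have e1 := sub_smul_dslope A.Ξ 1 z
  have e2 := sub_smul_dslope A.Ξ (-1) z
  rw [A.map_one, smul_eq_mul] at e1
  rw [A.map_neg_one, smul_eq_mul] at e2
  rw [hq z]
  simp only [hg]
  linear_combination -(z + 1) * dslope A.Ξ (-1) z * e1 - (A.Ξ z - 1) * e2

/-- The boundary values of the square root, in terms of the parametrization. -/
lemma exists_srp_eq (S : SqrtBranch A) {srp : ℂ → ℂ} (hsrp : BVplus A.Ξ S.sr srp) {N : Set ℂ}
    (hN : IsOpen N) (hNc : Convex ℝ N) (hsN : realSeg ⊆ N) (hNU : N ⊆ A.U) {q : ℂ → ℂ}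
    (hqd : DifferentiableOn ℂ q N) (hq0 : ∀ z ∈ N, q z ≠ 0)
    (hq : ∀ z ∈ N, A.Ξ z ^ 2 - 1 = (z ^ 2 - 1) * q z ^ 2) :
    ∃ σ : ℂ, σ ^ 2 = -1 ∧ ∀ x ∈ Ioo (-1:ℝ) 1,
      srp (A.Ξ x) = σ * q x * (Real.sqrt (1 - x ^ 2) : ℂ) := by
  set P : Set ℂ := N ∩ {z | 0 < z.im} with hP
  have hPc : IsPreconnected P := (hNc.inter (convex_halfSpace_im_gt 0)).isPreconnected
  have hslit : ∀ z : ℂ, (0 < z.im ∨ ∃ x ∈ Ioo (-1:ℝ) 1, z = x) → 1 - z ^ 2 ∈ slitPlane := by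
    rintro z (hz | ⟨x, hx, rfl⟩)
    · rw [mem_slitPlane_iff]
      by_cases hre : z.re = 0
      · left
        simp only [sub_re, one_re, sq, mul_re, hre]
        nlinarith
      · right
        simp only [sub_im, one_im, sq, mul_im]
        intro h
        have : z.re * z.im = 0 := by linarith
        rcases mul_eq_zero.1 this with h | h
        · exact hre h
        · exact hz.ne' h
    · rw [mem_slitPlane_iff]
      left
      rw [← Complex.ofReal_pow, ← Complex.ofReal_one, ← Complex.ofReal_sub, Complex.ofReal_re]
      nlinarith [hx.1, hx.2]
  set w : ℂ → ℂ := fun z => (1 - z ^ 2) ^ ((2:ℕ) : ℂ)⁻¹ with hw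
  have hwsq : ∀ z, w z ^ 2 = 1 - z ^ 2 := fun z => cpow_nat_inv_pow _ two_ne_zero
  have hwc : ∀ z : ℂ, (0 < z.im ∨ ∃ x ∈ Ioo (-1:ℝ) 1, z = x) → ContinuousAt w z := fun z hz =>
    ContinuousAt.cpow (by fun_prop) continuousAt_const (hslit z hz)
  have hw0 : ∀ z : ℂ, (0 < z.im ∨ ∃ x ∈ Ioo (-1:ℝ) 1, z = x) → w z ≠ 0 := fun z hz h =>
    slitPlane_ne_zero (hslit z hz) (by rw [← hwsq, h]; simp)
  have hmap : ∀ z ∈ P, A.Ξ z ∈ A.arcᶜ := by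
    rintro z hz ⟨t, ⟨x, hx, rfl⟩, h⟩
    have := A.inj (hsN (ofReal_mem_realSeg hx) |> fun h => hNU h) (hNU hz.1) h
    have him : 0 < z.im := hz.2
    rw [← this, Complex.ofReal_im] at him
    exact lt_irrefl _ him
  have hc1 : ContinuousOn (fun z => S.sr (A.Ξ z)) P :=
    S.diff.continuousOn.comp (A.diff.continuousOn.mono (inter_subset_left.trans hNU)) hmap
  have hc2 : ContinuousOn (fun z => I * w z * q z) P := by
    refine ContinuousOn.mul (continuousOn_const.mul fun z hz => ?_)
      (hqd.continuousOn.mono inter_subset_left)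
    exact (hwc z (Or.inl hz.2)).continuousWithinAt
  have hsq : EqOn ((fun z => S.sr (A.Ξ z)) ^ 2) ((fun z => I * w z * q z) ^ 2) P := by
    intro z hz
    simp only [Pi.pow_apply]
    rw [S.sq _ (hmap z hz), hq z hz.1, mul_pow, mul_pow, hwsq, I_sq]
    ring
  have hne : ∀ {z}, z ∈ P → I * w z * q z ≠ 0 := fun {z} hz =>
    mul_ne_zero (mul_ne_zero I_ne_zero (hw0 z (Or.inl hz.2))) (hq0 z hz.1)
  obtain ⟨σ, hσ, hs⟩ : ∃ σ : ℂ, σ ^ 2 = -1 ∧ ∀ z ∈ P, S.sr (A.Ξ z) = σ * q z * w z := by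
    rcases hPc.eq_or_eq_neg_of_sq_eq hc1 hc2 hsq hne with h | h
    · exact ⟨I, I_sq, fun z hz => by
        have e : S.sr (A.Ξ z) = I * w z * q z := h hz
        rw [e]; ring⟩
    · exact ⟨-I, by rw [neg_sq, I_sq], fun z hz => by
        have e : S.sr (A.Ξ z) = -(I * w z * q z) := h hz
        rw [e]; ring⟩
  refine ⟨σ, hσ, fun x hx => ?_⟩
  have hxN : (x:ℂ) ∈ N := hsN (ofReal_mem_realSeg (Ioo_subset_Icc_self hx))
  have hline : Tendsto (fun y : ℝ => (x + y * I : ℂ)) (𝓝[>] 0) (𝓝 (x:ℂ)) := by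
    have : Continuous fun y : ℝ => (x + y * I : ℂ) := by fun_prop
    have := this.tendsto 0
    simp only [ofReal_zero, zero_mul, add_zero] at this
    exact this.mono_left nhdsWithin_le_nhds
  have hlim : Tendsto (fun y : ℝ => S.sr (A.Ξ (x + y * I))) (𝓝[>] 0) (𝓝 (σ * q x * w x)) := by
    have hcont : ContinuousAt (fun z => σ * q z * w z) (x:ℂ) :=
      (continuousAt_const.mul (hqd.continuousOn.continuousAt (hN.mem_nhds hxN))).mul
        (hwc _ (Or.inr ⟨x, hx, rfl⟩))
    refine (hcont.tendsto.comp hline).congr' ?_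
    filter_upwards [hline.eventually (hN.mem_nhds hxN), self_mem_nhdsWithin] with y hy hy0
    exact (hs _ ⟨hy, by simpa using hy0⟩).symm
  rw [tendsto_nhds_unique (hsrp x hx) hlim]
  congr 1
  have hnn : 0 ≤ 1 - x ^ 2 := by nlinarith [hx.1, hx.2]
  simp only [hw]
  rw [Real.sqrt_eq_rpow, Complex.ofReal_cpow hnn]
  push_cast
  norm_num

end AnalyticArc

/-! ### Holomorphic dependence of integrals on a parameter -/

lemma differentiableOn_integral_of_bound {α : Type*} [MeasurableSpace α] {μ : Measure α} {O : Set ℂ}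
    (hO : IsOpen O) {K : ℂ → α → ℂ} {b : α → ℝ} (hd : ∀ x, DifferentiableOn ℂ (fun t => K t x) O)
    (hm : ∀ t ∈ O, AEStronglyMeasurable (K t) μ) (hb : ∀ t ∈ O, ∀ x, ‖K t x‖ ≤ b x)
    (hbi : Integrable b μ) : DifferentiableOn ℂ (fun t => ∫ x, K t x ∂μ) O := by
  intro t₀ ht₀
  obtain ⟨R, hR, hRO⟩ := Metric.isOpen_iff.1 hO t₀ ht₀
  have hr : 0 < R / 4 := by positivity
  have hsub : ∀ t ∈ ball t₀ (R / 4), closedBall t (R / 4) ⊆ O := by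
    intro t ht
    refine Subset.trans (fun z hz => ?_) hRO
    rw [mem_ball] at ht ⊢
    rw [mem_closedBall] at hz
    linarith [dist_triangle z t t₀]
  have hDA : ∀ t ∈ O, ∀ x, HasDerivAt (fun t => K t x) (deriv (fun t => K t x) t) t :=
    fun t ht x => ((hd x).differentiableAt (hO.mem_nhds ht)).hasDerivAt
  have hder : ∀ x, ∀ t ∈ ball t₀ (R / 4), ‖deriv (fun t => K t x) t‖ ≤ b x / (R / 4) := by
    intro x t ht
    refine Complex.norm_deriv_le_of_forall_mem_sphere_norm_le hr ?_ fun z hz =>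
      hb z (hsub t ht (sphere_subset_closedBall hz)) x
    exact ((hd x).mono (closure_ball_subset_closedBall.trans (hsub t ht))).diffContOnCl
  have hmeas : AEStronglyMeasurable (fun x => deriv (fun t => K t x) t₀) μ := by
    have hseq : Tendsto (fun n : ℕ => t₀ + ((1 / ((n : ℝ) + 1) : ℝ) : ℂ)) atTop (𝓝[≠] t₀) := by
      rw [tendsto_nhdsWithin_iff]
      constructor
      · have h1 : Tendsto (fun n : ℕ => ((1 / ((n : ℝ) + 1) : ℝ) : ℂ)) atTop (𝓝 ((0:ℝ):ℂ)) :=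
          (Complex.continuous_ofReal.tendsto 0).comp tendsto_one_div_add_atTop_nhds_zero_nat
        simpa using h1.const_add t₀
      · refine Eventually.of_forall fun n => ?_
        have : (0:ℝ) < 1 / ((n : ℝ) + 1) := by positivity
        simpa using (by exact_mod_cast this.ne' : ((1 / ((n : ℝ) + 1) : ℝ) : ℂ) ≠ 0)
    have hev : ∀ᶠ n : ℕ in atTop, t₀ + ((1 / ((n : ℝ) + 1) : ℝ) : ℂ) ∈ O :=
      (hseq.mono_right nhdsWithin_le_nhds).eventually (hO.mem_nhds ht₀)
    obtain ⟨M, hM⟩ := eventually_atTop.1 hev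
    refine aestronglyMeasurable_of_tendsto_ae (u := atTop)
      (f := fun (n : ℕ) x => slope (fun t => K t x) t₀ (t₀ + ((1 / (((n + M : ℕ) : ℝ) + 1) : ℝ) : ℂ)))
      (fun n => ?_) (ae_of_all _ fun x => ?_)
    · simp only [slope_def_field, div_eq_mul_inv _ (_ - _)]
      exact ((hm _ (hM _ (Nat.le_add_left M n))).sub (hm _ ht₀)).mul_const _
    · exact (hasDerivAt_iff_tendsto_slope.1 (hDA t₀ ht₀ x)).comp
        (hseq.comp (tendsto_add_atTop_nat M))
  have hint : Integrable (K t₀) μ := hbi.mono' (hm t₀ ht₀) (ae_of_all _ (hb t₀ ht₀))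
  have hball : ball t₀ (R / 4) ⊆ O := fun z hz => hsub z hz (mem_closedBall_self hr.le)
  have := hasDerivAt_integral_of_dominated_loc_of_deriv_le (μ := μ) (F := K)
    (F' := fun t x => deriv (fun t => K t x) t) (bound := fun x => b x / (R / 4))
    (ball_mem_nhds t₀ hr) (Filter.mem_of_superset (hO.mem_nhds ht₀) hm) hint hmeas
    (ae_of_all _ hder) (hbi.div_const _)
    (ae_of_all _ fun x t ht => hDA t (hball ht) x)
  exact this.2.differentiableAt.differentiableWithinAt

/-! ### Truncated cotangent integrals -/

lemma measurable_ite_le {ρ : ℝ → ℝ} (hρ : Continuous ρ) (ε : ℝ) :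
    Measurable fun x => if ε ≤ ρ x then (1:ℝ) else 0 :=
  Measurable.ite (measurableSet_le measurable_const hρ.measurable) measurable_const measurable_const

lemma integrable_ite_mul_cotH {ρ : ℝ → ℝ} (hρ : Continuous ρ) {L : ℝ} (hL : 0 < L)
    (hρL : ∀ x, ρ x ≤ L * |x|) {ε : ℝ} (hε : 0 < ε) :
    Integrable (fun x => (if ε ≤ ρ x then (1:ℝ) else 0) * cotH x)
      (volume.restrict (Ioc (-Real.pi) Real.pi)) := by
  refine Integrable.mono' (integrable_const (10 * L / ε))
    ((measurable_ite_le hρ ε).mul measurable_cotH).aestronglyMeasurable ?_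
  filter_upwards [ae_restrict_mem measurableSet_Ioc] with x hx
  have h0 : 0 ≤ 10 * L / ε := by positivity
  split_ifs with h
  · have h1 := h.trans (hρL x)
    have hx0 : 0 < |x| := by
      by_contra! h'
      nlinarith
    have hxp : |x| ≤ 3 * Real.pi / 2 := by
      rw [abs_le]; constructor <;> linarith [hx.1, hx.2, Real.pi_pos]
    rw [one_mul, Real.norm_eq_abs]
    refine (abs_cotH_le hxp).trans ?_
    rw [div_le_div_iff₀ hx0 hε]
    linarith
  · simpa using h0

/-- Truncated integrals of the cotangent kernel vanish in the limit, as soon as the truncation is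
asymptotically symmetric. -/
lemma tendsto_integral_ite_cotH {ρ : ℝ → ℝ} (hρ : Continuous ρ) {L : ℝ} (hL : 0 < L)
    (hρL : ∀ x, ρ x ≤ L * |x|) (hρ0 : ∀ᵐ x, 0 < ρ x) {a : ℝ} (ha : 0 < a)
    (hρa : Tendsto (fun x => ρ x / |x|) (𝓝[≠] 0) (𝓝 a)) :
    Tendsto (fun ε : ℝ => ∫ x in Ioc (-Real.pi) Real.pi, (if ε ≤ ρ x then (1:ℝ) else 0) * cotH x)
      (𝓝[>] 0) (𝓝 0) := by
  set μ := volume.restrict (Ioc (-Real.pi) Real.pi) with hμ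
  set D : ℝ → ℝ → ℝ := fun ε x =>
    (if ε ≤ ρ x then (1:ℝ) else 0) - (if ε ≤ a * |x| then (1:ℝ) else 0) with hD
  have hac : Continuous fun x : ℝ => a * |x| := by fun_prop
  have hDm : ∀ ε, Measurable (D ε) := fun ε =>
    (measurable_ite_le hρ ε).sub (measurable_ite_le hac ε)
  have hD1 : ∀ ε x, |D ε x| ≤ 1 := by
    intro ε x
    simp only [hD]
    split_ifs <;> norm_num
  have hDint : Tendsto (fun ε => ∫ x, |D ε x| ∂μ) (𝓝[>] 0) (𝓝 0) := by
    have := tendsto_integral_filter_of_dominated_convergence (μ := μ) (l := 𝓝[>] (0:ℝ))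
      (F := fun ε x => |D ε x|) (f := fun _ => 0) (fun _ => 1)
      (Eventually.of_forall fun ε => (hDm ε).norm.aestronglyMeasurable)
      (Eventually.of_forall fun ε => ae_of_all _ fun x => by simpa using hD1 ε x)
      (integrable_const _) ?_
    · simpa using this
    · have h0 : ∀ᵐ x : ℝ, x ≠ 0 := by simp [ae_iff, measure_singleton]
      filter_upwards [ae_restrict_of_ae hρ0, ae_restrict_of_ae h0] with x hx hx0
      have hx1 : 0 < a * |x| := mul_pos ha (abs_pos.2 hx0)
      refine tendsto_const_nhds.congr' ?_
      filter_upwards [nhdsWithin_le_nhds (eventually_lt_nhds hx),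
        nhdsWithin_le_nhds (eventually_lt_nhds hx1)] with ε h1 h2
      simp [hD, h1.le, h2.le]
  have hodd : ∀ ε, ∫ x, (if ε ≤ a * |x| then (1:ℝ) else 0) * cotH x ∂μ = 0 := by
    intro ε
    rw [hμ, ← intervalIntegral.integral_of_le (by linarith [Real.pi_pos])]
    have h := intervalIntegral.integral_comp_neg (a := -Real.pi) (b := Real.pi)
      (fun x => (if ε ≤ a * |x| then (1:ℝ) else 0) * cotH x)
    simp only [abs_neg, cotH_neg, mul_neg, intervalIntegral.integral_neg, neg_neg] at h
    linarith
  have hsplit : ∀ ε, 0 < ε → ∫ x, (if ε ≤ ρ x then (1:ℝ) else 0) * cotH x ∂μ =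
      ∫ x, D ε x * cotH x ∂μ := by
    intro ε hε
    have h1 := integral_sub (integrable_ite_mul_cotH hρ hL hρL hε)
      (integrable_ite_mul_cotH hac ha (fun x => le_rfl) hε)
    rw [← hμ, hodd, sub_zero] at h1
    rw [← h1]
    exact integral_congr_ae (ae_of_all _ fun x => by simp only [hD]; ring)
  rw [Metric.tendsto_nhdsWithin_nhds]
  intro η hη
  obtain ⟨δ, hδ0, hδ1, hδη⟩ : ∃ δ : ℝ, 0 < δ ∧ δ ≤ 1 / 2 ∧ 80 * δ < η / 2 := by
    refine ⟨min (1 / 2) (η / 200), by positivity, min_le_left _ _, ?_⟩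
    linarith [min_le_right (1 / 2) (η / 200)]
  obtain ⟨r, hr, hrρ⟩ := Metric.tendsto_nhdsWithin_nhds.1 hρa (δ * a) (by positivity)
  have hkey : ∀ ε, 0 < ε → ∀ x ∈ Ioc (-Real.pi) Real.pi, ‖D ε x * cotH x‖ ≤
      (Icc (ε / (a * (1 + δ))) (ε / (a * (1 - δ)))).indicator
          (fun _ => 10 / (ε / (a * (1 + δ)))) x +
        (Icc (-(ε / (a * (1 - δ)))) (-(ε / (a * (1 + δ))))).indicator
          (fun _ => 10 / (ε / (a * (1 + δ)))) x + |D ε x| * (10 / r) := by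
    intro ε hε x hx
    have hδ' : 0 < 1 - δ := by linarith
    have hn : (0:ℝ) ≤ 10 / (ε / (a * (1 + δ))) := by positivity
    have hi1 := indicator_nonneg (s := Icc (ε / (a * (1 + δ))) (ε / (a * (1 - δ))))
      (f := fun _ : ℝ => 10 / (ε / (a * (1 + δ)))) (fun _ _ => hn) x
    have hi2 := indicator_nonneg (s := Icc (-(ε / (a * (1 - δ)))) (-(ε / (a * (1 + δ)))))
      (f := fun _ : ℝ => 10 / (ε / (a * (1 + δ)))) (fun _ _ => hn) x
    have hxp : |x| ≤ 3 * Real.pi / 2 := by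
      rw [abs_le]; constructor <;> linarith [hx.1, hx.2, Real.pi_pos]
    have hcot := abs_cotH_le hxp
    rw [norm_mul, Real.norm_eq_abs, Real.norm_eq_abs]
    by_cases hD0 : D ε x = 0
    · rw [hD0, abs_zero, zero_mul, zero_mul, add_zero]
      exact add_nonneg hi1 hi2
    by_cases hxr : r ≤ |x|
    · have : |D ε x| * |cotH x| ≤ |D ε x| * (10 / r) :=
        mul_le_mul_of_nonneg_left (hcot.trans (by gcongr)) (abs_nonneg _)
      linarith
    have hx0 : x ≠ 0 := by
      rintro rfl
      apply hD0
      have h1 : ¬ ε ≤ ρ 0 := by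
        have := hρL 0
        rw [abs_zero, mul_zero] at this
        linarith
      have h2 : ¬ ε ≤ a * |(0:ℝ)| := by simpa using hε
      simp only [hD, if_neg h1, if_neg h2, sub_self]
    have hxpos : 0 < |x| := abs_pos.2 hx0
    have h1 : dist (ρ x / |x|) a < δ * a := hrρ hx0 (by simpa using hxr)
    rw [Real.dist_eq, abs_lt, lt_sub_iff_add_lt, sub_lt_iff_lt_add, lt_div_iff₀ hxpos,
      div_lt_iff₀ hxpos] at h1
    have hmem : ε / (a * (1 + δ)) ≤ |x| ∧ |x| ≤ ε / (a * (1 - δ)) := by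
      rw [div_le_iff₀ (by positivity), le_div_iff₀ (by positivity)]
      have hax : 0 < |x| * a * δ := by positivity
      by_cases c1 : ε ≤ ρ x <;> by_cases c2 : ε ≤ a * |x|
      · exact absurd (by simp [hD, c1, c2]) hD0
      · push Not at c2
        constructor <;> nlinarith
      · push Not at c1
        constructor <;> nlinarith
      · exact absurd (by simp [hD, c1, c2]) hD0
    have hle : |D ε x| * |cotH x| ≤ 10 / (ε / (a * (1 + δ))) := by
      have : |cotH x| ≤ 10 / (ε / (a * (1 + δ))) :=
        hcot.trans (div_le_div_of_nonneg_left (by norm_num) (by positivity) hmem.1)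
      calc _ ≤ 1 * |cotH x| := by gcongr; exact hD1 ε x
        _ ≤ _ := by rwa [one_mul]
    have hlast : 0 ≤ |D ε x| * (10 / r) := by positivity
    rcases le_total 0 x with hx' | hx'
    · rw [abs_of_nonneg hx'] at hmem
      rw [indicator_of_mem (show x ∈ Icc _ _ from hmem)]
      linarith
    · rw [abs_of_nonpos hx'] at hmem
      rw [indicator_of_mem (show x ∈ Icc (-(ε / (a * (1 - δ)))) (-(ε / (a * (1 + δ)))) from
        ⟨by linarith [hmem.2], by linarith [hmem.1]⟩)]
      linarith
  have hbound : ∀ ε, 0 < ε → ‖∫ x, D ε x * cotH x ∂μ‖ ≤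
      80 * δ + (∫ x, |D ε x| ∂μ) * (10 / r) := by
    intro ε hε
    have hδ' : 0 < 1 - δ := by linarith
    have hiD : Integrable (fun x => |D ε x| * (10 / r)) μ :=
      (Integrable.mono' (integrable_const 1) (hDm ε).norm.aestronglyMeasurable
        (ae_of_all _ fun x => by simpa using hD1 ε x)).mul_const _
    have hii : ∀ c d : ℝ, Integrable
        ((Icc c d).indicator (fun _ => 10 / (ε / (a * (1 + δ))))) μ := fun c d =>
      (integrable_const _).indicator measurableSet_Icc
    have hvol : ∀ c d : ℝ, c ≤ d → ∫ x, (Icc c d).indicator (fun _ => 10 / (ε / (a * (1 + δ)))) x ∂μ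
        ≤ (d - c) * (10 / (ε / (a * (1 + δ)))) := by
      intro c d hcd
      rw [integral_indicator measurableSet_Icc, setIntegral_const, smul_eq_mul]
      gcongr
      have h1 : μ.real (Icc c d) ≤ volume.real (Icc c d) := by
        refine ENNReal.toReal_mono (by simp) ?_
        exact Measure.restrict_apply_le _ _
      rwa [Real.volume_real_Icc_of_le hcd] at h1
    have hRR : ε / (a * (1 + δ)) ≤ ε / (a * (1 - δ)) := by gcongr; linarith
    have hfin : (ε / (a * (1 - δ)) - ε / (a * (1 + δ))) * (10 / (ε / (a * (1 + δ)))) ≤ 40 * δ := by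
      have : (ε / (a * (1 - δ)) - ε / (a * (1 + δ))) * (10 / (ε / (a * (1 + δ)))) =
          20 * δ / (1 - δ) := by
        field_simp; ring
      rw [this, div_le_iff₀ hδ']
      nlinarith
    refine (norm_integral_le_of_norm_le (((hii (ε / (a * (1 + δ))) (ε / (a * (1 - δ)))).add
      (hii (-(ε / (a * (1 - δ)))) (-(ε / (a * (1 + δ)))))).add hiD) ?_).trans ?_
    · filter_upwards [ae_restrict_mem measurableSet_Ioc] with x hx
      exact hkey ε hε x hx
    · have e1 := integral_add ((hii (ε / (a * (1 + δ))) (ε / (a * (1 - δ)))).add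
        (hii (-(ε / (a * (1 - δ)))) (-(ε / (a * (1 + δ)))))) hiD
      have e2 := integral_add (hii (ε / (a * (1 + δ))) (ε / (a * (1 - δ))))
        (hii (-(ε / (a * (1 - δ)))) (-(ε / (a * (1 + δ)))))
      have v1 := hvol _ _ hRR
      have v2 := hvol _ _ (neg_le_neg hRR)
      have e3 : ∫ x, |D ε x| * (10 / r) ∂μ = (∫ x, |D ε x| ∂μ) * (10 / r) := integral_mul_const _ _
      simp only [Pi.add_apply] at e1 e2 ⊢
      rw [e1, e2, e3]
      have : (-(ε / (a * (1 + δ))) - -(ε / (a * (1 - δ)))) * (10 / (ε / (a * (1 + δ)))) ≤ 40 * δ := by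
        rw [neg_sub_neg]; exact hfin
      linarith
  have hlim2 : Tendsto (fun ε => (∫ x, |D ε x| ∂μ) * (10 / r)) (𝓝[>] 0) (𝓝 0) := by
    simpa using hDint.mul_const (10 / r)
  obtain ⟨r', hr', h'⟩ := Metric.tendsto_nhdsWithin_nhds.1 hlim2 (η / 2) (by positivity)
  refine ⟨r', hr', fun {ε} hε hεr => ?_⟩
  have h2 := h' hε hεr
  rw [dist_zero_right, Real.norm_eq_abs] at h2
  rw [dist_zero_right, hsplit ε hε]
  linarith [hbound ε hε, le_abs_self ((∫ x, |D ε x| ∂μ) * (10 / r))]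

/-! ### Principal values on the segment -/

lemma cos_sub_cos_half (ψ φ : ℝ) :
    Real.cos ψ - Real.cos φ = -2 * Real.sin ((ψ + φ) / 2) * Real.sin ((ψ - φ) / 2) :=
  Real.cos_sub_cos ψ φ

lemma cotH_sub_cotH {φ ψ : ℝ} (h : Real.cos ψ - Real.cos φ ≠ 0) :
    cotH (ψ - φ) - cotH (ψ + φ) = -2 * Real.sin φ / (Real.cos ψ - Real.cos φ) := by
  rw [cos_sub_cos_half] at h ⊢
  have h1 : Real.sin ((ψ + φ) / 2) ≠ 0 := by
    intro h0; rw [h0] at h; simp at h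
  have h2 : Real.sin ((ψ - φ) / 2) ≠ 0 := by
    intro h0; rw [h0] at h; simp at h
  have e : Real.sin φ = Real.sin ((ψ + φ) / 2) * Real.cos ((ψ - φ) / 2) -
      Real.cos ((ψ + φ) / 2) * Real.sin ((ψ - φ) / 2) := by
    rw [← Real.sin_sub]; congr 1; ring
  rw [e, cotH, cotH]
  field_simp

lemma abs_cotH_le_of_cos {φ ψ c : ℝ} (hc : 0 < c) (h : c ≤ |Real.cos ψ - Real.cos φ|) :
    |cotH (ψ - φ)| ≤ 2 / c := by
  rw [cos_sub_cos_half, abs_mul, abs_mul, abs_neg, abs_two] at h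
  have h1 := Real.abs_sin_le_one ((ψ + φ) / 2)
  have h2 : c ≤ 2 * |Real.sin ((ψ - φ) / 2)| := by
    nlinarith [abs_nonneg (Real.sin ((ψ - φ) / 2))]
  have h3 : 0 < |Real.sin ((ψ - φ) / 2)| := by linarith
  rw [cotH, abs_div, div_le_div_iff₀ h3 hc]
  nlinarith [Real.abs_cos_le_one ((ψ - φ) / 2)]

lemma integral_comp_cos_div {g : ℝ → ℂ} (hg : Measurable fun ψ => g (Real.cos ψ)) {M c φ : ℝ}
    (hM : ∀ ψ, ‖g (Real.cos ψ)‖ ≤ M) (hc : 0 < c)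
    (hgc : ∀ x, g x ≠ 0 → c ≤ |x - Real.cos φ|) (hφ : Real.sin φ ≠ 0) :
    ∫ ψ in (0:ℝ)..Real.pi, g (Real.cos ψ) / ((Real.cos ψ : ℂ) - (Real.cos φ : ℂ)) =
      -(1 / (2 * (Real.sin φ : ℂ))) *
        ∫ x in (-Real.pi)..Real.pi, g (Real.cos (φ + x)) * (cotH x : ℂ) := by
  have hM0 : 0 ≤ M := (norm_nonneg _).trans (hM 0)
  set f : ℝ → ℂ := fun ψ => g (Real.cos ψ) * (cotH (ψ - φ) : ℂ) with hf
  have hfm : Measurable f :=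
    hg.mul (Complex.measurable_ofReal.comp (measurable_cotH.comp (measurable_id.sub_const φ)))
  have hfb : ∀ ψ, ‖f ψ‖ ≤ M * (2 / c) := by
    intro ψ
    simp only [hf]
    rw [norm_mul, Complex.norm_real, Real.norm_eq_abs]
    by_cases h : g (Real.cos ψ) = 0
    · rw [h, norm_zero, zero_mul]; positivity
    · exact mul_le_mul (hM ψ) (abs_cotH_le_of_cos hc (hgc _ h)) (abs_nonneg _) hM0
  have hfi : ∀ a b, IntervalIntegrable f volume a b := fun a b =>
    (intervalIntegrable_const (c := M * (2 / c))).mono_fun hfm.aestronglyMeasurable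
      (Eventually.of_forall fun ψ => (hfb ψ).trans (le_abs_self _))
  have hfin : IntervalIntegrable (fun ψ => f (-ψ)) volume 0 Real.pi :=
    (intervalIntegrable_const (c := M * (2 / c))).mono_fun
      (hfm.comp measurable_neg).aestronglyMeasurable
      (Eventually.of_forall fun ψ => (hfb (-ψ)).trans (le_abs_self _))
  have hfper : Function.Periodic f (2 * Real.pi) := by
    intro ψ
    simp only [hf]
    rw [Real.cos_add_two_pi, show ψ + 2 * Real.pi - φ = ψ - φ + 2 * Real.pi by ring,
      cotH_periodic]
  have hpt : ∀ ψ, g (Real.cos ψ) / ((Real.cos ψ : ℂ) - (Real.cos φ : ℂ)) =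
      -(1 / (2 * (Real.sin φ : ℂ))) * (f ψ + f (-ψ)) := by
    intro ψ
    simp only [hf]
    rw [Real.cos_neg]
    by_cases h : g (Real.cos ψ) = 0
    · simp [h]
    have hne : Real.cos ψ - Real.cos φ ≠ 0 := by
      intro h0
      have := hgc _ h
      rw [h0, abs_zero] at this
      linarith
    have e := cotH_sub_cotH hne
    rw [show -ψ - φ = -(ψ + φ) by ring, cotH_neg, ← mul_add, ← Complex.ofReal_add,
      ← sub_eq_add_neg, e]
    have hne' : ((Real.cos ψ : ℂ) - (Real.cos φ : ℂ)) ≠ 0 := by exact_mod_cast hne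
    have hφ' : (Real.sin φ : ℂ) ≠ 0 := by exact_mod_cast hφ
    rw [Complex.ofReal_div, Complex.ofReal_mul, Complex.ofReal_sub]
    push_cast at hne' hφ' ⊢
    field_simp
  have hshift := integral_periodic_shift hfper φ
  have hfs : ∀ x, f (φ + x) = g (Real.cos (φ + x)) * (cotH x : ℂ) := by
    intro x; simp only [hf]; rw [add_sub_cancel_left]
  simp only [hfs] at hshift
  rw [hshift]
  simp only [hpt]
  rw [intervalIntegral.integral_const_mul, intervalIntegral.integral_add (hfi _ _)
    hfin, intervalIntegral.integral_comp_neg, neg_zero, add_comm,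
    intervalIntegral.integral_add_adjacent_intervals (hfi _ _) (hfi _ _)]

/-- The principal value of a Hölder continuous density on `[-1,1]`, against the weight
`(1 - x²)^(-1/2)`, is given by the conjugate function. -/
lemma tendsto_pv_comp_cos {s : ℝ} (hs : 0 < s) (hs1 : s < 1) {v : ℝ → ℂ} (hv : HolderI s v)
    {R : ℝ → ℝ} (hR : ContinuousOn R (Icc (-1) 1)) {L φ a : ℝ} (hL : 0 < L)
    (hφ : φ ∈ Ioo 0 Real.pi) (hR1 : ∀ x ∈ Icc (-1:ℝ) 1, R x ≤ L * |x - Real.cos φ|)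
    (hR2 : ∀ x ∈ Icc (-1:ℝ) 1, |x - Real.cos φ| ≤ L * R x) (ha : 0 < a)
    (hRa : Tendsto (fun x => R (Real.cos (φ + x)) / |x|) (𝓝[≠] 0) (𝓝 a)) :
    Tendsto (fun ε : ℝ => ∫ ψ in (0:ℝ)..Real.pi,
        (if ε ≤ R (Real.cos ψ) then v (Real.cos ψ) else 0) /
          ((Real.cos ψ : ℂ) - (Real.cos φ : ℂ))) (𝓝[>] 0)
      (𝓝 (-(1 / (2 * (Real.sin φ : ℂ))) * conjInt (fun ψ => v (Real.cos ψ)) φ)) := by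
  have hpi := Real.pi_pos
  have hsin : Real.sin φ ≠ 0 := (Real.sin_pos_of_mem_Ioo hφ).ne'
  have hcosI : ∀ ψ, Real.cos ψ ∈ Icc (-1:ℝ) 1 := fun ψ =>
    ⟨Real.neg_one_le_cos ψ, Real.cos_le_one ψ⟩
  have hρc : Continuous fun ψ => R (Real.cos ψ) :=
    hR.comp_continuous Real.continuous_cos hcosI
  have hVc : Continuous fun ψ => v (Real.cos ψ) := continuous_comp_cos (hv.continuousOn hs)
  obtain ⟨M, hM0, hM⟩ := hv.bounded hs.le hs1.le
  have hset : ∀ ε, MeasurableSet {ψ | ε ≤ R (Real.cos ψ)} := fun ε =>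
    measurableSet_le measurable_const hρc.measurable
  have hrw : ∀ ε, 0 < ε → ∫ ψ in (0:ℝ)..Real.pi,
      (if ε ≤ R (Real.cos ψ) then v (Real.cos ψ) else 0) /
          ((Real.cos ψ : ℂ) - (Real.cos φ : ℂ)) = -(1 / (2 * (Real.sin φ : ℂ))) *
        ∫ x in (-Real.pi)..Real.pi,
          (if ε ≤ R (Real.cos (φ + x)) then v (Real.cos (φ + x)) else 0) * (cotH x : ℂ) := by
    intro ε hε
    have hg : ∀ ψ, (if Real.cos ψ ∈ Icc (-1:ℝ) 1 ∧ ε ≤ R (Real.cos ψ) then v (Real.cos ψ) else 0) =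
        if ε ≤ R (Real.cos ψ) then v (Real.cos ψ) else 0 := fun ψ => by
      simp only [hcosI, true_and]
    have h := integral_comp_cos_div
      (g := fun y => if y ∈ Icc (-1:ℝ) 1 ∧ ε ≤ R y then v y else 0) (M := M) (c := ε / L) (φ := φ)
      (by simpa only [hg] using Measurable.ite (hset ε) hVc.measurable measurable_const)
      (fun ψ => by
        rw [hg]
        split_ifs
        · exact hM _ (hcosI ψ)
        · simpa using hM0)
      (div_pos hε hL)
      (fun x hx => by
        have h : x ∈ Icc (-1:ℝ) 1 ∧ ε ≤ R x := by
          by_contra h; exact hx (if_neg h)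
        rw [div_le_iff₀ hL, mul_comm]
        exact h.2.trans (hR1 x h.1)) hsin
    simpa only [hg] using h
  have hρ' : Continuous fun x => R (Real.cos (φ + x)) :=
    hρc.comp (continuous_const.add continuous_id)
  have hρL : ∀ x, R (Real.cos (φ + x)) ≤ L * |x| := fun x => by
    refine (hR1 _ (hcosI _)).trans (mul_le_mul_of_nonneg_left ?_ hL.le)
    have := Real.abs_cos_sub_cos_le (φ + x) φ
    simpa using this
  have hρ0 : ∀ᵐ x : ℝ, 0 < R (Real.cos (φ + x)) := by
    have hcount : {x : ℝ | Real.cos (φ + x) = Real.cos φ}.Countable := by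
      have : {x : ℝ | Real.cos (φ + x) = Real.cos φ} ⊆
          (range fun k : ℤ => 2 * k * Real.pi) ∪ range fun k : ℤ => 2 * k * Real.pi - φ - φ := by
        intro x hx
        obtain ⟨k, hk | hk⟩ := Real.cos_eq_cos_iff.1 (show Real.cos (φ + x) = Real.cos φ from hx).symm
        · exact Or.inl ⟨k, by simp only; linarith⟩
        · exact Or.inr ⟨k, by simp only; linarith⟩
      exact ((countable_range _).union (countable_range _)).mono this
    filter_upwards [hcount.ae_notMem volume] with x hx
    have h1 := hR2 _ (hcosI (φ + x))
    have h2 : 0 < |Real.cos (φ + x) - Real.cos φ| := abs_pos.2 (sub_ne_zero.2 hx)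
    by_contra! h3
    nlinarith
  have hlim := tendsto_integral_ite_cotH hρ' hL hρL hρ0 ha hRa
  have hker : IntegrableOn (fun x => (v (Real.cos (φ + x)) - v (Real.cos φ)) * (cotH x : ℂ))
      (Ioc (-Real.pi) Real.pi) :=
    (intervalIntegrable_iff_integrableOn_Ioc_of_le (by linarith)).1 (kerInt_comp_cos hs hs1 hv φ)
  have hmeas : ∀ ε, AEStronglyMeasurable (fun x => if ε ≤ R (Real.cos (φ + x)) then
      (v (Real.cos (φ + x)) - v (Real.cos φ)) * (cotH x : ℂ) else 0)
      (volume.restrict (Ioc (-Real.pi) Real.pi)) := fun ε => by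
    have := hker.aestronglyMeasurable.indicator
      (measurableSet_le (f := fun _ : ℝ => ε) measurable_const hρ'.measurable)
    refine this.congr (ae_of_all _ fun x => ?_)
    simp only [indicator_apply, mem_ofPred_eq]
  have hdom : ∀ ε x, ‖(if ε ≤ R (Real.cos (φ + x)) then
      (v (Real.cos (φ + x)) - v (Real.cos φ)) * (cotH x : ℂ) else 0)‖ ≤
      ‖(v (Real.cos (φ + x)) - v (Real.cos φ)) * (cotH x : ℂ)‖ := by
    intro ε x
    split_ifs
    · exact le_rfl
    · rw [norm_zero]; exact norm_nonneg _
  have hlim1 : Tendsto (fun ε => ∫ x in Ioc (-Real.pi) Real.pi, if ε ≤ R (Real.cos (φ + x)) then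
      (v (Real.cos (φ + x)) - v (Real.cos φ)) * (cotH x : ℂ) else 0) (𝓝[>] 0)
      (𝓝 (conjInt (fun ψ => v (Real.cos ψ)) φ)) := by
    rw [conjInt, intervalIntegral.integral_of_le (by linarith)]
    refine tendsto_integral_filter_of_dominated_convergence _ (Eventually.of_forall hmeas)
      (Eventually.of_forall fun ε => ae_of_all _ (hdom ε)) hker.norm ?_
    filter_upwards [ae_restrict_of_ae hρ0] with x hx
    refine tendsto_const_nhds.congr' ?_
    filter_upwards [nhdsWithin_le_nhds (eventually_lt_nhds hx)] with ε h1
    rw [if_pos h1.le]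
  have hlim2 : Tendsto (fun ε => (∫ x in Ioc (-Real.pi) Real.pi, if ε ≤ R (Real.cos (φ + x)) then
      (v (Real.cos (φ + x)) - v (Real.cos φ)) * (cotH x : ℂ) else 0) + v (Real.cos φ) *
      ((∫ x in Ioc (-Real.pi) Real.pi,
        (if ε ≤ R (Real.cos (φ + x)) then (1:ℝ) else 0) * cotH x : ℝ) : ℂ)) (𝓝[>] 0)
      (𝓝 (conjInt (fun ψ => v (Real.cos ψ)) φ)) := by
    have h := hlim1.add (((Complex.continuous_ofReal.tendsto 0).comp hlim).const_mul
      (v (Real.cos φ)))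
    simpa using h
  refine (hlim2.const_mul _).congr' ?_
  filter_upwards [self_mem_nhdsWithin] with ε hε
  rw [hrw ε hε]
  congr 1
  have hi : Integrable (fun x => v (Real.cos φ) *
      (((if ε ≤ R (Real.cos (φ + x)) then (1:ℝ) else 0) * cotH x : ℝ) : ℂ))
      (volume.restrict (Ioc (-Real.pi) Real.pi)) :=
    (integrable_ite_mul_cotH hρ' hL hρL hε).ofReal.const_mul _
  rw [intervalIntegral.integral_of_le (by linarith), ← integral_complex_ofReal,
    ← integral_const_mul, ← integral_add (hker.norm.mono' (hmeas ε) (ae_of_all _ (hdom ε))) hi]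
  refine integral_congr_ae (ae_of_all _ fun x => ?_)
  simp only
  split_ifs
  · push_cast; ring
  · simp

/-! ### Principal values on the arc -/

lemma integral_Icc_eq_integral_cos (f : ℝ → ℂ) :
    ∫ x in Icc (-1:ℝ) 1, f x = ∫ ψ in (0:ℝ)..Real.pi, (Real.sin ψ : ℂ) * f (Real.cos ψ) := by
  have himg : Real.cos '' Icc 0 Real.pi = Icc (-1) 1 := Real.bijOn_cos.image_eq
  rw [← himg, integral_image_eq_integral_abs_deriv_smul measurableSet_Icc
    (fun x _ => (Real.hasDerivAt_cos x).hasDerivWithinAt) Real.injOn_cos,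
    intervalIntegral.integral_of_le Real.pi_pos.le, ← integral_Icc_eq_integral_Ioc]
  refine setIntegral_congr_fun measurableSet_Icc fun ψ hψ => ?_
  simp only [abs_neg]
  rw [abs_of_nonneg (Real.sin_nonneg_of_mem_Icc hψ), Complex.real_smul]

namespace AnalyticArc

variable (A : AnalyticArc)

lemma cos_mem_realSeg (ψ : ℝ) : (Real.cos ψ : ℂ) ∈ realSeg :=
  ofReal_mem_realSeg ⟨Real.neg_one_le_cos ψ, Real.cos_le_one ψ⟩

lemma continuous_comp_cos : Continuous fun ψ : ℝ => A.Ξ (Real.cos ψ) :=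
  A.diff.continuousOn.comp_continuous (by fun_prop) fun ψ => A.seg_sub (cos_mem_realSeg ψ)

lemma aestronglyMeasurable_kern {t : ℂ} (ht : t ∈ A.U) :
    AEStronglyMeasurable (fun ψ : ℝ => A.kern (Real.cos ψ) t)
      (volume.restrict (Ioc 0 Real.pi)) := by
  have hc : Continuous fun ψ : ℝ => (Real.cos ψ : ℂ) := by fun_prop
  have hm : Measurable fun ψ : ℝ =>
      deriv A.Ξ (Real.cos ψ) / (A.Ξ (Real.cos ψ) - A.Ξ t) - 1 / ((Real.cos ψ : ℂ) - t) := by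
    have h1 : Continuous fun ψ : ℝ => deriv A.Ξ (Real.cos ψ) :=
      (A.diff.deriv A.isOpen_U).continuousOn.comp_continuous hc
        fun ψ => A.seg_sub (cos_mem_realSeg ψ)
    exact (h1.measurable.div (A.continuous_comp_cos.measurable.sub_const _)).sub
      (measurable_const.div (hc.measurable.sub_const _))
  refine hm.aestronglyMeasurable.congr ?_
  have hsub : ({ψ : ℝ | (Real.cos ψ : ℂ) = t} ∩ Icc 0 Real.pi).Subsingleton := by
    rintro x ⟨hx, hx'⟩ y ⟨hy, hy'⟩
    refine Real.injOn_cos hx' hy' ?_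
    have : (Real.cos x : ℂ) = Real.cos y := Eq.trans hx (Eq.symm hy)
    exact_mod_cast this
  filter_upwards [ae_restrict_mem measurableSet_Ioc,
    ae_restrict_of_ae (hsub.countable.ae_notMem volume)] with ψ hψ hψ'
  have hne : (Real.cos ψ : ℂ) ≠ t := fun h => hψ' ⟨h, Ioc_subset_Icc_self hψ⟩
  exact (A.kern_eq (A.seg_sub (cos_mem_realSeg ψ)) ht hne).symm

lemma hasDerivAt_comp_cos (φ : ℝ) :
    HasDerivAt (fun x : ℝ => A.Ξ (Real.cos (φ + x)))
      (-(Real.sin φ : ℂ) * deriv A.Ξ (Real.cos φ)) 0 := by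
  have h1 : HasDerivAt A.Ξ (deriv A.Ξ (Real.cos φ)) ((Real.cos φ : ℝ) : ℂ) :=
    (A.diff.differentiableAt (A.isOpen_U.mem_nhds (A.seg_sub (cos_mem_realSeg φ)))).hasDerivAt
  have h2 : HasDerivAt (fun x => Real.cos (φ + x)) (-Real.sin φ) 0 := by
    have := (Real.hasDerivAt_cos (φ + 0)).comp_const_add φ 0
    rwa [add_zero] at this
  have h3 : HasDerivAt (fun y : ℝ => A.Ξ y) (deriv A.Ξ (Real.cos φ)) (Real.cos (φ + 0)) := by
    rw [add_zero]; exact h1.comp_ofReal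
  refine (h3.scomp 0 h2).congr_deriv ?_
  rw [Complex.real_smul]; push_cast; ring

/-- The principal value integral over the arc in terms of the conjugate function and of the
regular part of the Cauchy kernel. -/
theorem isPV_eq {N : Set ℂ} {B : ℝ} (hsN : realSeg ⊆ N)
    (hB : ∀ x ∈ realSeg, ∀ t ∈ N, ‖A.kern x t‖ ≤ B ∧ ‖x - t‖ ≤ B * ‖A.Ξ x - A.Ξ t‖ ∧
      ‖A.Ξ x - A.Ξ t‖ ≤ B * ‖x - t‖) {s : ℝ} (hs : 0 < s) (hs1 : s < 1) {w : ℝ → ℂ}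
    (hw : HolderI s w) {g : ℂ → ℂ}
    (hg : ∀ x ∈ Ioo (-1:ℝ) 1, g (A.Ξ x) = w x / (Real.sqrt (1 - x ^ 2) : ℂ)) {φ : ℝ}
    (hφ : φ ∈ Ioo 0 Real.pi) {c : ℂ} (hpv : IsPV A g (A.Ξ (Real.cos φ)) c) :
    c = (∫ ψ in (0:ℝ)..Real.pi, w (Real.cos ψ) * A.kern (Real.cos ψ) (Real.cos φ)) +
      -(1 / (2 * (Real.sin φ : ℂ))) * conjInt (fun ψ => w (Real.cos ψ)) φ := by
  have hpi := Real.pi_pos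
  have hcosI : ∀ ψ, Real.cos ψ ∈ Icc (-1:ℝ) 1 := fun ψ =>
    ⟨Real.neg_one_le_cos ψ, Real.cos_le_one ψ⟩
  have hsin : 0 < Real.sin φ := Real.sin_pos_of_mem_Ioo hφ
  have htU : (Real.cos φ : ℂ) ∈ A.U := A.seg_sub (cos_mem_realSeg φ)
  obtain ⟨M, hM0, hM⟩ := hw.bounded hs.le hs1.le
  set R : ℝ → ℝ := fun x => ‖A.Ξ x - A.Ξ (Real.cos φ)‖ with hR
  set L : ℝ := max B 1 with hL
  have hL0 : 0 < L := lt_of_lt_of_le one_pos (le_max_right _ _)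
  have hΞc : ContinuousOn (fun x : ℝ => A.Ξ x) (Icc (-1) 1) :=
    A.diff.continuousOn.comp Complex.continuous_ofReal.continuousOn
      fun x hx => A.seg_sub (ofReal_mem_realSeg hx)
  have hRc : ContinuousOn R (Icc (-1) 1) := (hΞc.sub continuousOn_const).norm
  have hBx : ∀ x ∈ Icc (-1:ℝ) 1, R x ≤ L * |x - Real.cos φ| ∧ |x - Real.cos φ| ≤ L * R x := by
    intro x hx
    obtain ⟨-, h2, h3⟩ := hB x (ofReal_mem_realSeg hx) _ (hsN (cos_mem_realSeg φ))
    rw [← Complex.ofReal_sub, Complex.norm_real, Real.norm_eq_abs] at h2 h3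
    exact ⟨h3.trans (mul_le_mul_of_nonneg_right (le_max_left _ _) (abs_nonneg _)),
      h2.trans (mul_le_mul_of_nonneg_right (le_max_left _ _) (norm_nonneg _))⟩
  have hRcos : Continuous fun ψ => R (Real.cos ψ) :=
    hRc.comp_continuous Real.continuous_cos hcosI
  have hset : ∀ ε, MeasurableSet {ψ | ε ≤ R (Real.cos ψ)} := fun ε =>
    measurableSet_le measurable_const hRcos.measurable
  have hwc : Continuous fun ψ => w (Real.cos ψ) := _root_.continuous_comp_cos (hw.continuousOn hs)
  -- the two pieces of the integrand
  set f₁ : ℝ → ℝ → ℂ := fun ε ψ => if ε ≤ R (Real.cos ψ) then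
    w (Real.cos ψ) * A.kern (Real.cos ψ) (Real.cos φ) else 0 with hf₁
  set f₂ : ℝ → ℝ → ℂ := fun ε ψ => (if ε ≤ R (Real.cos ψ) then w (Real.cos ψ) else 0) /
    ((Real.cos ψ : ℂ) - (Real.cos φ : ℂ)) with hf₂
  have hkm : AEStronglyMeasurable (fun ψ => w (Real.cos ψ) * A.kern (Real.cos ψ) (Real.cos φ))
      (volume.restrict (Ioc 0 Real.pi)) :=
    hwc.aestronglyMeasurable.mul (A.aestronglyMeasurable_kern htU)
  have hf₁m : ∀ ε, AEStronglyMeasurable (f₁ ε) (volume.restrict (Ioc 0 Real.pi)) := fun ε =>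
    (hkm.indicator (hset ε)).congr (ae_of_all _ fun ψ => by
      simp only [hf₁, indicator_apply, mem_ofPred_eq])
  have hB0 : 0 ≤ B := (norm_nonneg _).trans
    (hB _ (cos_mem_realSeg 0) _ (hsN (cos_mem_realSeg 0))).1
  have hf₁b : ∀ ε ψ, ‖f₁ ε ψ‖ ≤ M * B := by
    intro ε ψ
    simp only [hf₁]
    split_ifs
    · rw [norm_mul]
      exact mul_le_mul (hM _ (hcosI ψ)) (hB _ (cos_mem_realSeg ψ) _ (hsN (cos_mem_realSeg φ))).1
        (norm_nonneg _) hM0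
    · rw [norm_zero]; positivity
  have hf₁i : ∀ ε, IntervalIntegrable (f₁ ε) volume 0 Real.pi := fun ε => by
    rw [intervalIntegrable_iff_integrableOn_Ioc_of_le hpi.le]
    exact (integrable_const (M * B)).mono' (hf₁m ε) (ae_of_all _ (hf₁b ε))
  have hf₂i : ∀ ε, 0 < ε → IntervalIntegrable (f₂ ε) volume 0 Real.pi := fun ε hε => by
    rw [intervalIntegrable_iff_integrableOn_Ioc_of_le hpi.le]
    refine (integrable_const (M * (L / ε))).mono' (Measurable.aestronglyMeasurable ?_)
      (ae_of_all _ fun ψ => ?_)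
    · refine (Measurable.ite (hset ε) hwc.measurable measurable_const).div ?_
      exact (Complex.measurable_ofReal.comp Real.measurable_cos).sub_const _
    · simp only [hf₂]
      split_ifs with h
      · have h1 := h.trans (hBx _ (hcosI ψ)).1
        have h2 : 0 < |Real.cos ψ - Real.cos φ| := by
          by_contra! h'
          nlinarith
        rw [norm_div, ← Complex.ofReal_sub, Complex.norm_real, Real.norm_eq_abs, div_eq_mul_inv]
        refine mul_le_mul (hM _ (hcosI ψ)) ?_ (by positivity) hM0
        rw [inv_eq_one_div, div_le_div_iff₀ h2 hε, one_mul]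
        exact h1
      · rw [zero_div, norm_zero]; positivity
  have hlim₁ : Tendsto (fun ε => ∫ ψ in (0:ℝ)..Real.pi, f₁ ε ψ) (𝓝[>] 0)
      (𝓝 (∫ ψ in (0:ℝ)..Real.pi, w (Real.cos ψ) * A.kern (Real.cos ψ) (Real.cos φ))) := by
    simp only [intervalIntegral.integral_of_le hpi.le]
    refine tendsto_integral_filter_of_dominated_convergence (fun _ => M * B)
      (Eventually.of_forall hf₁m) (Eventually.of_forall fun ε => ae_of_all _ (hf₁b ε))
      (integrable_const _) ?_
    have hne : ∀ᵐ ψ : ℝ, ψ ≠ φ := by simp [ae_iff]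
    filter_upwards [ae_restrict_mem measurableSet_Ioc, ae_restrict_of_ae hne] with ψ hψ hψφ
    have hpos : 0 < R (Real.cos ψ) := by
      refine norm_pos_iff.2 (sub_ne_zero.2 fun h => hψφ ?_)
      have h1 := A.inj (A.seg_sub (cos_mem_realSeg ψ)) htU h
      exact Real.injOn_cos (Ioc_subset_Icc_self hψ) (Ioo_subset_Icc_self hφ) (by exact_mod_cast h1)
    refine tendsto_const_nhds.congr' ?_
    filter_upwards [nhdsWithin_le_nhds (eventually_lt_nhds hpos)] with ε h1
    simp only [hf₁]
    rw [if_pos h1.le]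
  have hlim₂ : Tendsto (fun ε => ∫ ψ in (0:ℝ)..Real.pi, f₂ ε ψ) (𝓝[>] 0)
      (𝓝 (-(1 / (2 * (Real.sin φ : ℂ))) * conjInt (fun ψ => w (Real.cos ψ)) φ)) := by
    refine tendsto_pv_comp_cos (a := ‖-(Real.sin φ : ℂ) * deriv A.Ξ (Real.cos φ)‖) hs hs1 hw hRc
      hL0 hφ (fun x hx => (hBx x hx).1) (fun x hx => (hBx x hx).2) ?_ ?_
    · refine norm_pos_iff.2 (mul_ne_zero (neg_ne_zero.2 ?_) (A.deriv_ne_zero htU))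
      exact_mod_cast hsin.ne'
    · have h := (hasDerivAt_iff_tendsto_slope.1 (A.hasDerivAt_comp_cos φ)).norm
      refine h.congr fun x => ?_
      rw [slope_def_module, norm_smul, norm_inv, sub_zero, add_zero, Real.norm_eq_abs]
      rw [div_eq_inv_mul]
  refine tendsto_nhds_unique hpv ((hlim₁.add hlim₂).congr' ?_)
  filter_upwards [self_mem_nhdsWithin] with ε hε
  rw [← intervalIntegral.integral_add (hf₁i ε) (hf₂i ε hε)]
  set Sε : Set ℝ := {x ∈ Icc (-1:ℝ) 1 | ε ≤ ‖A.Ξ (x:ℂ) - A.Ξ (Real.cos φ)‖} with hSε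
  have hSsub : Sε ⊆ Icc (-1) 1 := fun x hx => hx.1
  have hSm : MeasurableSet Sε :=
    (hRc.preimage_isClosed_of_isClosed isClosed_Icc (isClosed_Ici (a := ε))).measurableSet
  rw [← inter_eq_self_of_subset_right hSsub, ← setIntegral_indicator hSm,
    integral_Icc_eq_integral_cos, intervalIntegral.integral_of_le hpi.le,
    intervalIntegral.integral_of_le hpi.le, integral_Ioc_eq_integral_Ioo,
    integral_Ioc_eq_integral_Ioo]
  refine setIntegral_congr_fun measurableSet_Ioo fun ψ hψ => ?_
  have hmem : Real.cos ψ ∈ Sε ↔ ε ≤ R (Real.cos ψ) := ⟨fun h => h.2, fun h => ⟨hcosI ψ, h⟩⟩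
  simp only [hf₁, hf₂, indicator_apply, hmem]
  split_ifs with h
  · have hsψ : 0 < Real.sin ψ := Real.sin_pos_of_mem_Ioo hψ
    have hψI : Real.cos ψ ∈ Ioo (-1:ℝ) 1 := by
      have : Real.sin ψ ^ 2 + Real.cos ψ ^ 2 = 1 := Real.sin_sq_add_cos_sq ψ
      rw [mem_Ioo, ← abs_lt, ← sq_lt_one_iff_abs_lt_one]
      nlinarith
    have hne : (Real.cos ψ : ℂ) ≠ Real.cos φ := by
      intro h'
      have : R (Real.cos ψ) = 0 := by simp only [hR, h', sub_self, norm_zero]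
      rw [this] at h
      exact absurd h (not_le.2 hε)
    have hsqrt : Real.sqrt (1 - Real.cos ψ ^ 2) = Real.sin ψ := by
      rw [← Real.sin_sq, Real.sqrt_sq hsψ.le]
    rw [hg _ hψI, hsqrt, A.kern_eq (A.seg_sub (cos_mem_realSeg ψ)) htU hne]
    have : (Real.sin ψ : ℂ) ≠ 0 := by exact_mod_cast hsψ.ne'
    field_simp
    ring
  · simp

end AnalyticArc

/-! ### Interpolation at the endpoints and derivatives with respect to arclength -/

namespace AnalyticArc

variable (A : AnalyticArc)

/-- Division with remainder by `Ξ² - 1`. -/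
lemma exists_linear_add_mul {N : Set ℂ} (hN : IsOpen N) (hsN : realSeg ⊆ N) {q : ℂ → ℂ}
    (hqd : DifferentiableOn ℂ q N) (hq0 : ∀ z ∈ N, q z ≠ 0)
    (hq : ∀ z ∈ N, A.Ξ z ^ 2 - 1 = (z ^ 2 - 1) * q z ^ 2) (hΞ : DifferentiableOn ℂ A.Ξ N)
    {J : ℂ → ℂ} (hJ : DifferentiableOn ℂ J N) : ∃ (a b : ℂ) (G : ℂ → ℂ), DifferentiableOn ℂ G N ∧
      ∀ z ∈ N, J z = a + b * A.Ξ z + (A.Ξ z ^ 2 - 1) * G z := by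
  have h1 : (1:ℂ) ∈ N := hsN (by simpa using ofReal_mem_realSeg one_mem_segI)
  have h2 : (-1:ℂ) ∈ N := hsN (by simpa using ofReal_mem_realSeg neg_one_mem_segI)
  set a := (J 1 + J (-1)) / 2 with ha
  set b := (J 1 - J (-1)) / 2 with hb
  set H : ℂ → ℂ := fun z => J z - (a + b * A.Ξ z) with hH
  have hHd : DifferentiableOn ℂ H N := hJ.sub ((differentiableOn_const a).add (hΞ.const_mul b))
  have hH1 : H 1 = 0 := by simp only [hH, A.map_one, ha, hb]; ring
  have hH2 : H (-1) = 0 := by simp only [hH, A.map_neg_one, ha, hb]; ring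
  have hd1 : DifferentiableOn ℂ (dslope H 1) N :=
    (Complex.differentiableOn_dslope (hN.mem_nhds h1)).2 hHd
  have hd2 : DifferentiableOn ℂ (dslope (dslope H 1) (-1)) N :=
    (Complex.differentiableOn_dslope (hN.mem_nhds h2)).2 hd1
  have hz : dslope H 1 (-1) = 0 := by
    rw [dslope_of_ne _ (by norm_num), slope_def_field, hH1, hH2, sub_zero, zero_div]
  refine ⟨a, b, fun z => dslope (dslope H 1) (-1) z / q z ^ 2,
    hd2.div (hqd.pow 2) fun z hz => pow_ne_zero 2 (hq0 z hz), fun z hzN => ?_⟩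
  have e1 := sub_smul_dslope H 1 z
  have e2 := sub_smul_dslope (dslope H 1) (-1) z
  rw [hH1, sub_zero, smul_eq_mul] at e1
  rw [hz, sub_zero, smul_eq_mul] at e2
  have e3 : J z = a + b * A.Ξ z + H z := by simp only [hH]; ring
  rw [e3, hq z hzN, ← e1, ← e2]
  have := hq0 z hzN
  field_simp
  ring

/-- Hermite interpolation at `±1` by polynomials in `Ξ`. -/
lemma exists_hermite {N : Set ℂ} (hN : IsOpen N) (hsN : realSeg ⊆ N) {q : ℂ → ℂ}
    (hqd : DifferentiableOn ℂ q N) (hq0 : ∀ z ∈ N, q z ≠ 0)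
    (hq : ∀ z ∈ N, A.Ξ z ^ 2 - 1 = (z ^ 2 - 1) * q z ^ 2) (hΞ : DifferentiableOn ℂ A.Ξ N)
    {J : ℂ → ℂ} (hJ : DifferentiableOn ℂ J N) (m : ℕ) :
    ∃ (ℓ : ℂ[X]) (G : ℂ → ℂ), ℓ.natDegree ≤ 2 * m + 1 ∧ DifferentiableOn ℂ G N ∧
      ∀ z ∈ N, J z = ℓ.eval (A.Ξ z) + (A.Ξ z ^ 2 - 1) ^ (m + 1) * G z := by
  induction m with
  | zero =>
    obtain ⟨a, b, G, hG, h⟩ := A.exists_linear_add_mul hN hsN hqd hq0 hq hΞ hJ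
    refine ⟨C a + C b * X, G, by compute_degree, hG, fun z hz => ?_⟩
    simp [h z hz]
  | succ m ih =>
    obtain ⟨ℓ, G, hℓ, hG, h⟩ := ih
    obtain ⟨a, b, G', hG', h'⟩ := A.exists_linear_add_mul hN hsN hqd hq0 hq hΞ hG
    refine ⟨ℓ + (C a + C b * X) * (X ^ 2 - 1) ^ (m + 1), G', ?_, hG', fun z hz => ?_⟩
    · refine natDegree_add_le_of_degree_le (hℓ.trans (by omega)) (natDegree_mul_le.trans ?_)
      have h1 : (C a + C b * X : ℂ[X]).natDegree ≤ 1 := by compute_degree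
      have h2 : (X ^ 2 - 1 : ℂ[X]).natDegree ≤ 2 := by compute_degree
      have h3 := natDegree_pow_le_of_le (m + 1) h2
      omega
    · rw [h z hz, h' z hz]
      simp only [eval_add, eval_mul, eval_C, eval_X, eval_pow, eval_sub, eval_one]
      ring

lemma contDiffAt_norm_deriv {x : ℝ} (hx : x ∈ Icc (-1:ℝ) 1) :
    ContDiffAt ℝ (⊤ : ℕ∞) (fun x : ℝ => ‖deriv A.Ξ x‖) x := by
  have hxU : (x:ℂ) ∈ A.U := A.seg_sub (ofReal_mem_realSeg hx)
  have h1 : ContDiffAt ℂ (⊤ : ℕ∞) (deriv A.Ξ) x :=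
    ((A.diff.deriv A.isOpen_U).analyticAt (A.isOpen_U.mem_nhds hxU)).contDiffAt
  exact ((h1.restrict_scalars ℝ).comp x Complex.ofRealCLM.contDiff.contDiffAt).norm ℝ
    (A.deriv_ne_zero hxU)

variable {A}

lemma norm_deriv_ne_zero {x : ℝ} (hx : x ∈ Icc (-1:ℝ) 1) : ‖deriv A.Ξ x‖ ≠ 0 :=
  norm_ne_zero_iff.2 (A.deriv_ne_zero (A.seg_sub (ofReal_mem_realSeg hx)))

/-- Derivatives with respect to arclength of functions in the Hölder classes. -/
lemma exists_tower {z : Prop} {T : Set ℝ} (hT : T ⊆ Ioo 0 1) {m : ℕ} {e : ℝ → ℂ}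
    (he : HolderClass z T m e) : ∃ E : ℕ → ℝ → ℂ, E 0 = e ∧
      (∀ k < m, ∀ x ∈ Icc (-1:ℝ) 1, HasDerivWithinAt (E k)
        (E (k + 1) x * (‖deriv A.Ξ x‖ : ℂ)) (Icc (-1) 1) x) ∧
      (∀ k ≤ m, z → E k 1 = 0 ∧ E k (-1) = 0) ∧ ∀ s ∈ T, HolderI s (E m) := by
  induction m generalizing e with
  | zero =>
    refine ⟨fun _ => e, rfl, fun k hk => absurd hk (Nat.not_lt_zero k), fun k _ => he.1, he.2⟩
  | succ m ih =>
    have hv := he.vanish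
    obtain ⟨-, e', he', h⟩ := he
    have hsm : HolderClass False T m (fun x : ℝ => ((‖deriv A.Ξ x‖⁻¹ : ℝ) : ℂ)) :=
      HolderClass.of_contDiffAt hT fun x hx =>
        Complex.ofRealCLM.contDiff.contDiffAt.comp x
          ((A.contDiffAt_norm_deriv hx).inv (norm_deriv_ne_zero hx))
    obtain ⟨E, hE0, hE1, hE2, hE3⟩ := ih (h.mul hT hsm)
    refine ⟨fun k => Nat.casesOn k e E, rfl, fun k hk x hx => ?_, fun k hk => ?_, hE3⟩
    · cases k with
      | zero =>
        refine (he' x hx).congr_deriv ?_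
        have h0 : (‖deriv A.Ξ x‖ : ℂ) ≠ 0 := by exact_mod_cast norm_deriv_ne_zero hx
        simp only [hE0]
        rw [Complex.ofReal_inv, mul_assoc, inv_mul_cancel₀ h0, mul_one]
      | succ k => exact hE1 k (by omega) x hx
    · cases k with
      | zero => exact hv
      | succ k => exact hE2 k (by omega)

lemma holderClass_of_tower {T : Set ℝ} (hT : T ⊆ Ioo 0 1) {m : ℕ} {E : ℕ → ℝ → ℂ}
    (hE : ∀ k < m, ∀ x ∈ Icc (-1:ℝ) 1, HasDerivWithinAt (E k)
      (E (k + 1) x * (‖deriv A.Ξ x‖ : ℂ)) (Icc (-1) 1) x) (hm : ∀ s ∈ T, HolderI s (E m)) :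
    HolderClass False T m (E 0) := by
  induction m generalizing E with
  | zero => exact ⟨False.elim, hm⟩
  | succ m ih =>
    have h := ih (E := fun k => E (k + 1)) (fun k hk => hE (k + 1) (by omega)) hm
    refine ⟨False.elim, _, hE 0 (by omega), h.mul hT ?_⟩
    exact HolderClass.of_contDiffAt hT fun x hx =>
      Complex.ofRealCLM.contDiff.contDiffAt.comp x (A.contDiffAt_norm_deriv hx)

end AnalyticArc

/-! ### Proof of the main theorem -/

namespace AnalyticArc

variable (A : AnalyticArc)

/-- The singular integral in the coordinate `x ∈ [-1,1]` of the arc. -/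
theorem exists_decomp (S : SqrtBranch A) {srp : ℂ → ℂ}
    (hsrp : BVplus A.Ξ S.sr srp) {T : Set ℝ} (hT : GoodExp T) {m : ℕ} {θ : ℂ → ℂ}
    (hθ : HolderClass False T m fun x => θ (A.Ξ x)) {SI : ℂ → ℂ}
    (hSI : ∀ τ ∈ A.arcInt,
      IsPV A (fun t => θ t / srp t) τ ((Real.pi : ℂ) * Complex.I * SI τ)) :
    ∃ (e : ℝ → ℂ) (ℓ : ℂ[X]), ℓ.natDegree ≤ 2 * m + 1 ∧ HolderClass True T m e ∧
      ∀ x ∈ Ioo (-1:ℝ) 1,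
        srp (A.Ξ x) * SI (A.Ξ x) = e x + srp (A.Ξ x) * ℓ.eval (A.Ξ x) := by
  have hT' := hT.subset
  obtain ⟨N, B, hN, hNc, hsN, hNU, hB0, hB⟩ := A.exists_nhd
  obtain ⟨q, hqd, hq0, hq⟩ := A.exists_sqrt hN hNc hsN hNU
  obtain ⟨σ, hσ, hσq⟩ := A.exists_srp_eq S hsrp hN hNc hsN hNU hqd hq0 hq
  have hσ0 : σ ≠ 0 := fun h => by simp [h] at hσ
  set w : ℝ → ℂ := fun x => θ (A.Ξ x) * (1 / (σ * q x)) with hw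
  have hwc : HolderClass False T m w := hθ.mul hT'
    (HolderClass.of_differentiableOn hT' (F := fun z => 1 / (σ * q z)) hN hsN
      ((differentiableOn_const _).div (hqd.const_mul σ) fun z hz => mul_ne_zero hσ0 (hq0 z hz)))
  obtain ⟨s, hs⟩ := hT.1
  have hs' := hT' hs
  have hws : HolderI s w := hwc.holderI_zero hT' hs
  obtain ⟨M, hM0, hM⟩ := hws.bounded hs'.1.le hs'.2.le
  have hwcont : Continuous fun ψ : ℝ => w (Real.cos ψ) :=
    _root_.continuous_comp_cos (hws.continuousOn hs'.1)
  obtain ⟨d₁, p, hd₁, hp⟩ := exists_conjInt_decomp hT m hwc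
  set F : ℂ → ℂ := fun t => ∫ ψ in Ioc 0 Real.pi, w (Real.cos ψ) * A.kern (Real.cos ψ) t with hF
  have hFd : DifferentiableOn ℂ F N := by
    refine differentiableOn_integral_of_bound hN (b := fun _ => M * B) (fun ψ => ?_)
      (fun t ht => ?_) (fun t ht ψ => ?_) (integrable_const _)
    · exact ((A.differentiableOn_kern (A.seg_sub (cos_mem_realSeg ψ))).mono hNU).const_mul _
    · exact hwcont.aestronglyMeasurable.mul (A.aestronglyMeasurable_kern (hNU ht))
    · rw [norm_mul]
      exact mul_le_mul (hM _ ⟨Real.neg_one_le_cos ψ, Real.cos_le_one ψ⟩)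
        (hB _ (cos_mem_realSeg ψ) t ht).1 (norm_nonneg _) hM0
  set J : ℂ → ℂ := fun z => (F z - p.eval z / 2) / (Real.pi * Complex.I) with hJ
  have hJd : DifferentiableOn ℂ J N :=
    (hFd.sub (p.differentiable.differentiableOn.div_const 2)).div_const _
  obtain ⟨ℓ, G, hℓ, hG, hJℓ⟩ :=
    A.exists_hermite hN hsN hqd hq0 hq (A.diff.mono hNU) hJd m
  refine ⟨fun x => d₁ x * (-σ / (2 * Real.pi * Complex.I) * q x) +
    (((1 - x ^ 2) ^ ((m : ℝ) + 3 / 2) : ℝ) : ℂ) *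
      (σ * (-1) ^ (m + 1) * (q x ^ (2 * m + 3) * G x)), ℓ, hℓ, ?_, ?_⟩
  · refine (hd₁.mul hT' (HolderClass.of_differentiableOn hT'
      (F := fun z => -σ / (2 * Real.pi * Complex.I) * q z) hN hsN (hqd.const_mul _))).add
      ((HolderClass.weight hT' (by linarith)).mul hT' (HolderClass.of_differentiableOn hT'
        (F := fun z => σ * (-1) ^ (m + 1) * (q z ^ (2 * m + 3) * G z)) hN hsN
        (((hqd.pow _).mul hG).const_mul _)))
  intro x hx
  have hxN : (x : ℂ) ∈ N := hsN (ofReal_mem_realSeg (Ioo_subset_Icc_self hx))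
  have hxU := hNU hxN
  have harc : A.Ξ x ∈ A.arcInt := by
    refine ⟨⟨x, ofReal_mem_realSeg (Ioo_subset_Icc_self hx), rfl⟩, ?_⟩
    have h1 : (1:ℂ) ∈ A.U := by
      simpa using A.seg_sub (ofReal_mem_realSeg one_mem_segI)
    have h2 : (-1:ℂ) ∈ A.U := by
      simpa using A.seg_sub (ofReal_mem_realSeg neg_one_mem_segI)
    rintro (h | h)
    · have := A.inj hxU h1 (h.trans A.map_one.symm)
      have : x = 1 := by exact_mod_cast this
      exact hx.2.ne this
    · have := A.inj hxU h2 (Eq.trans h A.map_neg_one.symm)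
      have : x = -1 := by exact_mod_cast this
      exact hx.1.ne' this
  have hpos : 0 < 1 - x ^ 2 := by nlinarith [hx.1, hx.2]
  have hφ : Real.arccos x ∈ Ioo 0 Real.pi :=
    ⟨Real.arccos_pos.2 hx.2, Real.arccos_lt_pi.2 hx.1⟩
  have hcos : Real.cos (Real.arccos x) = x := Real.cos_arccos hx.1.le hx.2.le
  have hsin : Real.sin (Real.arccos x) = Real.sqrt (1 - x ^ 2) := Real.sin_arccos x
  have hg : ∀ y ∈ Ioo (-1:ℝ) 1,
      θ (A.Ξ y) / srp (A.Ξ y) = w y / (Real.sqrt (1 - y ^ 2) : ℂ) := by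
    intro y hy
    rw [hσq y hy, hw]
    simp only [div_eq_mul_inv, mul_inv, one_mul]
    ring
  have hpv := A.isPV_eq hsN hB hs'.1 hs'.2 hws (g := fun t => θ t / srp t) hg hφ
    (by rw [hcos]; exact hSI _ harc)
  rw [hp _ (Ioo_subset_Icc_self hφ), hcos, hsin, intervalIntegral.integral_of_le Real.pi_pos.le]
    at hpv
  change _ = F x + _ at hpv
  have hJx := hJℓ x hxN
  rw [hq _ hxN] at hJx
  set r : ℂ := (Real.sqrt (1 - x ^ 2) : ℂ) with hr
  have hr0 : r ≠ 0 := by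
    rw [hr]; exact_mod_cast (Real.sqrt_pos.2 hpos).ne'
  have hr2 : (x : ℂ) ^ 2 - 1 = - r ^ 2 := by
    rw [hr, ← Complex.ofReal_pow (Real.sqrt _), Real.sq_sqrt hpos.le]; push_cast; ring
  have hweight : (((1 - x ^ 2) ^ ((m : ℝ) + 3 / 2) : ℝ) : ℂ) = r * (r ^ 2) ^ (m + 1) := by
    rw [hr, ← Complex.ofReal_pow, Real.sq_sqrt hpos.le, ← Complex.ofReal_pow,
      ← Complex.ofReal_mul, Real.sqrt_eq_rpow, ← Real.rpow_natCast (1 - x ^ 2),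
      ← Real.rpow_add hpos]
    congr 2; push_cast; ring
  have hπ : (Real.pi : ℂ) ≠ 0 := by exact_mod_cast Real.pi_ne_zero
  have hSIx : SI (A.Ξ x) = J x - d₁ x / (2 * r * (Real.pi * Complex.I)) := by
    rw [hJ]
    field_simp
    field_simp at hpv
    linear_combination hpv
  beta_reduce
  rw [hSIx, hσq x hx, ← hr, hJx, hweight, hr2, neg_mul, neg_pow]
  field_simp
  ring

/-- The inverse of the parametrization of the arc. -/
def coord (t : ℂ) : ℝ := Function.invFunOn (fun x : ℝ => A.Ξ x) (Icc (-1) 1) t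

lemma coord_Ξ {x : ℝ} (hx : x ∈ Icc (-1:ℝ) 1) : A.coord (A.Ξ x) = x := by
  have hinj : InjOn (fun x : ℝ => A.Ξ x) (Icc (-1) 1) := fun a ha b hb h =>
    Complex.ofReal_injective
      (A.inj (A.seg_sub (ofReal_mem_realSeg ha)) (A.seg_sub (ofReal_mem_realSeg hb)) h)
  exact hinj.leftInvOn_invFunOn hx

lemma exists_bilipschitz : ∃ B : ℝ, 0 ≤ B ∧ ∀ x ∈ Icc (-1:ℝ) 1, ∀ y ∈ Icc (-1:ℝ) 1,
    |x - y| ≤ B * ‖A.Ξ x - A.Ξ y‖ ∧ ‖A.Ξ x - A.Ξ y‖ ≤ B * |x - y| := by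
  obtain ⟨N, B, -, -, hsN, -, hB0, hB⟩ := A.exists_nhd
  refine ⟨B, hB0, fun x hx y hy => ?_⟩
  have h := (hB x (ofReal_mem_realSeg hx) y (hsN (ofReal_mem_realSeg hy))).2
  rwa [← Complex.ofReal_sub, Complex.norm_real, Real.norm_eq_abs] at h

lemma holderI_of_holderOnWith {s : ℝ} (hs : 0 < s) {f : ℂ → ℂ} {C : ℝ≥0}
    (hf : HolderOnWith C s.toNNReal f A.arc) : HolderI s fun x => f (A.Ξ x) := by
  obtain ⟨B, hB0, hB⟩ := A.exists_bilipschitz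
  refine ⟨C * B ^ s, fun x hx y hy => ?_⟩
  have h := hf.dist_le ⟨x, ofReal_mem_realSeg hx, rfl⟩ ⟨y, ofReal_mem_realSeg hy, rfl⟩
  rw [dist_eq_norm, dist_eq_norm, Real.coe_toNNReal _ hs.le] at h
  rw [mul_assoc, ← Real.mul_rpow hB0 (abs_nonneg _)]
  exact h.trans (mul_le_mul_of_nonneg_left
    (Real.rpow_le_rpow (norm_nonneg _) (hB x hx y hy).2 hs.le) C.2)

lemma exists_holderOnWith {s : ℝ} (hs : 0 < s) {v : ℝ → ℂ} (hv : HolderI s v) :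
    ∃ C : ℝ≥0, HolderOnWith C s.toNNReal (fun t => v (A.coord t)) A.arc := by
  obtain ⟨B, hB0, hB⟩ := A.exists_bilipschitz
  obtain ⟨C, hC0, hC⟩ := hv.nonneg_const
  have hCB : 0 ≤ C * B ^ s := by positivity
  refine ⟨(C * B ^ s).toNNReal, ?_⟩
  rintro _ ⟨_, ⟨x, hx, rfl⟩, rfl⟩ _ ⟨_, ⟨y, hy, rfl⟩, rfl⟩
  have h : dist (v x) (v y) ≤ C * B ^ s * dist (A.Ξ x) (A.Ξ y) ^ s := by
    rw [dist_eq_norm, dist_eq_norm, mul_assoc, ← Real.mul_rpow hB0 (norm_nonneg _)]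
    exact (hC x hx y hy).trans (mul_le_mul_of_nonneg_left
      (Real.rpow_le_rpow (abs_nonneg _) (hB x hx y hy).1 hs.le) hC0)
  beta_reduce
  rw [A.coord_Ξ hx, A.coord_Ξ hy, edist_dist, edist_dist, Real.coe_toNNReal _ hs.le,
    ENNReal.ofReal_rpow_of_nonneg dist_nonneg hs.le, ← ENNReal.ofReal,
    ← ENNReal.ofReal_mul hCB]
  exact ENNReal.ofReal_le_ofReal h

theorem exists_arcCm (S : SqrtBranch A) {srp : ℂ → ℂ}
    (hsrp : BVplus A.Ξ S.sr srp) {T : Set ℝ} (hT : GoodExp T) {m : ℕ} {θ : ℂ → ℂ} {ς : ℝ}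
    (hς : 0 < ς) (hς1 : ς ≤ 1) (hTς : ∀ s ∈ T, s ≤ ς) (hθ : ArcCmHolder A m ς θ)
    {SI : ℂ → ℂ} (hSI : ∀ τ ∈ A.arcInt,
      IsPV A (fun t => θ t / srp t) τ ((Real.pi : ℂ) * Complex.I * SI τ)) :
    ∃ (d : ℂ → ℂ) (ℓ : ℂ[X]), ℓ.natDegree ≤ 2 * m + 1 ∧
      (∀ t ∈ A.arcInt, srp t * SI t = d t + srp t * ℓ.eval t) ∧
      ∃ D : ArcCm A m d, (∀ k ≤ m, D.d k 1 = 0 ∧ D.d k (-1) = 0) ∧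
        ∀ s, 0 < s → (∃ s' ∈ T, s ≤ s') → ∃ C : ℝ≥0, HolderOnWith C s.toNNReal (D.d m) A.arc := by
  have hT' := hT.subset
  obtain ⟨D, C, hC⟩ := hθ
  have hcls : HolderClass False T m fun x => θ (A.Ξ x) := by
    have h := holderClass_of_tower (A := A) hT' (E := fun k x => D.d k (A.Ξ x)) D.hd
      fun s hs => (A.holderI_of_holderOnWith hς hC).mono (hTς s hs) hς1 (hT' hs).1
    rwa [D.d0] at h
  obtain ⟨e, ℓ, hℓ, he, heq⟩ := A.exists_decomp S hsrp hT hcls hSI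
  obtain ⟨E, hE0, hE1, hE2, hE3⟩ := exists_tower (A := A) hT' he
  have h1 : A.coord 1 = 1 := by
    simpa [A.map_one] using A.coord_Ξ one_mem_segI
  have h2 : A.coord (-1) = -1 := by
    simpa [A.map_neg_one] using A.coord_Ξ neg_one_mem_segI
  refine ⟨fun t => E 0 (A.coord t), ℓ, hℓ, ?_, ⟨fun k t => E k (A.coord t), rfl, ?_⟩, ?_, ?_⟩
  · rintro _ ⟨⟨_, ⟨x, hx, rfl⟩, rfl⟩, hne⟩
    beta_reduce
    rw [A.coord_Ξ hx, hE0]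
    refine heq x ⟨lt_of_le_of_ne hx.1 ?_, lt_of_le_of_ne hx.2 ?_⟩
    · rintro rfl
      exact hne (Or.inr (by simp [A.map_neg_one]))
    · rintro rfl
      exact hne (Or.inl (by simp [A.map_one]))
  · intro k hk x hx
    rw [A.coord_Ξ hx]
    exact (hE1 k hk x hx).congr (fun y hy => by rw [A.coord_Ξ hy]) (by rw [A.coord_Ξ hx])
  · intro k hk
    simp only [h1, h2]
    exact hE2 k hk trivial
  · rintro s hs ⟨s', hs', hss⟩
    exact A.exists_holderOnWith hs ((hE3 s' hs').mono hss (hT' hs').2.le hs)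

end AnalyticArc

/-- **Hölder smoothness of the singular integral `sr^± S(θ/sr⁺)`**
(Proposition 5.2 of the paper).  If `θ ∈ C^{m,ς}`, `m ≥ 0`, `ς ∈ (0,1]`, then
`sr^± S(θ/sr⁺) = ± d + sr^± ℓ` on `Δ°`, where `d^{(k)}(±1) = 0` for `k ∈ {0,…,m}`,
`ℓ` is a polynomial of degree at most `2m+1`, and `d ∈ C^{m,ς}` when
`ς ∈ (0,1/2) ∪ (1/2,1)`, while `d ∈ C^{m,ς-ε}` for every `ε ∈ (0,ς)` when
`ς = 1/2` or `ς = 1`.  (Since `sr⁻ = -sr⁺`, the two sign choices are equivalent, and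
the `+` version is stated.) -/
theorem singular_integral_holder_smoothness (A : AnalyticArc) (S : SqrtBranch A)
    (srp : ℂ → ℂ) (hsrp : BVplus A.Ξ S.sr srp)
    (θ : ℂ → ℂ) (m : ℕ) (ς : ℝ) (hς : 0 < ς) (hς1 : ς ≤ 1)
    (hθ : ArcCmHolder A m ς θ)
    (SI : ℂ → ℂ)
    (hSI : ∀ τ ∈ A.arcInt,
      IsPV A (fun t => θ t / srp t) τ ((Real.pi : ℂ) * Complex.I * SI τ)) :
    ∃ (d : ℂ → ℂ) (ℓ : Polynomial ℂ), ℓ.natDegree ≤ 2 * m + 1 ∧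
      (∀ t ∈ A.arcInt, srp t * SI t = d t + srp t * ℓ.eval t) ∧
      ∃ D : ArcCm A m d,
        (∀ k ≤ m, D.d k 1 = 0 ∧ D.d k (-1) = 0) ∧
        ((ς ≠ 1/2 ∧ ς ≠ 1) →
          ∃ C : ℝ≥0, HolderOnWith C ς.toNNReal (D.d m) A.arc) ∧
        ((ς = 1/2 ∨ ς = 1) →
          ∀ ε : ℝ, 0 < ε → ε < ς →
            ∃ C : ℝ≥0, HolderOnWith C (ς - ε).toNNReal (D.d m) A.arc) := by
  obtain ⟨T, hT, hTς, hmem, hε⟩ : ∃ T : Set ℝ, GoodExp T ∧ (∀ s ∈ T, s ≤ ς) ∧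
      ((ς ≠ 1/2 ∧ ς ≠ 1) → ς ∈ T) ∧
      ((ς = 1/2 ∨ ς = 1) → ∀ ε : ℝ, 0 < ε → ε < ς → ∃ s ∈ T, ς - ε ≤ s) := by
    rcases eq_or_ne ς 1 with rfl | h1
    · refine ⟨Ioo (1/2) 1, ⟨⟨3/4, by norm_num, by norm_num⟩, Or.inr subset_rfl⟩,
        fun s hs => hs.2.le, fun h => absurd rfl h.2, fun _ ε h0 h1 => ?_⟩
      exact ⟨1 - ε / 2, ⟨by linarith, by linarith⟩, by linarith⟩
    rcases eq_or_ne ς (1/2) with rfl | h2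
    · refine ⟨Ioo 0 (1/2), ⟨⟨1/4, by norm_num, by norm_num⟩, Or.inl subset_rfl⟩,
        fun s hs => hs.2.le, fun h => absurd rfl h.1, fun _ ε h0 h1 => ?_⟩
      exact ⟨1/2 - ε, ⟨by linarith, by linarith⟩, le_rfl⟩
    · refine ⟨{ς}, ⟨singleton_nonempty ς, ?_⟩, fun s hs => hs.le, fun _ => rfl,
        fun h => (h.elim h2 h1).elim⟩
      rcases lt_or_gt_of_ne h2 with h | h
      · exact Or.inl (singleton_subset_iff.2 ⟨hς, h⟩)
      · exact Or.inr (singleton_subset_iff.2 ⟨h, lt_of_le_of_ne hς1 h1⟩)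
  obtain ⟨d, ℓ, hℓ, heq, D, hD, hDs⟩ := A.exists_arcCm S hsrp hT hς hς1 hTς hθ hSI
  exact ⟨d, ℓ, hℓ, heq, D, hD, fun h => hDs ς hς ⟨ς, hmem h, le_rfl⟩,
    fun h ε h0 h1 => hDs (ς - ε) (by linarith) (hε h ε h0 h1)⟩

end
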